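/- Let P be a simple polygon in ℝ² such that: (i) no two distinct edges of P lie on parallel lines and no two edges of P lie on perpendicular lines; (ii) every square inscribed in P has its four vertices in the relative interiors of four pairwise distinct edges of P; and (iii) the collection of vertex sets of squares inscribed in P is finite. Then the number of squares inscribed in P (counted as four-element vertex sets) is odd. -/

import Mathlib

open scoped RealInnerProductSpace

noncomputable section

/-- The Euclidean plane. -/
abbrev Pt := EuclideanSpace ℝ (Fin 2)

/-- Counterclockwise rotation of a vector by `π/2`: `(x, y) ↦ (-y, x)`. -/
def rotCCW (w : Pt) : Pt := (WithLp.equiv 2 (Fin 2 → ℝ)).symm ![-w 1, w 0]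

/-- Clockwise rotation of a vector by `π/2`: `(x, y) ↦ (y, -x)`. -/
def rotCW (w : Pt) : Pt := (WithLp.equiv 2 (Fin 2 → ℝ)).symm ![w 1, -w 0]

/-- `v : ZMod n → Pt` (with `3 ≤ n`) is a simple polygon: consecutive vertices are
distinct, consecutive edges meet exactly in their common vertex, and
non-consecutive edges are disjoint. -/
def IsSimplePolygon {n : ℕ} (v : ZMod n → Pt) : Prop :=
  3 ≤ n ∧
  (∀ i, v i ≠ v (i + 1)) ∧
  (∀ i : ZMod n,
    segment ℝ (v i) (v (i + 1)) ∩ segment ℝ (v (i + 1)) (v (i + 2)) = {v (i + 1)}) ∧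
  (∀ i j : ZMod n, i ≠ j → i ≠ j + 1 → j ≠ i + 1 →
    segment ℝ (v i) (v (i + 1)) ∩ segment ℝ (v j) (v (j + 1)) = ∅)

/-- The polygon itself: the union of its edges. -/
def polygonSet {n : ℕ} (v : ZMod n → Pt) : Set Pt :=
  ⋃ i : ZMod n, segment ℝ (v i) (v (i + 1))

/-- Four distinct points of `P` forming the vertices of a (nondegenerate) square:
`a₂ - a₁ = a₃ - a₄` and `a₃ - a₂` is the rotation of `a₂ - a₁` by `π/2`. -/
def InscribedSquare (P : Set Pt) (a₁ a₂ a₃ a₄ : Pt) : Prop :=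
  a₁ ∈ P ∧ a₂ ∈ P ∧ a₃ ∈ P ∧ a₄ ∈ P ∧
  a₂ - a₁ = a₃ - a₄ ∧ a₃ - a₂ = rotCCW (a₂ - a₁) ∧
  a₁ ≠ a₂ ∧ a₁ ≠ a₃ ∧ a₁ ≠ a₄ ∧ a₂ ≠ a₃ ∧ a₂ ≠ a₄ ∧ a₃ ≠ a₄

section Deformation

set_option linter.unusedSimpArgs false
set_option linter.unusedSectionVars false

open Filter Topology Complex

/-- The indicator of a proposition, with values in `ZMod 2`. -/
noncomputable def ind (p : Prop) : ZMod 2 := by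
  classical exact if p then 1 else 0

lemma ind_true {p : Prop} (h : p) : ind p = 1 := by simp [ind, h]

lemma ind_false {p : Prop} (h : ¬ p) : ind p = 0 := by simp [ind, h]

lemma ind_congr {p q : Prop} (h : p ↔ q) : ind p = ind q := by rw [propext h]

lemma zmod2_add_self (x : ZMod 2) : x + x = 0 := CharTwo.add_self_eq_zero x

section LineParity

variable {ι : Type*} [Fintype ι] {α β : ι → ℝ}

lemma exists_small_move {a s : ℝ} (ha : ∀ r, 0 ≤ α r + β r * a)
    (hs : ∀ r, α r + β r * a = 0 → 0 ≤ β r * s) :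
    ∃ ε > 0, ∀ r, 0 ≤ α r + β r * (a + s * ε) := by
  have key : ∀ r, ∀ᶠ ε in 𝓝[>] (0 : ℝ), 0 ≤ α r + β r * (a + s * ε) := by
    intro r
    rcases (ha r).eq_or_lt with h | h
    · filter_upwards [self_mem_nhdsWithin] with ε hε
      have := mul_nonneg (hs r h.symm) (le_of_lt hε)
      linarith
    · have hc : Tendsto (fun ε : ℝ => α r + β r * (a + s * ε)) (𝓝[>] 0)
          (𝓝 (α r + β r * (a + s * 0))) :=
        (Continuous.tendsto (by fun_prop) 0).mono_left nhdsWithin_le_nhds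
      have := hc.eventually (lt_mem_nhds (a := 0) (by simpa using h))
      filter_upwards [this] with ε hε using hε.le
  have := (eventually_all.2 key).and self_mem_nhdsWithin
  obtain ⟨ε, h1, h2⟩ := this.exists
  exact ⟨ε, h2, h1⟩

lemma line_hit_unique {Sp : ℝ → Prop}
    (hbdd : ∃ B, ∀ u, (∀ r, 0 ≤ α r + β r * u) → |u| ≤ B)
    (hSp : ∀ u v, u ≠ v → Sp u → Sp v → ∀ w, Sp w)
    (h1 : ∀ u, (∀ r, 0 ≤ α r + β r * u) → ¬ Sp u →
      ∀ r s, α r + β r * u = 0 → α s + β s * u = 0 → r = s)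
    (h2 : ∀ u, (∀ r, 0 ≤ α r + β r * u) → Sp u →
      ∃ r s, r ≠ s ∧ α r + β r * u = 0 ∧ α s + β s * u = 0) (r : ι) {u v : ℝ}
    (hu : α r + β r * u = 0) (hu' : ∀ s, s ≠ r → 0 < α s + β s * u)
    (hv : α r + β r * v = 0) (hv' : ∀ s, s ≠ r → 0 < α s + β s * v) : u = v := by
  classical
  by_contra huv
  have hβ : β r = 0 := by
    have : β r * (u - v) = 0 := by linarith
    exact (mul_eq_zero.1 this).resolve_right (sub_ne_zero.2 huv)
  have hα : α r = 0 := by simpa [hβ] using hu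
  set K : Set ℝ := {u | ∀ r, 0 ≤ α r + β r * u}
  have hKc : IsClosed K := by
    have : K = ⋂ r, {u | 0 ≤ α r + β r * u} := by ext; simp [K]
    rw [this]
    exact isClosed_iInter fun r => isClosed_le continuous_const (by fun_prop)
  have hK : IsCompact K := by
    obtain ⟨B, hB⟩ := hbdd
    refine Metric.isCompact_of_isClosed_isBounded hKc ?_
    refine (Metric.isBounded_Icc (-B) B).subset fun u hu => ?_
    exact abs_le.1 (hB u hu)
  have huK : u ∈ K := fun s => by
    by_cases h : s = r
    · subst h; exact hu.ge
    · exact (hu' s h).le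
  have hvK : v ∈ K := fun s => by
    by_cases h : s = r
    · subst h; exact hv.ge
    · exact (hv' s h).le
  obtain ⟨a, ha⟩ := hK.exists_isLeast ⟨u, huK⟩
  obtain ⟨b, hb⟩ := hK.exists_isGreatest ⟨u, huK⟩
  have hab : a < b := by
    rcases lt_or_gt_of_ne huv with h | h
    · exact (ha.2 huK).trans_lt (h.trans_le (hb.2 hvK))
    · exact (ha.2 hvK).trans_lt (h.trans_le (hb.2 huK))
  have hspa : Sp a := by
    by_contra hsp
    have := h1 a ha.1 hsp r
    obtain ⟨ε, hε, h⟩ := exists_small_move (s := -1) ha.1 (fun s hs => by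
      have := this s (by simp [hα, hβ]) hs
      subst this; simp [hβ])
    have := ha.2 (show a + -1 * ε ∈ K from h)
    linarith
  have hspb : Sp b := by
    by_contra hsp
    have := h1 b hb.1 hsp r
    obtain ⟨ε, hε, h⟩ := exists_small_move (s := 1) hb.1 (fun s hs => by
      have := this s (by simp [hα, hβ]) hs
      subst this; simp [hβ])
    have := hb.2 (show b + 1 * ε ∈ K from h)
    linarith
  obtain ⟨s, t, hst, hs, ht⟩ := h2 u huK (hSp a b hab.ne hspa hspb u)
  by_cases h : s = r
  · exact (hu' t (fun h' => hst (h.trans h'.symm))).ne' ht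
  · exact (hu' s h).ne' hs

theorem line_parity {Sp : ℝ → Prop}
    (hbdd : ∃ B, ∀ u, (∀ r, 0 ≤ α r + β r * u) → |u| ≤ B)
    (hSp : ∀ u v, u ≠ v → Sp u → Sp v → ∀ w, Sp w)
    (h1 : ∀ u, (∀ r, 0 ≤ α r + β r * u) → ¬ Sp u →
      ∀ r s, α r + β r * u = 0 → α s + β s * u = 0 → r = s)
    (h2 : ∀ u, (∀ r, 0 ≤ α r + β r * u) → Sp u →
      ∃ r s, r ≠ s ∧ α r + β r * u = 0 ∧ α s + β s * u = 0) :
    ∑ r, ind (∃ u, α r + β r * u = 0 ∧ ∀ s, s ≠ r → 0 < α s + β s * u) +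
      ind ((∃ u, ∀ r, 0 < α r + β r * u) ∧ ∃ u, (∀ r, 0 ≤ α r + β r * u) ∧ Sp u) = 0 := by
  classical
  set K : Set ℝ := {u | ∀ r, 0 ≤ α r + β r * u}
  have hKc : IsClosed K := by
    have : K = ⋂ r, {u | 0 ≤ α r + β r * u} := by ext; simp [K]
    rw [this]
    exact isClosed_iInter fun r => isClosed_le continuous_const (by fun_prop)
  have hK : IsCompact K := by
    obtain ⟨B, hB⟩ := hbdd
    refine Metric.isCompact_of_isClosed_isBounded hKc ?_
    refine (Metric.isBounded_Icc (-B) B).subset fun u hu => ?_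
    exact abs_le.1 (hB u hu)
  have hitK : ∀ r u, α r + β r * u = 0 → (∀ s, s ≠ r → 0 < α s + β s * u) →
      u ∈ K ∧ ¬ Sp u := by
    intro r u hu hu'
    have hu2 : u ∈ K := fun s => by
      by_cases h : s = r
      · subst h; exact hu.ge
      · exact (hu' s h).le
    refine ⟨hu2, fun hsp => ?_⟩
    obtain ⟨s, t, hst, hs, ht⟩ := h2 u hu2 hsp
    by_cases h : s = r
    · exact (hu' t (fun h' => hst (h.trans h'.symm))).ne' ht
    · exact (hu' s h).ne' hs
  rcases K.eq_empty_or_nonempty with hE | hne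
  · have e1 : ∀ u, ¬ ∀ r, 0 ≤ α r + β r * u := fun u hu => by
      have : u ∈ K := hu
      simp [hE] at this
    rw [ind_false (fun h => by obtain ⟨-, u, hu, -⟩ := h; exact e1 u hu), Finset.sum_eq_zero, add_zero]
    rintro r -
    exact ind_false fun ⟨u, hu, hu'⟩ => e1 u (hitK r u hu hu').1
  obtain ⟨a, ha⟩ := hK.exists_isLeast hne
  obtain ⟨b, hb⟩ := hK.exists_isGreatest hne
  have hra : ∃ r, α r + β r * a = 0 ∧ 0 < β r := by
    by_contra! h
    obtain ⟨ε, hε, h⟩ := exists_small_move (s := -1) ha.1 (fun s hs => by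
      have := h s hs
      linarith)
    have := ha.2 (show a + -1 * ε ∈ K from h)
    linarith
  have hrb : ∃ r, α r + β r * b = 0 ∧ β r < 0 := by
    by_contra! h
    obtain ⟨ε, hε, h⟩ := exists_small_move (s := 1) hb.1 (fun s hs => by
      have := h s hs
      linarith)
    have := hb.2 (show b + 1 * ε ∈ K from h)
    linarith
  obtain ⟨ra, hra, hra'⟩ := hra
  obtain ⟨rb, hrb, hrb'⟩ := hrb
  have hrab : ra ≠ rb := by rintro rfl; linarith
  rcases (ha.2 hb.1).eq_or_lt with hab | hab
  · subst hab
    have hsp : Sp a := by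
      by_contra hsp
      exact hrab (h1 a ha.1 hsp _ _ hra hrb)
    have e1 : ∀ u ∈ K, u = a := fun u hu => le_antisymm (hb.2 hu) (ha.2 hu)
    rw [ind_false (fun h => ?_), Finset.sum_eq_zero, add_zero]
    · rintro r -
      refine ind_false fun ⟨u, hu, hu'⟩ => ?_
      obtain ⟨h3, h4⟩ := hitK r u hu hu'
      rw [e1 u h3] at h4
      exact h4 hsp
    · obtain ⟨⟨u, hu⟩, -⟩ := h
      have := e1 u (fun r => (hu r).le)
      subst this
      exact (hu ra).ne' hra
  by_cases hz : ∃ r, α r + β r * a = 0 ∧ α r + β r * b = 0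
  · obtain ⟨r0, hr0, hr0'⟩ := hz
    have hβ : β r0 = 0 := by
      have : β r0 * (a - b) = 0 := by linarith
      exact (mul_eq_zero.1 this).resolve_right (sub_ne_zero.2 hab.ne)
    have hα : α r0 = 0 := by simpa [hβ] using hr0
    have hspa : Sp a := by
      by_contra hsp
      have := h1 a ha.1 hsp _ _ hra hr0
      rw [this] at hra'
      exact hra'.ne' hβ
    have hspb : Sp b := by
      by_contra hsp
      have := h1 b hb.1 hsp _ _ hrb hr0'
      rw [this] at hrb'
      exact hrb'.ne hβ
    have hall := hSp a b hab.ne hspa hspb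
    rw [ind_false (fun h => ?_), Finset.sum_eq_zero, add_zero]
    · rintro r -
      exact ind_false fun ⟨u, hu, hu'⟩ => (hitK r u hu hu').2 (hall u)
    · obtain ⟨⟨u, hu⟩, -⟩ := h
      have := hu r0
      simp [hα, hβ] at this
  push Not at hz
  have h_pos : ∀ u, a < u → u < b → ∀ r, 0 < α r + β r * u := by
    intro u hau hub r
    have hA := ha.1 r
    have hB := hb.1 r
    have hz' := hz r
    by_contra! hcon
    have hβ1 : β r * (u - a) ≤ 0 := by linarith
    have hβ2 : 0 ≤ β r * (b - u) := by linarith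
    have hβ3 : β r ≤ 0 := by
      by_contra! h; nlinarith
    have hβ4 : 0 ≤ β r := by
      by_contra! h; nlinarith
    have hβ : β r = 0 := le_antisymm hβ3 hβ4
    simp only [hβ, zero_mul, add_zero] at hA hcon hz'
    exact hz' (le_antisymm hcon hA) (le_antisymm hcon hA)
  have hspint : ∀ u, a < u → u < b → ¬ Sp u := by
    intro u hau hub hsp
    obtain ⟨r, -, -, hr, -⟩ := h2 u (fun r => (h_pos u hau hub r).le) hsp
    exact (h_pos u hau hub r).ne' hr
  have hnot : ¬ (Sp a ∧ Sp b) := fun ⟨h, h'⟩ =>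
    hspint ((a + b) / 2) (by linarith) (by linarith) (hSp a b hab.ne h h' _)
  have hKab : ∀ u ∈ K, u = a ∨ u = b ∨ (a < u ∧ u < b) := by
    intro u hu
    rcases (ha.2 hu).eq_or_lt with h | h
    · exact Or.inl h.symm
    rcases (hb.2 hu).eq_or_lt with h' | h'
    · exact Or.inr (Or.inl h')
    · exact Or.inr (Or.inr ⟨h, h'⟩)
  have hhit : ∀ r, ind (∃ u, α r + β r * u = 0 ∧ ∀ s, s ≠ r → 0 < α s + β s * u) =
      (if r = ra then ind (¬ Sp a) else 0) + (if r = rb then ind (¬ Sp b) else 0) := by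
    intro r
    have hA : ¬ Sp a → ∀ s, s ≠ ra → 0 < α s + β s * a := fun h s hs =>
      lt_of_le_of_ne (ha.1 s) fun h' => hs (h1 a ha.1 h _ _ h'.symm hra)
    have hB : ¬ Sp b → ∀ s, s ≠ rb → 0 < α s + β s * b := fun h s hs =>
      lt_of_le_of_ne (hb.1 s) fun h' => hs (h1 b hb.1 h _ _ h'.symm hrb)
    by_cases hr : r = ra
    · subst hr
      rw [if_pos rfl, if_neg hrab, add_zero]
      refine ind_congr ⟨?_, fun h => ⟨a, hra, hA h⟩⟩
      rintro ⟨u, hu, hu'⟩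
      obtain ⟨h3, h4⟩ := hitK r u hu hu'
      rcases hKab u h3 with h | h | h
      · exact h ▸ h4
      · subst h; exact absurd hrb (hu' rb hrab.symm).ne'
      · exact absurd hu (h_pos u h.1 h.2 r).ne'
    · rw [if_neg hr, zero_add]
      by_cases hr' : r = rb
      · subst hr'
        rw [if_pos rfl]
        refine ind_congr ⟨?_, fun h => ⟨b, hrb, hB h⟩⟩
        rintro ⟨u, hu, hu'⟩
        obtain ⟨h3, h4⟩ := hitK r u hu hu'
        rcases hKab u h3 with h | h | h
        · subst h; exact absurd hra (hu' ra hrab).ne'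
        · exact h ▸ h4
        · exact absurd hu (h_pos u h.1 h.2 r).ne'
      · rw [if_neg hr']
        refine ind_false ?_
        rintro ⟨u, hu, hu'⟩
        obtain ⟨h3, h4⟩ := hitK r u hu hu'
        rcases hKab u h3 with h | h | h
        · subst h; exact hr (h1 u h3 h4 _ _ hu hra)
        · subst h; exact hr' (h1 u h3 h4 _ _ hu hrb)
        · exact absurd hu (h_pos u h.1 h.2 r).ne'
  rw [Finset.sum_congr rfl (fun r _ => hhit r), Finset.sum_add_distrib, Finset.sum_ite_eq',
    Finset.sum_ite_eq', if_pos (Finset.mem_univ _), if_pos (Finset.mem_univ _)]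
  have hend : ind ((∃ u, ∀ r, 0 < α r + β r * u) ∧ ∃ u, (∀ r, 0 ≤ α r + β r * u) ∧ Sp u) =
      ind (Sp a ∨ Sp b) := by
    refine ind_congr ⟨?_, ?_⟩
    · rintro ⟨-, u, hu, hsp⟩
      rcases hKab u hu with h | h | h
      · exact Or.inl (h ▸ hsp)
      · exact Or.inr (h ▸ hsp)
      · exact absurd hsp (hspint u h.1 h.2)
    · refine fun h => ⟨⟨(a + b) / 2, h_pos _ (by linarith) (by linarith)⟩, ?_⟩
      rcases h with h | h
      · exact ⟨a, ha.1, h⟩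
      · exact ⟨b, hb.1, h⟩
  rw [hend]
  by_cases h : Sp a <;> by_cases h' : Sp b
  · exact absurd ⟨h, h'⟩ hnot
  · simp [ind, h, h']; decide
  · simp [ind, h, h']; decide
  · simp [ind, h, h']; decide

end LineParity

section CellParity

/-- A real function is affine along every line. -/
def AffineFun {m : ℕ} (c : (Fin m → ℝ) → ℝ) : Prop :=
  ∀ x d : Fin m → ℝ, ∀ u : ℝ, c (x + u • d) = c x + (c (x + d) - c x) * u

/-- A subset of `ℝᵐ` cut out by a surjective linear system of corank one. -/
def IsSystemLine {m : ℕ} (S : Set (Fin m → ℝ)) : Prop :=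
  ∃ x₀ d : Fin m → ℝ, d ≠ 0 ∧ ∀ x, x ∈ S ↔ ∃ u : ℝ, x = x₀ + u • d

lemma isSystemLine_of_surjective {m : ℕ} {F : Type*} [AddCommGroup F] [Module ℝ F]
    [FiniteDimensional ℝ F] (hF : Module.finrank ℝ F = m)
    (f : (Fin (m + 1) → ℝ) →ₗ[ℝ] F) (hf : Function.Surjective f) (b : F)
    {S : Set (Fin (m + 1) → ℝ)} (hS : ∀ x, x ∈ S ↔ f x = b) : IsSystemLine S := by
  have h1 := f.finrank_range_add_finrank_ker
  rw [LinearMap.range_eq_top.2 hf, finrank_top, hF, Module.finrank_fin_fun] at h1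
  have h2 : Module.finrank ℝ (LinearMap.ker f) = 1 := by omega
  obtain ⟨⟨d, hd⟩, hd0, hspan⟩ := finrank_eq_one_iff'.1 h2
  obtain ⟨x₀, hx₀⟩ := hf b
  refine ⟨x₀, d, fun h => hd0 (Subtype.ext h), fun x => ?_⟩
  rw [hS]
  constructor
  · intro hx
    obtain ⟨c, hc⟩ := hspan ⟨x - x₀, by simp [hx, hx₀]⟩
    refine ⟨c, ?_⟩
    have : c • d = x - x₀ := congrArg Subtype.val hc
    rw [this]; abel
  · rintro ⟨u, rfl⟩
    have : f d = 0 := hd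
    simp [this, hx₀]

variable {m : ℕ} {ι : Type*} [Fintype ι] {S : Set (Fin m → ℝ)} {c : ι → (Fin m → ℝ) → ℝ}
  {Sp : (Fin m → ℝ) → Prop}

lemma line_data (hS : IsSystemLine S) (hc : ∀ r, AffineFun (c r))
    (hbox : ∀ x ∈ S, (∀ r, 0 ≤ c r x) → ∀ s, 0 ≤ x s ∧ x s ≤ 1)
    (hSp : ∀ x d, ∀ u v : ℝ, u ≠ v → Sp (x + u • d) → Sp (x + v • d) → ∀ w : ℝ, Sp (x + w • d))
    (h1 : ∀ x ∈ S, (∀ r, 0 ≤ c r x) → ¬ Sp x → ∀ r s, c r x = 0 → c s x = 0 → r = s)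
    (h2 : ∀ x ∈ S, (∀ r, 0 ≤ c r x) → Sp x → ∃ r s, r ≠ s ∧ c r x = 0 ∧ c s x = 0) :
    ∃ x₀ d : Fin m → ℝ, d ≠ 0 ∧ (∀ x, x ∈ S ↔ ∃ u : ℝ, x = x₀ + u • d) ∧ ∃ α β : ι → ℝ,
      (∀ r u, c r (x₀ + u • d) = α r + β r * u) ∧
      (∃ B, ∀ u, (∀ r, 0 ≤ α r + β r * u) → |u| ≤ B) ∧
      (∀ u v : ℝ, u ≠ v → Sp (x₀ + u • d) → Sp (x₀ + v • d) → ∀ w : ℝ, Sp (x₀ + w • d)) ∧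
      (∀ u : ℝ, (∀ r, 0 ≤ α r + β r * u) → ¬ Sp (x₀ + u • d) →
        ∀ r s, α r + β r * u = 0 → α s + β s * u = 0 → r = s) ∧
      (∀ u : ℝ, (∀ r, 0 ≤ α r + β r * u) → Sp (x₀ + u • d) →
        ∃ r s, r ≠ s ∧ α r + β r * u = 0 ∧ α s + β s * u = 0) := by
  obtain ⟨x₀, d, hd, hS⟩ := hS
  have hab : ∀ r, ∀ u : ℝ, c r (x₀ + u • d) = c r x₀ + (c r (x₀ + d) - c r x₀) * u :=
    fun r u => hc r _ _ _
  have hmem : ∀ u : ℝ, x₀ + u • d ∈ S := fun u => (hS _).2 ⟨u, rfl⟩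
  refine ⟨x₀, d, hd, hS, fun r => c r x₀, fun r => c r (x₀ + d) - c r x₀, hab, ?_, hSp _ _, ?_, ?_⟩
  · obtain ⟨s, hs⟩ : ∃ s, d s ≠ 0 := by
      by_contra! h; exact hd (funext h)
    refine ⟨(1 + |x₀ s|) / |d s|, fun u hu => ?_⟩
    simp_rw [← hab] at hu
    have := hbox _ (hmem u) hu s
    simp only [Pi.add_apply, Pi.smul_apply, smul_eq_mul] at this
    rw [le_div_iff₀ (abs_pos.2 hs), ← abs_mul]
    have h3 : u * d s = (x₀ s + u * d s) - x₀ s := by ring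
    rw [h3]
    refine (abs_sub _ _).trans ?_
    have : |x₀ s + u * d s| ≤ 1 := abs_le.2 ⟨by linarith, this.2⟩
    linarith
  · intro u hu hsp r s
    simp_rw [← hab] at hu ⊢
    exact h1 _ (hmem u) hu hsp r s
  · intro u hu hsp
    simp_rw [← hab] at hu ⊢
    exact h2 _ (hmem u) hu hsp

theorem cell_parity (hS : IsSystemLine S) (hc : ∀ r, AffineFun (c r))
    (hbox : ∀ x ∈ S, (∀ r, 0 ≤ c r x) → ∀ s, 0 ≤ x s ∧ x s ≤ 1)
    (hSp : ∀ x d, ∀ u v : ℝ, u ≠ v → Sp (x + u • d) → Sp (x + v • d) → ∀ w : ℝ, Sp (x + w • d))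
    (h1 : ∀ x ∈ S, (∀ r, 0 ≤ c r x) → ¬ Sp x → ∀ r s, c r x = 0 → c s x = 0 → r = s)
    (h2 : ∀ x ∈ S, (∀ r, 0 ≤ c r x) → Sp x → ∃ r s, r ≠ s ∧ c r x = 0 ∧ c s x = 0) :
    ∑ r, ind (∃ x ∈ S, c r x = 0 ∧ ∀ s, s ≠ r → 0 < c s x) +
      ind ((∃ x ∈ S, ∀ r, 0 < c r x) ∧ ∃ x ∈ S, (∀ r, 0 ≤ c r x) ∧ Sp x) = 0 := by
  obtain ⟨x₀, d, -, hS, α, β, hab, hB, h3, h4, h5⟩ := line_data hS hc hbox hSp h1 h2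
  have key : ∀ Q : (Fin m → ℝ) → Prop, (∃ x ∈ S, Q x) ↔ ∃ u : ℝ, Q (x₀ + u • d) := by
    intro Q
    constructor
    · rintro ⟨x, hx, hq⟩
      obtain ⟨u, rfl⟩ := (hS x).1 hx
      exact ⟨u, hq⟩
    · rintro ⟨u, hq⟩
      exact ⟨_, (hS _).2 ⟨u, rfl⟩, hq⟩
  simp_rw [key, hab]
  exact line_parity hB h3 h4 h5

theorem cell_hit_unique (hS : IsSystemLine S) (hc : ∀ r, AffineFun (c r))
    (hbox : ∀ x ∈ S, (∀ r, 0 ≤ c r x) → ∀ s, 0 ≤ x s ∧ x s ≤ 1)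
    (hSp : ∀ x d, ∀ u v : ℝ, u ≠ v → Sp (x + u • d) → Sp (x + v • d) → ∀ w : ℝ, Sp (x + w • d))
    (h1 : ∀ x ∈ S, (∀ r, 0 ≤ c r x) → ¬ Sp x → ∀ r s, c r x = 0 → c s x = 0 → r = s)
    (h2 : ∀ x ∈ S, (∀ r, 0 ≤ c r x) → Sp x → ∃ r s, r ≠ s ∧ c r x = 0 ∧ c s x = 0) (r : ι)
    {x y : Fin m → ℝ} (hx : x ∈ S) (hy : y ∈ S) (hxr : c r x = 0)
    (hx' : ∀ s, s ≠ r → 0 < c s x) (hyr : c r y = 0)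
    (hy' : ∀ s, s ≠ r → 0 < c s y) : x = y := by
  obtain ⟨x₀, d, -, hS, α, β, hab, hB, h3, h4, h5⟩ := line_data hS hc hbox hSp h1 h2
  obtain ⟨u, rfl⟩ := (hS x).1 hx
  obtain ⟨v, rfl⟩ := (hS y).1 hy
  simp_rw [hab] at hxr hyr hx' hy'
  rw [line_hit_unique hB h3 h4 h5 r hxr hx' hyr hy']

end CellParity

/-- The cross product of two plane vectors. -/
def crs (a b : ℂ) : ℝ := a.re * b.im - a.im * b.re

/-- The dot product of two plane vectors. -/
def dt (a b : ℂ) : ℝ := a.re * b.re + a.im * b.im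

lemma exists_real_combination {u v : ℂ} (h : crs u v ≠ 0) (p : ℂ) :
    ∃ a b : ℝ, p = a * u + b * v := by
  refine ⟨crs p v / crs u v, crs u p / crs u v, ?_⟩
  have h1 : p.re * crs u v = crs p v * u.re + crs u p * v.re := by simp [crs]; ring
  have h2 : p.im * crs u v = crs p v * u.im + crs u p * v.im := by simp [crs]; ring
  apply Complex.ext
  · simp only [add_re, re_ofReal_mul]; field_simp; exact h1
  · simp only [add_im, im_ofReal_mul]; field_simp; exact h2

lemma crs_I_mul (u v : ℂ) : crs u (I * v) = dt u v := by simp [crs, dt]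

/-- The `i`-th edge vector. -/
noncomputable def ed (V : ℕ → ℂ) (i : ℕ) : ℂ := V (i + 1) - V i

/-- The point with parameter `x` on the `i`-th edge. -/
noncomputable def pt (V : ℕ → ℂ) (i : ℕ) (x : ℝ) : ℂ := V i + x * ed V i

lemma pt_zero (V : ℕ → ℂ) (i : ℕ) : pt V i 0 = V i := by simp [pt]

lemma pt_one (V : ℕ → ℂ) (i : ℕ) : pt V i 1 = V (i + 1) := by simp [pt, ed]

/-- The solutions of the two square equations, up to horizontal displacement of the midpoints. -/
def SqLine (V : ℕ → ℂ) (i k j l : ℕ) : Set (Fin 4 → ℝ) :=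
  {x | pt V k (x 2) - pt V i (x 0) = I * (pt V l (x 3) - pt V j (x 1)) ∧
    (pt V i (x 0) + pt V k (x 2) - pt V j (x 1) - pt V l (x 3)).im = 0}

/-- The parameter of an endpoint of an edge. -/
def IsEnd (x : ℝ) : Prop := x = 0 ∨ x = 1

/-- The position data of a polygon in general position, with lowest vertex `V 0`. -/
structure Core (V : ℕ → ℂ) (n : ℕ) : Prop where
  three : 3 ≤ n
  per : ∀ i, V (i + n) = V i
  crs_ne : ∀ i < n, ∀ j < n, i ≠ j → crs (ed V i) (ed V j) ≠ 0
  dt_ne : ∀ i < n, ∀ j < n, dt (ed V i) (ed V j) ≠ 0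
  simple : ∀ i j, i < j → j < n → ∀ x y : ℝ, 0 ≤ x → x ≤ 1 → 0 ≤ y → y ≤ 1 →
    pt V i x = pt V j y → (j = i + 1 ∧ x = 1 ∧ y = 0) ∨ (i = 0 ∧ j + 1 = n ∧ x = 0 ∧ y = 1)
  im_ne : ∀ a < n, ∀ b < n, a ≠ b → (V a).im ≠ (V b).im
  bot : ∀ a, 0 < a → a < n → (V 0).im < (V a).im
  two_vertices : ∀ i < n, ∀ k < n, ∀ j < n, ∀ l < n, ∀ x ∈ SqLine V i k j l,
    (∀ r, 0 ≤ x r ∧ x r ≤ 1) → pt V i (x 0) ≠ pt V k (x 2) →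
    ∀ r s, IsEnd (x r) → IsEnd (x s) → r = s
  no_vertex : ∀ i < n, ∀ k < n, ∀ j < n, ∀ l < n, ∀ x ∈ SqLine V i k j l,
    (∀ r, 0 ≤ x r ∧ x r ≤ 1) → pt V i (x 0) ≠ pt V k (x 2) →
    pt V i (x 0) + pt V k (x 2) = pt V j (x 1) + pt V l (x 3) → ∀ r, ¬ IsEnd (x r)
  transverse : ∀ i < n, ∀ k < n, ∀ j < n, ∀ l < n, ∃ w : Fin 4 → ℝ,
    w 2 * ed V k - w 0 * ed V i = I * (w 3 * ed V l - w 1 * ed V j) ∧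
    (w 0 * ed V i + w 2 * ed V k - w 1 * ed V j - w 3 * ed V l).im ≠ 0
  base_vertices : ∀ j < n, ∀ l < n, ∀ m < n, ∀ x : Fin 3 → ℝ, (∀ r, 0 ≤ x r ∧ x r ≤ 1) →
    pt V m (x 2) - V 0 = I * (pt V l (x 1) - pt V j (x 0)) → pt V j (x 0) ≠ pt V l (x 1) →
    ∀ r s, IsEnd (x r) → IsEnd (x s) → r = s
  base_fst : ((|crs (ed V 0) (-ed V (n - 1))| - dt (ed V 0) (-ed V (n - 1)) : ℝ) * ed V 0 -
    normSq (ed V 0) * (-ed V (n - 1)) : ℂ).im ≠ 0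
  base_snd : ((|crs (ed V 0) (-ed V (n - 1))| - dt (ed V 0) (-ed V (n - 1)) : ℝ) *
    (-ed V (n - 1)) - normSq (ed V (n - 1)) * ed V 0 : ℂ).im ≠ 0

/-- The four inequalities describing two points in order on the polygon; `b` says that they lie
on different edges. -/
noncomputable def ch (b : Prop) [Decidable b] (x y : ℝ) : Fin 4 → ℝ :=
  ![x, 1 - y, if b then 1 - x else y - x, if b then y else 1]

/-- Two points in the interior of the edges `i ≤ k`, in order. -/
def Sepd (i k : ℕ) (x y : ℝ) : Prop := (0 < x ∧ x < 1) ∧ (0 < y ∧ y < 1) ∧ (i = k → x < y)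

lemma ch_pos_iff {i k : ℕ} (h : i ≤ k) {x y : ℝ} :
    (∀ q, 0 < ch (i < k) x y q) ↔ Sepd i k x y := by
  rcases h.lt_or_eq with h | h
  · simp [Fin.forall_fin_succ, ch, h, Sepd, h.ne]; tauto
  · subst h
    simp only [ch, lt_irrefl, if_false, Fin.forall_fin_succ, Sepd]
    simp
    constructor
    · rintro ⟨h1, h2, h3⟩; exact ⟨⟨h1, h3.trans h2⟩, ⟨h1.trans h3, h2⟩, h3⟩
    · rintro ⟨⟨h1, h2⟩, ⟨h3, h4⟩, h5⟩; exact ⟨h1, h4, h5⟩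

lemma ch_nonneg_box {i k : ℕ} (h : i ≤ k) {x y : ℝ} (hq : ∀ q, 0 ≤ ch (i < k) x y q) :
    (0 ≤ x ∧ x ≤ 1) ∧ (0 ≤ y ∧ y ≤ 1) ∧ (i = k → x ≤ y) := by
  have h0 := hq 0
  have h1 := hq 1
  have h2 := hq 2
  have h3 := hq 3
  rcases h.lt_or_eq with h | h
  · simp [ch, h] at h0 h1 h2 h3
    exact ⟨⟨h0, h2⟩, ⟨h3, h1⟩, fun h' => absurd h' h.ne⟩
  · subst h
    simp [ch] at h0 h1 h2 h3
    exact ⟨⟨h0, by linarith⟩, ⟨by linarith, h1⟩, fun _ => h2⟩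

lemma ch_hit_zero {i k : ℕ} (h : i ≤ k) {x y : ℝ} :
    (ch (i < k) x y 0 = 0 ∧ ∀ s, s ≠ 0 → 0 < ch (i < k) x y s) ↔ x = 0 ∧ 0 < y ∧ y < 1 := by
  rcases h.lt_or_eq with h | h
  · simp [Fin.forall_fin_succ, ch, h]
    rintro rfl
    norm_num
    tauto
  · subst h
    simp [Fin.forall_fin_succ, ch]
    rintro rfl
    tauto

lemma ch_hit_one {i k : ℕ} (h : i ≤ k) {x y : ℝ} :
    (ch (i < k) x y 1 = 0 ∧ ∀ s, s ≠ 1 → 0 < ch (i < k) x y s) ↔ y = 1 ∧ 0 < x ∧ x < 1 := by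
  rcases h.lt_or_eq with h | h
  · simp [Fin.forall_fin_succ, ch, h]
    constructor
    · rintro ⟨h1, h2, h3, h4⟩; exact ⟨by linarith, h2, h3⟩
    · rintro ⟨rfl, h2, h3⟩; simp [h2, h3]
  · subst h
    simp [Fin.forall_fin_succ, ch]
    constructor
    · rintro ⟨h1, h2, h3⟩; exact ⟨by linarith, h2, by linarith⟩
    · rintro ⟨rfl, h2, h3⟩; simp [h2, h3]

lemma ch_hit_two {i k : ℕ} (h : i < k) {x y : ℝ} :
    (ch (i < k) x y 2 = 0 ∧ ∀ s, s ≠ 2 → 0 < ch (i < k) x y s) ↔ x = 1 ∧ 0 < y ∧ y < 1 := by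
  simp [Fin.forall_fin_succ, ch, h]
  constructor
  · rintro ⟨h1, h2, h3, h4⟩; exact ⟨by linarith, h4, by linarith⟩
  · rintro ⟨rfl, h2, h3⟩; simp [h2, h3]

lemma ch_hit_three {i k : ℕ} (h : i < k) {x y : ℝ} :
    (ch (i < k) x y 3 = 0 ∧ ∀ s, s ≠ 3 → 0 < ch (i < k) x y s) ↔ y = 0 ∧ 0 < x ∧ x < 1 := by
  simp [Fin.forall_fin_succ, ch, h]
  rintro rfl
  norm_num

lemma ch_three_ne {i k : ℕ} (h : ¬ i < k) {x y : ℝ} : ch (i < k) x y 3 ≠ 0 := by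
  simp [ch, h]

/-- Which of the two parameters an active inequality pins to an endpoint. -/
lemma ch_active {i k : ℕ} {x y : ℝ} (hxy : i = k → x ≠ y) (h : i ≤ k) {q : Fin 4}
    (hq : ch (i < k) x y q = 0) :
    (q = 0 ∧ x = 0) ∨ (q = 1 ∧ y = 1) ∨ (q = 2 ∧ x = 1) ∨ (q = 3 ∧ y = 0) := by
  rcases h.lt_or_eq with h | h
  · fin_cases q <;> simp [ch, h] at hq ⊢ <;> linarith
  · subst h
    fin_cases q <;> simp [ch] at hq ⊢
    · exact hq
    · linarith
    · exact absurd (by linarith) (hxy rfl)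

/-- The inequalities defining a cell of squares. -/
noncomputable def cns (V : ℕ → ℂ) (i k j l : ℕ) : Option (Fin 4 ⊕ Fin 4) → (Fin 4 → ℝ) → ℝ
  | none, x => (pt V i (x 0) + pt V k (x 2) - pt V j (x 1) - pt V l (x 3)).re
  | some (Sum.inl q), x => ch (i < k) (x 0) (x 2) q
  | some (Sum.inr q), x => ch (j < l) (x 1) (x 3) q

lemma affineFun_cns (V : ℕ → ℂ) (i k j l : ℕ) (r) : AffineFun (cns V i k j l r) := by
  intro x d u
  rcases r with _ | q | q
  · simp [cns, pt]; ring
  · fin_cases q <;> simp [cns, ch] <;> (try split_ifs) <;> ring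
  · fin_cases q <;> simp [cns, ch] <;> (try split_ifs) <;> ring

namespace Core

variable {V : ℕ → ℂ} {n : ℕ} (H : Core V n)

include H

lemma isSystemLine {i k j l : ℕ} (hi : i < n) (hk : k < n) (hj : j < n) (hl : l < n) :
    IsSystemLine (SqLine V i k j l) := by
  let f₁ : (Fin 4 → ℝ) →ₗ[ℝ] ℂ :=
    { toFun := fun w => w 2 * ed V k - w 0 * ed V i - I * (w 3 * ed V l - w 1 * ed V j)
      map_add' := by intros; simp; ring
      map_smul' := by intros; simp; ring }
  let f₂ : (Fin 4 → ℝ) →ₗ[ℝ] ℝ :=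
    { toFun := fun w => (w 0 * ed V i + w 2 * ed V k - w 1 * ed V j - w 3 * ed V l).im
      map_add' := by intros; simp; ring
      map_smul' := by intros; simp; ring }
  refine isSystemLine_of_surjective (F := ℂ × ℝ) (by simp) (f₁.prod f₂) ?_
    (-(V k - V i - I * (V l - V j)), -(V i + V k - V j - V l).im) ?_
  · obtain ⟨w, hw, hw'⟩ := H.transverse i hi k hk j hj l hl
    have hw1 : f₁ w = 0 := sub_eq_zero.2 hw
    have hd := H.dt_ne i hi j hj
    rintro ⟨p, q⟩
    obtain ⟨y, hy⟩ : ∃ y, f₁ y = p := by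
      obtain ⟨a, b, rfl⟩ := exists_real_combination (u := ed V i) (v := I * ed V j)
        (by rwa [crs_I_mul]) p
      exact ⟨![-a, b, 0, 0], by simp [f₁]; ring⟩
    refine ⟨y + ((q - f₂ y) / f₂ w) • w, ?_⟩
    have : f₂ w ≠ 0 := hw'
    refine Prod.ext ?_ ?_
    · simp [LinearMap.prod_apply, hw1, hy]
    · simp only [LinearMap.prod_apply, Function.prod, map_add, map_smul, smul_eq_mul, Prod.snd_add,
        Prod.smul_snd]
      field_simp
      ring
  · intro x
    simp only [SqLine, Set.mem_ofPred_eq, LinearMap.prod_apply, Function.prod, Prod.mk.injEq, f₁, f₂,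
      LinearMap.coe_mk, AddHom.coe_mk, pt]
    refine and_congr ?_ ?_
    · constructor <;> intro h <;> linear_combination h
    · simp only [add_im, sub_im]
      constructor <;> intro h <;> linear_combination h

end Core

/-- `a₁, a₃` and `a₂, a₄` are the diagonals of a square, except that the second midpoint may lie
to the left of the first one. -/
def SemiSq (a₁ a₃ a₂ a₄ : ℂ) : Prop :=
  a₃ - a₁ = I * (a₄ - a₂) ∧ (a₁ + a₃ - a₂ - a₄).im = 0 ∧ 0 < (a₁ + a₃ - a₂ - a₄).re

/-- The square with diagonals `a₁, a₃` and `a₂, a₄`. -/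
def SqRel (a₁ a₃ a₂ a₄ : ℂ) : Prop := a₃ - a₁ = I * (a₄ - a₂) ∧ a₁ + a₃ = a₂ + a₄

/-- The second chord of a cell completes the chord `a₁, a₃`. -/
def Comp₁ (V : ℕ → ℂ) (j l : ℕ) (a₁ a₃ : ℂ) : Prop :=
  ∃ x y : ℝ, Sepd j l x y ∧ SemiSq a₁ a₃ (pt V j x) (pt V l y)

/-- The first chord of a cell completes the chord `a₂, a₄`. -/
def Comp₂ (V : ℕ → ℂ) (i k : ℕ) (a₂ a₄ : ℂ) : Prop :=
  ∃ x y : ℝ, Sepd i k x y ∧ SemiSq (pt V i x) (pt V k y) a₂ a₄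

/-- The cell contains a square. -/
def CellSq (V : ℕ → ℂ) (i k j l : ℕ) : Prop :=
  ∃ x y z w : ℝ, Sepd i k x y ∧ Sepd j l z w ∧ SqRel (pt V i x) (pt V k y) (pt V j z) (pt V l w)

/-- The cell contains a nondegenerate solution, and a degenerate solution in its closure. -/
def CellEnd (V : ℕ → ℂ) (i k j l : ℕ) : Prop :=
  (∃ x y z w : ℝ, Sepd i k x y ∧ Sepd j l z w ∧
    SemiSq (pt V i x) (pt V k y) (pt V j z) (pt V l w)) ∧
  ∃ x y z w : ℝ, (∀ q, 0 ≤ ch (i < k) x y q) ∧ (∀ q, 0 ≤ ch (j < l) z w q) ∧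
    pt V i x = pt V k y ∧ pt V j z = pt V l w ∧ (pt V i x).im = (pt V j z).im ∧
    (pt V j z).re ≤ (pt V i x).re

/-- A point of the open edge `k` completes the first point `a`. -/
def StartAt (V : ℕ → ℂ) (Q : ℂ → ℂ → Prop) (m k : ℕ) : Prop :=
  ∃ y : ℝ, (0 < y ∧ y < 1) ∧ Q (V m) (pt V k y)

/-- A point of the open edge `i` completes the last point `V m`. -/
def FinishAt (V : ℕ → ℂ) (Q : ℂ → ℂ → Prop) (i m : ℕ) : Prop :=
  ∃ x : ℝ, (0 < x ∧ x < 1) ∧ Q (pt V i x) (V m)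

lemma exists_fin_four {P : (Fin 4 → ℝ) → Prop} :
    (∃ x, P x) ↔ ∃ a b c d : ℝ, P ![a, b, c, d] := by
  constructor
  · rintro ⟨x, hx⟩
    refine ⟨x 0, x 1, x 2, x 3, ?_⟩
    convert hx using 1
    ext i; fin_cases i <;> rfl
  · rintro ⟨a, b, c, d, h⟩; exact ⟨_, h⟩

namespace Core

variable {V : ℕ → ℂ} {n : ℕ} (H : Core V n)

include H

lemma ed_ne {i : ℕ} (hi : i < n) : ed V i ≠ 0 := fun h => H.dt_ne i hi i hi (by simp [dt, h])

lemma pt_inj {i : ℕ} (hi : i < n) {x y : ℝ} (h : pt V i x = pt V i y) : x = y := by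
  have : ((x : ℂ) - y) * ed V i = 0 := by simp only [pt] at h; linear_combination h
  have := (mul_eq_zero.1 this).resolve_right (H.ed_ne hi)
  exact_mod_cast sub_eq_zero.1 this

lemma ch_special {i k : ℕ} (hik : i ≤ k) (hk : k < n) {x y : ℝ}
    (hf : ∀ q, 0 ≤ ch (i < k) x y q) (h : pt V i x = pt V k y) : ∃ q, ch (i < k) x y q = 0 := by
  obtain ⟨⟨h1, h2⟩, ⟨h3, h4⟩, -⟩ := ch_nonneg_box hik hf
  rcases hik.lt_or_eq with h' | h'
  · rcases H.simple i k h' hk x y h1 h2 h3 h4 h with ⟨-, h5, -⟩ | ⟨-, -, h5, -⟩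
    · exact ⟨2, by simp [ch, h', h5]⟩
    · exact ⟨0, by simp [ch, h', h5]⟩
  · subst h'
    exact ⟨2, by simp [ch, H.pt_inj hk h]⟩

variable {i k j l : ℕ} (hik : i ≤ k) (hk : k < n) (hjl : j ≤ l) (hl : l < n)

include hik hk hjl hl

lemma cns_box : ∀ x ∈ SqLine V i k j l, (∀ r, 0 ≤ cns V i k j l r x) →
    ∀ s, 0 ≤ x s ∧ x s ≤ 1 := by
  intro x _ hf s
  obtain ⟨h1, h2, -⟩ := ch_nonneg_box hik (fun q => hf (some (Sum.inl q)))
  obtain ⟨h3, h4, -⟩ := ch_nonneg_box hjl (fun q => hf (some (Sum.inr q)))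
  fin_cases s <;> assumption

omit H hik hk hjl hl in
lemma special_affine : ∀ x d : Fin 4 → ℝ, ∀ u v : ℝ, u ≠ v →
    pt V i ((x + u • d) 0) = pt V k ((x + u • d) 2) →
    pt V i ((x + v • d) 0) = pt V k ((x + v • d) 2) → ∀ w : ℝ,
    pt V i ((x + w • d) 0) = pt V k ((x + w • d) 2) := by
  intro x d u v huv hu hv w
  simp only [pt, Pi.add_apply, Pi.smul_apply, smul_eq_mul, ofReal_add, ofReal_mul] at hu hv ⊢
  have huv' : (u : ℂ) - v ≠ 0 := sub_ne_zero.2 (by exact_mod_cast huv)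
  apply mul_left_cancel₀ huv'
  linear_combination (w - v) * hu - (w - u) * hv

lemma cns_one_active : ∀ x ∈ SqLine V i k j l, (∀ r, 0 ≤ cns V i k j l r x) →
    ¬ pt V i (x 0) = pt V k (x 2) →
    ∀ r s, cns V i k j l r x = 0 → cns V i k j l s x = 0 → r = s := by
  intro x hx hf hsp
  have hbox := H.cns_box hik hk hjl hl x hx hf
  have hi := hik.trans_lt hk
  have hj := hjl.trans_lt hl
  have hne : i = k → x 0 ≠ x 2 := by rintro rfl h; exact hsp (by rw [h])
  have hne' : j = l → x 1 ≠ x 3 := by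
    rintro rfl h
    have := hx.1
    rw [h, sub_self, mul_zero, sub_eq_zero] at this
    exact hsp this.symm
  have h1 : ∀ q, cns V i k j l (some (Sum.inl q)) x = 0 →
      ∃ r : Fin 4, IsEnd (x r) ∧ (r = 0 ∨ r = 2) := by
    intro q hq
    rcases ch_active hne hik hq with ⟨-, h⟩ | ⟨-, h⟩ | ⟨-, h⟩ | ⟨-, h⟩
    exacts [⟨0, .inl h, .inl rfl⟩, ⟨2, .inr h, .inr rfl⟩, ⟨0, .inr h, .inl rfl⟩,
      ⟨2, .inl h, .inr rfl⟩]
  have h2 : ∀ q, cns V i k j l (some (Sum.inr q)) x = 0 →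
      ∃ r : Fin 4, IsEnd (x r) ∧ (r = 1 ∨ r = 3) := by
    intro q hq
    rcases ch_active hne' hjl hq with ⟨-, h⟩ | ⟨-, h⟩ | ⟨-, h⟩ | ⟨-, h⟩
    exacts [⟨1, .inl h, .inl rfl⟩, ⟨3, .inr h, .inr rfl⟩, ⟨1, .inr h, .inl rfl⟩,
      ⟨3, .inl h, .inr rfl⟩]
  have h0 : cns V i k j l none x = 0 → ∀ r, ¬ IsEnd (x r) := by
    intro h
    refine H.no_vertex i hi k hk j hj l hl x hx hbox hsp ?_
    have := Complex.ext (z := pt V i (x 0) + pt V k (x 2) - pt V j (x 1) - pt V l (x 3))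
      (w := 0) h hx.2
    linear_combination this
  have h2v := H.two_vertices i hi k hk j hj l hl x hx hbox hsp
  rintro (_ | q | q) (_ | q' | q') hr hs
  · rfl
  · obtain ⟨r, h, -⟩ := h1 _ hs; exact absurd h (h0 hr r)
  · obtain ⟨r, h, -⟩ := h2 _ hs; exact absurd h (h0 hr r)
  · obtain ⟨r, h, -⟩ := h1 _ hr; exact absurd h (h0 hs r)
  · have := h2v 0 2
    congr 2
    rcases ch_active hne hik hr with ⟨rfl, h⟩ | ⟨rfl, h⟩ | ⟨rfl, h⟩ | ⟨rfl, h⟩ <;>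
    rcases ch_active hne hik hs with ⟨rfl, h'⟩ | ⟨rfl, h'⟩ | ⟨rfl, h'⟩ | ⟨rfl, h'⟩ <;>
    first
    | rfl
    | (exfalso; simp [IsEnd, h, h'] at this; done)
    | (exfalso; linarith)
  · obtain ⟨r, h, h'⟩ := h1 _ hr
    obtain ⟨r', k, k'⟩ := h2 _ hs
    have := h2v r r' h k
    rcases h' with rfl | rfl <;> rcases k' with rfl | rfl <;> simp at this
  · obtain ⟨r, h, -⟩ := h2 _ hr; exact absurd h (h0 hs r)
  · obtain ⟨r, h, h'⟩ := h1 _ hs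
    obtain ⟨r', k, k'⟩ := h2 _ hr
    have := h2v r r' h k
    rcases h' with rfl | rfl <;> rcases k' with rfl | rfl <;> simp at this
  · have := h2v 1 3
    congr 2
    rcases ch_active hne' hjl hr with ⟨rfl, h⟩ | ⟨rfl, h⟩ | ⟨rfl, h⟩ | ⟨rfl, h⟩ <;>
    rcases ch_active hne' hjl hs with ⟨rfl, h'⟩ | ⟨rfl, h'⟩ | ⟨rfl, h'⟩ | ⟨rfl, h'⟩ <;>
    first
    | rfl
    | (exfalso; simp [IsEnd, h, h'] at this; done)
    | (exfalso; linarith)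

lemma cns_two_active : ∀ x ∈ SqLine V i k j l, (∀ r, 0 ≤ cns V i k j l r x) →
    pt V i (x 0) = pt V k (x 2) →
    ∃ r s, r ≠ s ∧ cns V i k j l r x = 0 ∧ cns V i k j l s x = 0 := by
  intro x hx hf hsp
  have hsp' : pt V j (x 1) = pt V l (x 3) := by
    have := hx.1
    rw [hsp, sub_self, eq_comm, mul_eq_zero, sub_eq_zero] at this
    exact (this.resolve_left I_ne_zero).symm
  obtain ⟨q, hq⟩ := H.ch_special hik hk (fun q => hf (some (Sum.inl q))) hsp
  obtain ⟨q', hq'⟩ := H.ch_special hjl hl (fun q => hf (some (Sum.inr q))) hsp'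
  exact ⟨some (Sum.inl q), some (Sum.inr q'), by simp, hq, hq'⟩

omit hik hk H hl in
lemma hit_fst (q : Fin 4) : (∃ x ∈ SqLine V i k j l, cns V i k j l (some (Sum.inl q)) x = 0 ∧
      ∀ s, s ≠ some (Sum.inl q) → 0 < cns V i k j l s x) ↔
    ∃ x y, (ch (i < k) x y q = 0 ∧ ∀ s, s ≠ q → 0 < ch (i < k) x y s) ∧
      Comp₁ V j l (pt V i x) (pt V k y) := by
  rw [exists_fin_four]
  simp only [Option.forall, Sum.forall, cns, SqLine, Set.mem_ofPred_eq, Comp₁, SemiSq,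
    ← ch_pos_iff hjl, ne_eq, reduceCtorEq, not_false_eq_true, true_implies, Option.some.injEq,
    Sum.inl.injEq, Matrix.cons_val]
  constructor
  · rintro ⟨a, b, c, d, ⟨h1, h2⟩, h3, h4, h5, h6⟩
    exact ⟨a, c, ⟨h3, h5⟩, b, d, h6, h1, h2, h4⟩
  · rintro ⟨a, c, ⟨h3, h5⟩, b, d, h6, h1, h2, h4⟩
    exact ⟨a, b, c, d, ⟨h1, h2⟩, h3, h4, h5, h6⟩

omit hjl hk H hl in
lemma hit_snd (q : Fin 4) : (∃ x ∈ SqLine V i k j l, cns V i k j l (some (Sum.inr q)) x = 0 ∧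
      ∀ s, s ≠ some (Sum.inr q) → 0 < cns V i k j l s x) ↔
    ∃ x y, (ch (j < l) x y q = 0 ∧ ∀ s, s ≠ q → 0 < ch (j < l) x y s) ∧
      Comp₂ V i k (pt V j x) (pt V l y) := by
  rw [exists_fin_four]
  simp only [Option.forall, Sum.forall, cns, SqLine, Set.mem_ofPred_eq, Comp₂, SemiSq,
    ← ch_pos_iff hik, ne_eq, reduceCtorEq, not_false_eq_true, true_implies, Option.some.injEq,
    Sum.inr.injEq, Matrix.cons_val]
  constructor
  · rintro ⟨a, b, c, d, ⟨h1, h2⟩, h3, h4, h5, h6⟩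
    exact ⟨b, d, ⟨h3, h6⟩, a, c, h5, h1, h2, h4⟩
  · rintro ⟨b, d, ⟨h3, h6⟩, a, c, h5, h1, h2, h4⟩
    exact ⟨a, b, c, d, ⟨h1, h2⟩, h3, h4, h5, h6⟩

omit H hik hk hjl hl in
lemma sum_chord_hits (Q : ℂ → ℂ → Prop) (hQ : ∀ a, ¬ Q a a) (hik : i ≤ k) :
    ∑ q, ind (∃ x y, (ch (i < k) x y q = 0 ∧ ∀ s, s ≠ q → 0 < ch (i < k) x y s) ∧
      Q (pt V i x) (pt V k y)) =
    ind (StartAt V Q i k) + ind (FinishAt V Q i (k + 1)) +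
      if i < k then ind (StartAt V Q (i + 1) k) + ind (FinishAt V Q i k) else 0 := by
  rw [Fin.sum_univ_four]
  simp_rw [ch_hit_zero hik, ch_hit_one hik]
  have e0 : (∃ x y : ℝ, (x = 0 ∧ 0 < y ∧ y < 1) ∧ Q (pt V i x) (pt V k y)) ↔ StartAt V Q i k := by
    constructor
    · rintro ⟨x, y, ⟨rfl, h⟩, h'⟩; exact ⟨y, h, by rwa [pt_zero] at h'⟩
    · rintro ⟨y, h, h'⟩; exact ⟨0, y, ⟨rfl, h⟩, by rwa [pt_zero]⟩
  have e1 : (∃ x y : ℝ, (y = 1 ∧ 0 < x ∧ x < 1) ∧ Q (pt V i x) (pt V k y)) ↔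
      FinishAt V Q i (k + 1) := by
    constructor
    · rintro ⟨x, y, ⟨rfl, h⟩, h'⟩; exact ⟨x, h, by rwa [pt_one] at h'⟩
    · rintro ⟨y, h, h'⟩; exact ⟨y, 1, ⟨rfl, h⟩, by rwa [pt_one]⟩
  rw [ind_congr e0, ind_congr e1]
  split_ifs with h
  · simp_rw [ch_hit_two h, ch_hit_three h]
    have e2 : (∃ x y : ℝ, (x = 1 ∧ 0 < y ∧ y < 1) ∧ Q (pt V i x) (pt V k y)) ↔
        StartAt V Q (i + 1) k := by
      constructor
      · rintro ⟨x, y, ⟨rfl, h⟩, h'⟩; exact ⟨y, h, by rwa [pt_one] at h'⟩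
      · rintro ⟨y, h, h'⟩; exact ⟨1, y, ⟨rfl, h⟩, by rwa [pt_one]⟩
    have e3 : (∃ x y : ℝ, (y = 0 ∧ 0 < x ∧ x < 1) ∧ Q (pt V i x) (pt V k y)) ↔
        FinishAt V Q i k := by
      constructor
      · rintro ⟨x, y, ⟨rfl, h⟩, h'⟩; exact ⟨x, h, by rwa [pt_zero] at h'⟩
      · rintro ⟨y, h, h'⟩; exact ⟨y, 0, ⟨rfl, h⟩, by rwa [pt_zero]⟩
    rw [ind_congr e2, ind_congr e3]
    ring
  · have hk : i = k := by omega
    subst hk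
    rw [ind_false (p := ∃ x y, (ch (i < i) x y 2 = 0 ∧ _) ∧ _),
      ind_false (p := ∃ x y, (ch (i < i) x y 3 = 0 ∧ _) ∧ _)]
    · ring
    · rintro ⟨x, y, ⟨h', -⟩, -⟩
      exact ch_three_ne h h'
    · rintro ⟨x, y, ⟨h', -⟩, h2⟩
      have : x = y := by simp [ch] at h'; linarith
      subst this
      exact hQ _ h2

theorem cell_relation :
    ind (CellSq V i k j l) +
      (ind (StartAt V (Comp₁ V j l) i k) + ind (FinishAt V (Comp₁ V j l) i (k + 1)) +
        if i < k then ind (StartAt V (Comp₁ V j l) (i + 1) k) + ind (FinishAt V (Comp₁ V j l) i k)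
        else 0) +
      (ind (StartAt V (Comp₂ V i k) j l) + ind (FinishAt V (Comp₂ V i k) j (l + 1)) +
        if j < l then ind (StartAt V (Comp₂ V i k) (j + 1) l) + ind (FinishAt V (Comp₂ V i k) j l)
        else 0) +
      ind (CellEnd V i k j l) = 0 := by
  have hi := hik.trans_lt hk
  have hj := hjl.trans_lt hl
  have key := cell_parity (Sp := fun x => pt V i (x 0) = pt V k (x 2))
    (H.isSystemLine hi hk hj hl) (affineFun_cns V i k j l)
    (H.cns_box hik hk hjl hl) special_affine (H.cns_one_active hik hk hjl hl)
    (H.cns_two_active hik hk hjl hl)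
  have hs : ∀ {j l : ℕ}, j ≤ l → l < n → ∀ {x y}, Sepd j l x y → pt V j x ≠ pt V l y := by
    intro j l hjl hl x y h h'
    obtain ⟨q, hq⟩ := H.ch_special hjl hl (fun q => ((ch_pos_iff hjl).2 h q).le) h'
    exact ((ch_pos_iff hjl).2 h q).ne' hq
  have hQ₁ : ∀ a, ¬ Comp₁ V j l a a := by
    rintro a ⟨x, y, h, h', -⟩
    rw [sub_self, eq_comm, mul_eq_zero, sub_eq_zero] at h'
    exact hs hjl hl h (h'.resolve_left I_ne_zero).symm
  have hQ₂ : ∀ a, ¬ Comp₂ V i k a a := by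
    rintro a ⟨x, y, h, h', -⟩
    rw [sub_self, mul_zero, sub_eq_zero] at h'
    exact hs hik hk h h'.symm
  rw [Fintype.sum_option, Fintype.sum_sum_type] at key
  simp_rw [hit_fst hjl, hit_snd hik] at key
  rw [sum_chord_hits _ hQ₁ hik, sum_chord_hits _ hQ₂ hjl] at key
  have e1 : (∃ x ∈ SqLine V i k j l, cns V i k j l none x = 0 ∧
      ∀ s, s ≠ none → 0 < cns V i k j l s x) ↔ CellSq V i k j l := by
    rw [exists_fin_four]
    simp only [Option.forall, Sum.forall, cns, SqLine, Set.mem_ofPred_eq, CellSq, SqRel,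
      ← ch_pos_iff hik, ← ch_pos_iff hjl, ne_eq, reduceCtorEq, not_false_eq_true, true_implies,
      Matrix.cons_val, not_true_eq_false, false_implies, true_and]
    constructor
    · rintro ⟨a, b, c, d, ⟨h1, h2⟩, h3, h4, h5⟩
      refine ⟨a, c, b, d, h4, h5, h1, ?_⟩
      have := Complex.ext (z := pt V i a + pt V k c - pt V j b - pt V l d) (w := 0) h3 h2
      linear_combination this
    · rintro ⟨a, c, b, d, h4, h5, h1, h2⟩
      have h3 : pt V i a + pt V k c - pt V j b - pt V l d = 0 := by linear_combination h2
      exact ⟨a, b, c, d, ⟨h1, by rw [h3]; rfl⟩, by rw [h3]; rfl, h4, h5⟩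
  have e2 : ((∃ x ∈ SqLine V i k j l, ∀ r, 0 < cns V i k j l r x) ∧
      ∃ x ∈ SqLine V i k j l, (∀ r, 0 ≤ cns V i k j l r x) ∧ pt V i (x 0) = pt V k (x 2)) ↔
      CellEnd V i k j l := by
    rw [exists_fin_four, exists_fin_four]
    simp only [Option.forall, Sum.forall, cns, SqLine, Set.mem_ofPred_eq, CellEnd, SemiSq,
      ← ch_pos_iff hik, ← ch_pos_iff hjl, Matrix.cons_val]
    refine and_congr ?_ ?_
    · constructor
      · rintro ⟨a, b, c, d, ⟨h1, h2⟩, h3, h4, h5⟩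
        exact ⟨a, c, b, d, h4, h5, h1, h2, h3⟩
      · rintro ⟨a, c, b, d, h4, h5, h1, h2, h3⟩
        exact ⟨a, b, c, d, ⟨h1, h2⟩, h3, h4, h5⟩
    · constructor
      · rintro ⟨a, b, c, d, ⟨h1, h2⟩, ⟨h3, h4, h5⟩, h6⟩
        rw [h6, sub_self, eq_comm, mul_eq_zero, sub_eq_zero] at h1
        have h7 := h1.resolve_left I_ne_zero
        rw [h6, h7] at h2 h3
        simp only [add_im, sub_im, add_re, sub_re] at h2 h3
        exact ⟨a, c, b, d, h4, h5, h6, h7.symm, by rw [h6]; linarith,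
          by rw [h6]; linarith⟩
      · rintro ⟨a, c, b, d, h4, h5, h6, h7, h8, h9⟩
        refine ⟨a, b, c, d, ⟨by rw [h6, h7]; simp, ?_⟩, ⟨?_, h4, h5⟩, h6⟩
        · simp only [add_im, sub_im]; rw [← h6, ← h7]; linarith
        · simp only [add_re, sub_re]; rw [← h6, ← h7]; linarith
  rw [ind_congr e1, ind_congr e2] at key
  linear_combination key

end Core

/-- The sum over pairs `i ≤ k < n`. -/
def pairSum (n : ℕ) (f : ℕ → ℕ → ZMod 2) : ZMod 2 :=
  ∑ k ∈ Finset.range n, ∑ i ∈ Finset.range (k + 1), f i k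

lemma pairSum_congr {n : ℕ} {f g : ℕ → ℕ → ZMod 2} (h : ∀ i k, i ≤ k → k < n → f i k = g i k) :
    pairSum n f = pairSum n g :=
  Finset.sum_congr rfl fun k hk => Finset.sum_congr rfl fun i hi =>
    h i k (by simp at hi; omega) (by simpa using hk)

lemma pairSum_add {n : ℕ} (f g : ℕ → ℕ → ZMod 2) :
    pairSum n (fun i k => f i k + g i k) = pairSum n f + pairSum n g := by
  simp [pairSum, Finset.sum_add_distrib]

lemma pairSum_zero (n : ℕ) : pairSum n (fun _ _ => 0) = 0 := by simp [pairSum]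

lemma pairSum_comm {n : ℕ} (f : ℕ → ℕ → ℕ → ℕ → ZMod 2) :
    pairSum n (fun i k => pairSum n fun j l => f i k j l) =
      pairSum n (fun j l => pairSum n fun i k => f i k j l) := by
  unfold pairSum
  simp_rw [Finset.sum_sigma' (Finset.range n) (fun k => Finset.range (k + 1))]
  exact Finset.sum_comm

lemma pairSum_telescope (n : ℕ) (A B : ℕ → ℕ → ZMod 2) :
    pairSum n (fun i k => A i k + B i (k + 1) + if i < k then A (i + 1) k + B i k else 0) =
      ∑ m ∈ Finset.range n, (A 0 m + B m n) := by
  have h1 : ∀ k, ∑ i ∈ Finset.range (k + 1),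
      (A i k + B i (k + 1) + if i < k then A (i + 1) k + B i k else 0) =
      A 0 k + (∑ i ∈ Finset.range (k + 1), B i (k + 1) + ∑ i ∈ Finset.range k, B i k) := by
    intro k
    rw [Finset.sum_add_distrib, Finset.sum_add_distrib]
    have : ∑ i ∈ Finset.range (k + 1), (if i < k then A (i + 1) k + B i k else 0) =
        ∑ i ∈ Finset.range k, A (i + 1) k + ∑ i ∈ Finset.range k, B i k := by
      rw [Finset.sum_range_succ, if_neg (lt_irrefl k), add_zero, ← Finset.sum_add_distrib]
      exact Finset.sum_congr rfl fun i hi => if_pos (by simpa using hi)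
    rw [this, Finset.sum_range_succ' (fun i => A i k)]
    linear_combination zmod2_add_self (∑ i ∈ Finset.range k, A (i + 1) k)
  have h2 : ∑ k ∈ Finset.range n, (∑ i ∈ Finset.range (k + 1), B i (k + 1) +
      ∑ i ∈ Finset.range k, B i k) = ∑ m ∈ Finset.range n, B m n := by
    induction n with
    | zero => simp
    | succ n ih =>
      rw [Finset.sum_range_succ (fun k => ∑ i ∈ Finset.range (k + 1), B i (k + 1) +
        ∑ i ∈ Finset.range k, B i k), ih]
      linear_combination zmod2_add_self (∑ i ∈ Finset.range n, B i n)
  rw [pairSum, Finset.sum_congr rfl fun k _ => h1 k, Finset.sum_add_distrib, h2,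
    ← Finset.sum_add_distrib]

lemma sum_sum_eq_pairSum (n : ℕ) (f : ℕ → ℕ → ZMod 2) :
    ∑ j ∈ Finset.range n, ∑ l ∈ Finset.range n, f j l =
      pairSum n fun j l => if j < l then f j l + f l j else f j j := by
  have h : ∀ k, ∑ i ∈ Finset.range (k + 1), (if i < k then f i k + f k i else f i i) =
      ∑ i ∈ Finset.range k, f i k + ∑ i ∈ Finset.range k, f k i + f k k := by
    intro k
    rw [Finset.sum_range_succ, if_neg (lt_irrefl k), ← Finset.sum_add_distrib]
    congr 1
    exact Finset.sum_congr rfl fun i hi => if_pos (by simpa using hi)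
  rw [pairSum, Finset.sum_congr rfl fun k _ => h k]
  induction n with
  | zero => simp
  | succ n ih =>
    rw [Finset.sum_range_succ, Finset.sum_range_succ (fun k => _ + _ + f k k), ← ih]
    simp_rw [Finset.sum_range_succ]
    rw [Finset.sum_add_distrib]
    ring

lemma sum_cyclic {n : ℕ} {f : ℕ → ZMod 2} (h : f n = f 0) :
    ∑ i ∈ Finset.range n, (f i + f (i + 1)) = 0 := by
  have : ∀ m, ∑ i ∈ Finset.range m, (f i + f (i + 1)) = f 0 + f m := by
    intro m
    induction m with
    | zero => simp [zmod2_add_self]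
    | succ m ih =>
      rw [Finset.sum_range_succ, ih]
      linear_combination zmod2_add_self (f m)
  rw [this, h, zmod2_add_self]

lemma ind_split {α : Type*} {A : α → Prop} (B : α → Prop) (h : ∀ s t, A s → A t → s = t) :
    ind (∃ s, A s) = ind (∃ s, A s ∧ B s) + ind (∃ s, A s ∧ ¬ B s) := by
  by_cases hA : ∃ s, A s
  · obtain ⟨s, hs⟩ := hA
    rw [ind_true ⟨s, hs⟩]
    by_cases hB : B s
    · rw [ind_true ⟨s, hs, hB⟩, ind_false, add_zero]
      rintro ⟨t, ht, ht'⟩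
      exact ht' (h s t hs ht ▸ hB)
    · rw [ind_true (p := ∃ s, A s ∧ ¬ B s) ⟨s, hs, hB⟩, ind_false, zero_add]
      rintro ⟨t, ht, ht'⟩
      exact hB (h s t hs ht ▸ ht')
  · rw [ind_false hA, ind_false (fun ⟨s, hs, _⟩ => hA ⟨s, hs⟩),
      ind_false (fun ⟨s, hs, _⟩ => hA ⟨s, hs⟩), add_zero]

/-- An isosceles right triangle with apex `V 0`, completed to a point `a`: the equations satisfied
by `p`, `q`, `a`. -/
def BaseSol (V : ℕ → ℂ) (j l m : ℕ) (s : ℝ × ℝ × ℝ) : Prop :=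
  ((0 < s.1 ∧ s.1 < 1) ∧ (0 < s.2.1 ∧ s.2.1 < 1) ∧ (0 < s.2.2 ∧ s.2.2 < 1)) ∧
  pt V m s.2.2 - V 0 = I * (pt V l s.2.1 - pt V j s.1) ∧
  (V 0 + pt V m s.2.2 - pt V j s.1 - pt V l s.2.1).im = 0

/-- The inequalities defining a cell of triangles at `V 0`. -/
noncomputable def cns₃ (V : ℕ → ℂ) (j l m : ℕ) : Option (Fin 3 × Bool) → (Fin 3 → ℝ) → ℝ
  | none, x => (V 0 + pt V m (x 2) - pt V j (x 0) - pt V l (x 1)).im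
  | some (s, true), x => x s
  | some (s, false), x => 1 - x s

/-- The solutions of the triangle equation at `V 0`. -/
def TriLine (V : ℕ → ℂ) (j l m : ℕ) : Set (Fin 3 → ℝ) :=
  {x | pt V m (x 2) - V 0 = I * (pt V l (x 1) - pt V j (x 0))}

lemma affineFun_cns₃ (V : ℕ → ℂ) (j l m : ℕ) (r) : AffineFun (cns₃ V j l m r) := by
  intro x d u
  rcases r with _ | ⟨s, _ | _⟩
  · simp [cns₃, pt]; ring
  · simp [cns₃]; ring
  · simp [cns₃]; ring

/-- A triangle cell contains nondegenerate solutions and has a degenerate one in its closure. -/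
def BaseEnd (V : ℕ → ℂ) (j l m : ℕ) : Prop :=
  (∃ x ∈ TriLine V j l m, (∀ s, 0 < x s ∧ x s < 1) ∧
    0 < (V 0 + pt V m (x 2) - pt V j (x 0) - pt V l (x 1)).im) ∧
  ∃ x ∈ TriLine V j l m, (∀ s, 0 ≤ x s ∧ x s ≤ 1) ∧
    0 ≤ (V 0 + pt V m (x 2) - pt V j (x 0) - pt V l (x 1)).im ∧ pt V m (x 2) = V 0

lemma exists_fin_three {P : (Fin 3 → ℝ) → Prop} :
    (∃ x, P x) ↔ ∃ a b c : ℝ, P ![a, b, c] := by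
  constructor
  · rintro ⟨x, hx⟩
    refine ⟨x 0, x 1, x 2, ?_⟩
    convert hx using 1
    ext i; fin_cases i <;> rfl
  · rintro ⟨a, b, c, h⟩; exact ⟨_, h⟩

namespace Core

variable {V : ℕ → ℂ} {n : ℕ} (H : Core V n)

include H

lemma V_n : V n = V 0 := by simpa using H.per 0

lemma im_le_pt {i : ℕ} (hi : i < n) {x : ℝ} (h0 : 0 ≤ x) (h1 : x ≤ 1) :
    (V 0).im ≤ (pt V i x).im := by
  have a : (V 0).im ≤ (V i).im := by
    rcases i.eq_zero_or_pos with rfl | h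
    · rfl
    · exact (H.bot i h hi).le
  have b : (V 0).im ≤ (V (i + 1)).im := by
    rcases (show i + 1 ≤ n from hi).lt_or_eq with h | h
    · exact (H.bot _ (by omega) h).le
    · rw [h, H.V_n]
  simp only [pt, ed, add_im, im_ofReal_mul, sub_im]
  nlinarith

lemma isEnd_of_im_le {i : ℕ} (hi : i < n) {x : ℝ} (h0 : 0 ≤ x) (h1 : x ≤ 1)
    (h : (pt V i x).im ≤ (V 0).im) : IsEnd x ∧ pt V i x = V 0 := by
  have a : (V 0).im ≤ (V i).im := by
    simpa [pt_zero] using H.im_le_pt hi (le_refl 0) zero_le_one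
  have b : (V 0).im ≤ (V (i + 1)).im := by
    simpa [pt_one] using H.im_le_pt hi zero_le_one (le_refl 1)
  have hne : (V i).im ≠ (V (i + 1)).im := by
    rcases (show i + 1 ≤ n from hi).lt_or_eq with h | h
    · exact H.im_ne _ hi _ h (by omega)
    · rw [h, H.V_n]
      exact H.im_ne _ hi _ (by have := H.three; omega) (by have := H.three; omega)
  simp only [pt, ed, add_im, im_ofReal_mul, sub_im] at h
  rcases h0.eq_or_lt with rfl | h0
  · refine ⟨.inl rfl, ?_⟩
    rw [pt_zero]
    rcases i.eq_zero_or_pos with rfl | h'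
    · rfl
    · have := H.bot i h' hi
      linarith
  rcases h1.eq_or_lt with rfl | h1
  · refine ⟨.inr rfl, ?_⟩
    rw [pt_one]
    rcases (show i + 1 ≤ n from hi).lt_or_eq with h' | h'
    · have := H.bot _ (by omega) h'
      linarith
    · rw [h', H.V_n]
  · exfalso
    rcases a.eq_or_lt with a | a
    · have hb := lt_of_le_of_ne b (by rw [a]; exact hne)
      nlinarith
    · nlinarith

lemma sum_cellSq_add_sum_cellEnd : pairSum n (fun i k => pairSum n fun j l => ind (CellSq V i k j l)) +
    (pairSum n (fun j l => ∑ m ∈ Finset.range n,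
      (ind (StartAt V (Comp₁ V j l) 0 m) + ind (FinishAt V (Comp₁ V j l) m n))) +
    pairSum n (fun i k => ∑ m ∈ Finset.range n,
      (ind (StartAt V (Comp₂ V i k) 0 m) + ind (FinishAt V (Comp₂ V i k) m n)))) +
    pairSum n (fun i k => pairSum n fun j l => ind (CellEnd V i k j l)) = 0 := by
  have h := pairSum_zero n
  rw [← pairSum_congr (fun i k hik hk => (pairSum_congr (n := n) (fun j l hjl hl =>
    H.cell_relation hik hk hjl hl)).trans (pairSum_zero n))] at h
  simp_rw [pairSum_add _ (fun j l => ind (CellEnd V _ _ j l))] at h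
  rw [pairSum_add] at h
  rw [← h]
  congr 1
  have e : ∀ i k, pairSum n (fun j l => ind (CellSq V i k j l) +
      (ind (StartAt V (Comp₁ V j l) i k) + ind (FinishAt V (Comp₁ V j l) i (k + 1)) +
        if i < k then ind (StartAt V (Comp₁ V j l) (i + 1) k) + ind (FinishAt V (Comp₁ V j l) i k)
        else 0) +
      (ind (StartAt V (Comp₂ V i k) j l) + ind (FinishAt V (Comp₂ V i k) j (l + 1)) +
        if j < l then ind (StartAt V (Comp₂ V i k) (j + 1) l) + ind (FinishAt V (Comp₂ V i k) j l)
        else 0)) = pairSum n (fun j l => ind (CellSq V i k j l)) +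
      pairSum n (fun j l => ind (StartAt V (Comp₁ V j l) i k) +
        ind (FinishAt V (Comp₁ V j l) i (k + 1)) +
        if i < k then ind (StartAt V (Comp₁ V j l) (i + 1) k) + ind (FinishAt V (Comp₁ V j l) i k)
        else 0) +
      ∑ m ∈ Finset.range n,
        (ind (StartAt V (Comp₂ V i k) 0 m) + ind (FinishAt V (Comp₂ V i k) m n)) := by
    intro i k
    rw [pairSum_add _ (fun j l => ind (StartAt V (Comp₂ V i k) j l) +
      ind (FinishAt V (Comp₂ V i k) j (l + 1)) + if j < l then _ else 0), pairSum_add]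
    congr 1
    exact pairSum_telescope n (fun j l => ind (StartAt V (Comp₂ V i k) j l))
      (fun j l => ind (FinishAt V (Comp₂ V i k) j l))
  simp_rw [e]
  rw [pairSum_add, pairSum_add, pairSum_comm (fun i k j l =>
    ind (StartAt V (Comp₁ V j l) i k) + ind (FinishAt V (Comp₁ V j l) i (k + 1)) + if i < k then _
      else 0), ← add_assoc]
  congr 2
  exact pairSum_congr fun j l _ _ =>
    (pairSum_telescope n (fun i k => ind (StartAt V (Comp₁ V j l) i k))
      (fun i k => ind (FinishAt V (Comp₁ V j l) i k))).symm

end Core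

/-- Three points forming a triangle at `o`, with downward displacement. -/
def TriRel (o p q a : ℂ) : Prop := a - o = I * (q - p) ∧ 0 < (o + a - p - q).im

namespace Core

variable {V : ℕ → ℂ} {n : ℕ} (H : Core V n)

include H

lemma n_pos : 0 < n := by have := H.three; omega

lemma pt_ne_bot {i : ℕ} (hi : i < n) {x : ℝ} (h : 0 < x ∧ x < 1) : pt V i x ≠ V 0 := by
  intro h'
  have := (H.isEnd_of_im_le hi h.1.le h.2.le (by rw [h'])).1
  rcases this with rfl | rfl <;> simp at h

section Tri

variable {j l m : ℕ} (hj : j < n) (hl : l < n) (hm : m < n)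

include hj hl hm

lemma isSystemLine_tri : IsSystemLine (TriLine V j l m) := by
  let f : (Fin 3 → ℝ) →ₗ[ℝ] ℂ :=
    { toFun := fun w => w 2 * ed V m - I * (w 1 * ed V l - w 0 * ed V j)
      map_add' := by intros; simp; ring
      map_smul' := by intros; simp; ring }
  refine isSystemLine_of_surjective (F := ℂ) (by simp) f ?_
    (V 0 - V m + I * (V l - V j)) ?_
  · intro p
    obtain ⟨a, b, rfl⟩ := exists_real_combination (u := ed V m) (v := I * ed V l)
      (by rw [crs_I_mul]; exact H.dt_ne m hm l hl) p
    exact ⟨![0, -b, a], by simp [f]; ring⟩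
  · intro x
    simp only [TriLine, Set.mem_ofPred_eq, f, LinearMap.coe_mk, AddHom.coe_mk, pt]
    constructor <;> intro h <;> linear_combination h

lemma tri_box : ∀ x ∈ TriLine V j l m, (∀ r, 0 ≤ cns₃ V j l m r x) →
    ∀ s, 0 ≤ x s ∧ x s ≤ 1 := by
  intro x _ hf s
  have h1 := hf (some (s, true))
  have h2 := hf (some (s, false))
  simp only [cns₃] at h1 h2
  exact ⟨h1, by linarith⟩

omit H hj hl hm in
lemma tri_special_affine : ∀ x d : Fin 3 → ℝ, ∀ u v : ℝ, u ≠ v →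
    pt V m ((x + u • d) 2) = V 0 → pt V m ((x + v • d) 2) = V 0 → ∀ w : ℝ,
    pt V m ((x + w • d) 2) = V 0 := by
  intro x d u v huv hu hv w
  simp only [pt, Pi.add_apply, Pi.smul_apply, smul_eq_mul, ofReal_add, ofReal_mul] at hu hv ⊢
  have huv' : (u : ℂ) - v ≠ 0 := sub_ne_zero.2 (by exact_mod_cast huv)
  apply mul_left_cancel₀ huv'
  linear_combination (w - v) * hu - (w - u) * hv

lemma tri_one_active : ∀ x ∈ TriLine V j l m, (∀ r, 0 ≤ cns₃ V j l m r x) →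
    ¬ pt V m (x 2) = V 0 →
    ∀ r s, cns₃ V j l m r x = 0 → cns₃ V j l m s x = 0 → r = s := by
  intro x hx hf hsp
  have hbox := H.tri_box hj hl hm x hx hf
  have hx' : pt V m (x 2) - V 0 = I * (pt V l (x 1) - pt V j (x 0)) := hx
  have hne : pt V j (x 0) ≠ pt V l (x 1) := by
    intro h
    rw [h, sub_self, mul_zero, sub_eq_zero] at hx'
    exact hsp hx'
  have hE : ∀ s b, cns₃ V j l m (some (s, b)) x = 0 → IsEnd (x s) := by
    intro s b h
    cases b
    · simp only [cns₃] at h; exact .inr (by linarith)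
    · exact .inl h
  have h0 : cns₃ V j l m none x = 0 → ∀ s, ¬ IsEnd (x s) := by
    intro h s hs
    have key := H.two_vertices 0 H.n_pos m hm j hj l hl ![0, x 0, x 2, x 1]
      ⟨by simpa [pt_zero] using hx', by simpa [pt_zero, cns₃] using h⟩
      (by
        intro r
        fin_cases r
        · simp
        · exact hbox 0
        · exact hbox 2
        · exact hbox 1)
      (by simpa [pt_zero] using Ne.symm hsp)
    have k0 : IsEnd ((![0, x 0, x 2, x 1] : Fin 4 → ℝ) 0) := .inl rfl
    fin_cases s
    · have := key 0 1 k0 hs; simp at this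
    · have := key 0 3 k0 hs; simp at this
    · have := key 0 2 k0 hs; simp at this
  rintro (_ | ⟨s, b⟩) (_ | ⟨s', b'⟩) hr hs
  · rfl
  · exact absurd (hE _ _ hs) (h0 hr _)
  · exact absurd (hE _ _ hr) (h0 hs _)
  · obtain rfl := H.base_vertices j hj l hl m hm x hbox hx' hne s s' (hE _ _ hr) (hE _ _ hs)
    cases b <;> cases b' <;> simp only [cns₃] at hr hs <;> first | rfl | (exfalso; linarith)

lemma tri_two_active : ∀ x ∈ TriLine V j l m, (∀ r, 0 ≤ cns₃ V j l m r x) →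
    pt V m (x 2) = V 0 →
    ∃ r s, r ≠ s ∧ cns₃ V j l m r x = 0 ∧ cns₃ V j l m s x = 0 := by
  intro x hx hf hsp
  have hbox := H.tri_box hj hl hm x hx hf
  have hx' : pt V m (x 2) - V 0 = I * (pt V l (x 1) - pt V j (x 0)) := hx
  rw [hsp, sub_self, eq_comm, mul_eq_zero, sub_eq_zero] at hx'
  have hpq := hx'.resolve_left I_ne_zero
  have h0 := hf none
  simp only [cns₃, hsp, hpq, sub_im, add_im] at h0
  have e0 := (H.isEnd_of_im_le hj (hbox 0).1 (hbox 0).2 (by linarith)).1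
  have e1 := (H.isEnd_of_im_le hl (hbox 1).1 (hbox 1).2 (by rw [hpq]; linarith)).1
  have hE : ∀ s, IsEnd (x s) → ∃ b, cns₃ V j l m (some (s, b)) x = 0 := by
    rintro s (h | h)
    · exact ⟨true, h⟩
    · exact ⟨false, by simp [cns₃, h]⟩
  obtain ⟨b, hb⟩ := hE 0 e0
  obtain ⟨b', hb'⟩ := hE 1 e1
  exact ⟨_, _, by simp, hb, hb'⟩

lemma tri_relation :
    ind (∃ s, BaseSol V j l m s) + ind (BaseEnd V j l m) +
      ((ind (∃ y z : ℝ, (0 < y ∧ y < 1) ∧ (0 < z ∧ z < 1) ∧ TriRel (V 0) (V j) (pt V l y) (pt V m z))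
        + ind (∃ y z : ℝ, (0 < y ∧ y < 1) ∧ (0 < z ∧ z < 1) ∧
          TriRel (V 0) (V (j + 1)) (pt V l y) (pt V m z))) +
      (ind (∃ y z : ℝ, (0 < y ∧ y < 1) ∧ (0 < z ∧ z < 1) ∧ TriRel (V 0) (pt V j y) (V l) (pt V m z))
        + ind (∃ y z : ℝ, (0 < y ∧ y < 1) ∧ (0 < z ∧ z < 1) ∧
          TriRel (V 0) (pt V j y) (V (l + 1)) (pt V m z))) +
      (ind (∃ y z : ℝ, (0 < y ∧ y < 1) ∧ (0 < z ∧ z < 1) ∧ TriRel (V 0) (pt V j y) (pt V l z) (V m))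
        + ind (∃ y z : ℝ, (0 < y ∧ y < 1) ∧ (0 < z ∧ z < 1) ∧
          TriRel (V 0) (pt V j y) (pt V l z) (V (m + 1))))) = 0 := by
  have key := cell_parity (Sp := fun x => pt V m (x 2) = V 0)
    (H.isSystemLine_tri hj hl hm) (affineFun_cns₃ V j l m)
    (H.tri_box hj hl hm) tri_special_affine (H.tri_one_active hj hl hm)
    (H.tri_two_active hj hl hm)
  rw [Fintype.sum_option, Fintype.sum_prod_type, Fin.sum_univ_three] at key
  simp only [Fintype.sum_bool] at key
  have e0 : (∃ x ∈ TriLine V j l m, cns₃ V j l m none x = 0 ∧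
      ∀ s, s ≠ none → 0 < cns₃ V j l m s x) ↔ ∃ s, BaseSol V j l m s := by
    rw [exists_fin_three]
    simp [Option.forall, cns₃, TriLine, BaseSol, Fin.forall_fin_succ]
    constructor
    · rintro ⟨a, b, c, h1, h2, h3, h4, h5⟩
      exact ⟨a, b, c, ⟨h3.symm, h4.symm, h5.symm⟩, h1, h2⟩
    · rintro ⟨a, b, c, ⟨h3, h4, h5⟩, h1, h2⟩
      exact ⟨a, b, c, h1, h2, h3.symm, h4.symm, h5.symm⟩
  have e1 : ((∃ x ∈ TriLine V j l m, ∀ r, 0 < cns₃ V j l m r x) ∧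
      ∃ x ∈ TriLine V j l m, (∀ r, 0 ≤ cns₃ V j l m r x) ∧ pt V m (x 2) = V 0) ↔
      BaseEnd V j l m := by
    simp only [BaseEnd, Option.forall, Prod.forall, Bool.forall_bool, cns₃, sub_pos, sub_nonneg]
    refine and_congr ?_ ?_
    · constructor
      · rintro ⟨x, hx, h1, h2⟩; exact ⟨x, hx, fun s => ⟨(h2 s).2, (h2 s).1⟩, h1⟩
      · rintro ⟨x, hx, h2, h1⟩; exact ⟨x, hx, h1, fun s => ⟨(h2 s).2, (h2 s).1⟩⟩
    · constructor
      · rintro ⟨x, hx, ⟨h1, h2⟩, h3⟩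
        exact ⟨x, hx, fun s => ⟨(h2 s).2, (h2 s).1⟩, h1, h3⟩
      · rintro ⟨x, hx, h2, h1, h3⟩
        exact ⟨x, hx, ⟨h1, fun s => ⟨(h2 s).2, (h2 s).1⟩⟩, h3⟩
  have f : ∀ s b, (∃ x ∈ TriLine V j l m, cns₃ V j l m (some (s, b)) x = 0 ∧
      ∀ t, t ≠ some (s, b) → 0 < cns₃ V j l m t x) ↔
      ∃ x : Fin 3 → ℝ, x s = (if b then 0 else 1) ∧ (∀ t, t ≠ s → 0 < x t ∧ x t < 1) ∧
        TriRel (V 0) (pt V j (x 0)) (pt V l (x 1)) (pt V m (x 2)) := by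
    intro s b
    refine exists_congr fun x => ?_
    simp only [Option.forall, Prod.forall, cns₃, TriLine, Set.mem_ofPred_eq, TriRel, ne_eq,
      reduceCtorEq, not_false_eq_true, true_implies, Option.some.injEq, Prod.mk.injEq,
      Bool.forall_bool]
    cases b
    · simp only [cns₃, sub_eq_zero]
      constructor
      · rintro ⟨h1, h2, h3, h4⟩
        refine ⟨by simpa using h2.symm, fun t ht => ⟨(h4 t).2 (by simp), ?_⟩, h1, h3⟩
        have := (h4 t).1 (by simp [ht]); linarith
      · rintro ⟨h2, h4, h1, h3⟩
        refine ⟨h1, by simpa using h2.symm, h3, fun t => ⟨fun ht => ?_, fun _ => ?_⟩⟩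
        · have := (h4 t (by simpa using ht)).2; linarith
        · by_cases ht : t = s
          · subst ht; simp at h2; rw [h2]; norm_num
          · exact (h4 t ht).1
    · simp only [cns₃]
      constructor
      · rintro ⟨h1, h2, h3, h4⟩
        refine ⟨by simpa using h2, fun t ht => ⟨(h4 t).2 (by simp [ht]), ?_⟩, h1, h3⟩
        have := (h4 t).1 (by simp); linarith
      · rintro ⟨h2, h4, h1, h3⟩
        refine ⟨h1, by simpa using h2, h3, fun t => ⟨fun _ => ?_, fun ht => ?_⟩⟩
        · by_cases ht : t = s
          · subst ht; simp at h2; rw [h2]; norm_num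
          · have := (h4 t ht).2; linarith
        · exact (h4 t (by simpa using ht)).1
  simp_rw [f] at key
  rw [ind_congr e0, ind_congr e1] at key
  have g0 : ∀ c : ℝ, (∃ x : Fin 3 → ℝ, x 0 = c ∧ (∀ t, t ≠ 0 → 0 < x t ∧ x t < 1) ∧
      TriRel (V 0) (pt V j (x 0)) (pt V l (x 1)) (pt V m (x 2))) ↔
      ∃ y z : ℝ, (0 < y ∧ y < 1) ∧ (0 < z ∧ z < 1) ∧
        TriRel (V 0) (pt V j c) (pt V l y) (pt V m z) := by
    intro c
    constructor
    · rintro ⟨x, rfl, h2, h3⟩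
      exact ⟨x 1, x 2, h2 1 (by decide), h2 2 (by decide), h3⟩
    · rintro ⟨b, d, h1, h2, h3⟩
      refine ⟨![c, b, d], rfl, fun t ht => ?_, h3⟩
      fin_cases t
      · exact absurd rfl ht
      · exact h1
      · exact h2
  have g1 : ∀ c : ℝ, (∃ x : Fin 3 → ℝ, x 1 = c ∧ (∀ t, t ≠ 1 → 0 < x t ∧ x t < 1) ∧
      TriRel (V 0) (pt V j (x 0)) (pt V l (x 1)) (pt V m (x 2))) ↔
      ∃ y z : ℝ, (0 < y ∧ y < 1) ∧ (0 < z ∧ z < 1) ∧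
        TriRel (V 0) (pt V j y) (pt V l c) (pt V m z) := by
    intro c
    constructor
    · rintro ⟨x, rfl, h2, h3⟩
      exact ⟨x 0, x 2, h2 0 (by decide), h2 2 (by decide), h3⟩
    · rintro ⟨b, d, h1, h2, h3⟩
      refine ⟨![b, c, d], rfl, fun t ht => ?_, h3⟩
      fin_cases t
      · exact h1
      · exact absurd rfl ht
      · exact h2
  have g2 : ∀ c : ℝ, (∃ x : Fin 3 → ℝ, x 2 = c ∧ (∀ t, t ≠ 2 → 0 < x t ∧ x t < 1) ∧
      TriRel (V 0) (pt V j (x 0)) (pt V l (x 1)) (pt V m (x 2))) ↔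
      ∃ y z : ℝ, (0 < y ∧ y < 1) ∧ (0 < z ∧ z < 1) ∧
        TriRel (V 0) (pt V j y) (pt V l z) (pt V m c) := by
    intro c
    constructor
    · rintro ⟨x, rfl, h2, h3⟩
      exact ⟨x 0, x 1, h2 0 (by decide), h2 1 (by decide), h3⟩
    · rintro ⟨b, d, h1, h2, h3⟩
      refine ⟨![b, d, c], rfl, fun t ht => ?_, h3⟩
      fin_cases t
      · exact h1
      · exact h2
      · exact absurd rfl ht
  simp only [if_true, Bool.false_eq_true, if_false, g0, g1, g2, pt_zero, pt_one] at key
  linear_combination key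

lemma baseSol_unique : ∀ s t, BaseSol V j l m s → BaseSol V j l m t → s = t := by
  rintro ⟨a, b, c⟩ ⟨a', b', c'⟩ ⟨hs, h1, h2⟩ ⟨hs', h1', h2'⟩
  have key : (![a, b, c] : Fin 3 → ℝ) = ![a', b', c'] := by
    refine cell_hit_unique (Sp := fun x => pt V m (x 2) = V 0)
      (H.isSystemLine_tri hj hl hm) (affineFun_cns₃ V j l m)
      (H.tri_box hj hl hm) tri_special_affine (H.tri_one_active hj hl hm)
      (H.tri_two_active hj hl hm) none h1 h1' h2 ?_ h2' ?_
    · rintro (_ | ⟨s, b⟩) h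
      · exact absurd rfl h
      · fin_cases s <;> cases b <;> simp [cns₃] <;> tauto
    · rintro (_ | ⟨s, b⟩) h
      · exact absurd rfl h
      · fin_cases s <;> cases b <;> simp [cns₃] <;> tauto
  have k0 := congrFun key 0
  have k1 := congrFun key 1
  have k2 := congrFun key 2
  simp at k0 k1 k2
  simp [k0, k1, k2]

lemma baseSol_re_ne {s} (h : BaseSol V j l m s) :
    (V 0 + pt V m s.2.2 - pt V j s.1 - pt V l s.2.1).re ≠ 0 := by
  intro hre
  obtain ⟨⟨h1, h2, h3⟩, h4, h5⟩ := h
  refine H.no_vertex 0 H.n_pos m hm j hj l hl ![0, s.1, s.2.2, s.2.1]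
    ⟨by simpa [pt_zero] using h4, by simpa [pt_zero] using h5⟩ ?_
    (by simpa [pt_zero] using (H.pt_ne_bot hm h3).symm) ?_ 0 (.inl rfl)
  · simp [Fin.forall_fin_succ, h1.1.le, h1.2.le, h2.1.le, h2.2.le, h3.1.le, h3.2.le]
  · have := Complex.ext (z := V 0 + pt V m s.2.2 - pt V j s.1 - pt V l s.2.1) (w := 0) hre h5
    simp only [Matrix.cons_val, pt_zero]
    linear_combination this

end Tri

end Core

/-- The sum over triples of edges. -/
def tripleSum (n : ℕ) (f : ℕ → ℕ → ℕ → ZMod 2) : ZMod 2 :=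
  ∑ j ∈ Finset.range n, ∑ l ∈ Finset.range n, ∑ m ∈ Finset.range n, f j l m

lemma tripleSum_congr {n : ℕ} {f g : ℕ → ℕ → ℕ → ZMod 2}
    (h : ∀ j l m, j < n → l < n → m < n → f j l m = g j l m) : tripleSum n f = tripleSum n g :=
  Finset.sum_congr rfl fun j hj => Finset.sum_congr rfl fun l hl => Finset.sum_congr rfl fun m hm =>
    h j l m (by simpa using hj) (by simpa using hl) (by simpa using hm)

lemma tripleSum_add {n : ℕ} (f g : ℕ → ℕ → ℕ → ZMod 2) :
    tripleSum n (fun j l m => f j l m + g j l m) = tripleSum n f + tripleSum n g := by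
  simp [tripleSum, Finset.sum_add_distrib]

namespace Core

variable {V : ℕ → ℂ} {n : ℕ} (H : Core V n)

include H

lemma tripleSum_baseSol : tripleSum n (fun j l m => ind (∃ s, BaseSol V j l m s)) =
    tripleSum n (fun j l m => ind (BaseEnd V j l m)) := by
  have key : tripleSum n (fun j l m => ind (∃ s, BaseSol V j l m s) + ind (BaseEnd V j l m) +
      ((ind (∃ y z : ℝ, (0 < y ∧ y < 1) ∧ (0 < z ∧ z < 1) ∧ TriRel (V 0) (V j) (pt V l y) (pt V m z))
        + ind (∃ y z : ℝ, (0 < y ∧ y < 1) ∧ (0 < z ∧ z < 1) ∧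
          TriRel (V 0) (V (j + 1)) (pt V l y) (pt V m z))) +
      (ind (∃ y z : ℝ, (0 < y ∧ y < 1) ∧ (0 < z ∧ z < 1) ∧ TriRel (V 0) (pt V j y) (V l) (pt V m z))
        + ind (∃ y z : ℝ, (0 < y ∧ y < 1) ∧ (0 < z ∧ z < 1) ∧
          TriRel (V 0) (pt V j y) (V (l + 1)) (pt V m z))) +
      (ind (∃ y z : ℝ, (0 < y ∧ y < 1) ∧ (0 < z ∧ z < 1) ∧ TriRel (V 0) (pt V j y) (pt V l z) (V m))
        + ind (∃ y z : ℝ, (0 < y ∧ y < 1) ∧ (0 < z ∧ z < 1) ∧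
          TriRel (V 0) (pt V j y) (pt V l z) (V (m + 1)))))) = tripleSum n (fun _ _ _ => 0) :=
    tripleSum_congr fun j l m hj hl hm => H.tri_relation hj hl hm
  rw [tripleSum_add (fun j l m => ind (∃ s, BaseSol V j l m s) + ind (BaseEnd V j l m)),
    tripleSum_add, tripleSum_add, tripleSum_add] at key
  have z : tripleSum n (fun _ _ _ => 0) = 0 := by simp [tripleSum]
  have h1 : tripleSum n (fun j l m => ind (∃ y z : ℝ, (0 < y ∧ y < 1) ∧ (0 < z ∧ z < 1) ∧
      TriRel (V 0) (V j) (pt V l y) (pt V m z)) + ind (∃ y z : ℝ, (0 < y ∧ y < 1) ∧ (0 < z ∧ z < 1) ∧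
          TriRel (V 0) (V (j + 1)) (pt V l y) (pt V m z))) = 0 := by
    rw [tripleSum, Finset.sum_comm]
    refine Finset.sum_eq_zero fun l _ => ?_
    rw [Finset.sum_comm]
    refine Finset.sum_eq_zero fun m _ => ?_
    exact sum_cyclic (f := fun j => ind (∃ y z : ℝ, (0 < y ∧ y < 1) ∧ (0 < z ∧ z < 1) ∧
      TriRel (V 0) (V j) (pt V l y) (pt V m z))) (by simp only [H.V_n])
  have h2 : tripleSum n (fun j l m => ind (∃ y z : ℝ, (0 < y ∧ y < 1) ∧ (0 < z ∧ z < 1) ∧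
      TriRel (V 0) (pt V j y) (V l) (pt V m z)) + ind (∃ y z : ℝ, (0 < y ∧ y < 1) ∧
        (0 < z ∧ z < 1) ∧ TriRel (V 0) (pt V j y) (V (l + 1)) (pt V m z))) = 0 := by
    refine Finset.sum_eq_zero fun j _ => ?_
    rw [Finset.sum_comm]
    refine Finset.sum_eq_zero fun m _ => ?_
    exact sum_cyclic (f := fun l => ind (∃ y z : ℝ, (0 < y ∧ y < 1) ∧ (0 < z ∧ z < 1) ∧
      TriRel (V 0) (pt V j y) (V l) (pt V m z))) (by simp only [H.V_n])
  have h3 : tripleSum n (fun j l m => ind (∃ y z : ℝ, (0 < y ∧ y < 1) ∧ (0 < z ∧ z < 1) ∧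
      TriRel (V 0) (pt V j y) (pt V l z) (V m)) + ind (∃ y z : ℝ, (0 < y ∧ y < 1) ∧
        (0 < z ∧ z < 1) ∧ TriRel (V 0) (pt V j y) (pt V l z) (V (m + 1)))) = 0 := by
    refine Finset.sum_eq_zero fun j _ => Finset.sum_eq_zero fun l _ => ?_
    exact sum_cyclic (f := fun m => ind (∃ y z : ℝ, (0 < y ∧ y < 1) ∧ (0 < z ∧ z < 1) ∧
      TriRel (V 0) (pt V j y) (pt V l z) (V m))) (by simp only [H.V_n])
  rw [z, h1, h2, h3] at key
  linear_combination key - zmod2_add_self (tripleSum n (fun j l m => ind (BaseEnd V j l m)))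

/-- Triangles at `V 0` are the squares with a vertex at `V 0`, up to displacement. -/
lemma base_split {j l m : ℕ} (hjl : j ≤ l) (hl : l < n) (hm : m < n) :
    ind (StartAt V (Comp₁ V j l) 0 m) + ind (FinishAt V (Comp₁ V j l) m n) +
      (ind (StartAt V (Comp₂ V j l) 0 m) + ind (FinishAt V (Comp₂ V j l) m n)) =
    if j < l then ind (∃ s, BaseSol V j l m s) + ind (∃ s, BaseSol V l j m s)
    else ind (∃ s, BaseSol V j j m s) := by
  have hj := hjl.trans_lt hl
  have e1 : StartAt V (Comp₁ V j l) 0 m ↔ ∃ s, BaseSol V j l m s ∧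
      ((j = l → s.1 < s.2.1) ∧ 0 < (V 0 + pt V m s.2.2 - pt V j s.1 - pt V l s.2.1).re) := by
    constructor
    · rintro ⟨c, hc, a, b, ⟨ha, hb, h⟩, h1, h2, h3⟩
      exact ⟨(a, b, c), ⟨⟨ha, hb, hc⟩, h1, h2⟩, h, h3⟩
    · rintro ⟨⟨a, b, c⟩, ⟨⟨ha, hb, hc⟩, h1, h2⟩, h, h3⟩
      exact ⟨c, hc, a, b, ⟨ha, hb, h⟩, h1, h2, h3⟩
  have e2 : FinishAt V (Comp₁ V j l) m n ↔ ∃ s, BaseSol V l j m s ∧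
      ((j = l → s.2.1 < s.1) ∧ 0 < (V 0 + pt V m s.2.2 - pt V l s.1 - pt V j s.2.1).re) := by
    constructor
    · rintro ⟨c, hc, a, b, ⟨ha, hb, h⟩, h1, h2, h3⟩
      rw [H.V_n] at h1 h2 h3
      refine ⟨(b, a, c), ⟨⟨hb, ha, hc⟩, ?_, ?_⟩, h, ?_⟩
      · dsimp only; linear_combination -h1
      · rw [← h2]; congr 1; dsimp only; ring
      · convert h3 using 2; dsimp only; ring
    · rintro ⟨⟨b, a, c⟩, ⟨⟨hb, ha, hc⟩, h1, h2⟩, h, h3⟩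
      refine ⟨c, hc, a, b, ⟨ha, hb, h⟩, ?_⟩
      rw [H.V_n]
      refine ⟨?_, ?_, ?_⟩
      · dsimp only at h1; linear_combination -h1
      · rw [← h2]; congr 1; dsimp only; ring
      · convert h3 using 2; dsimp only; ring
  have e3 : StartAt V (Comp₂ V j l) 0 m ↔ ∃ s, BaseSol V l j m s ∧
      ((j = l → s.2.1 < s.1) ∧ (V 0 + pt V m s.2.2 - pt V l s.1 - pt V j s.2.1).re < 0) := by
    constructor
    · rintro ⟨c, hc, a, b, ⟨ha, hb, h⟩, h1, h2, h3⟩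
      refine ⟨(b, a, c), ⟨⟨hb, ha, hc⟩, ?_, ?_⟩, h, ?_⟩
      · dsimp only; linear_combination I * h1 + (pt V m c - V 0) * I_sq
      · simp only [add_im, sub_im] at h2 ⊢; linarith
      · simp only [add_re, sub_re] at h3 ⊢; linarith
    · rintro ⟨⟨b, a, c⟩, ⟨⟨hb, ha, hc⟩, h1, h2⟩, h, h3⟩
      refine ⟨c, hc, a, b, ⟨ha, hb, h⟩, ?_, ?_, ?_⟩
      · dsimp only at h1; linear_combination -I * h1 - (pt V j a - pt V l b) * I_sq
      · simp only [add_im, sub_im] at h2 ⊢; linarith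
      · simp only [add_re, sub_re] at h3 ⊢; linarith
  have e4 : FinishAt V (Comp₂ V j l) m n ↔ ∃ s, BaseSol V j l m s ∧
      ((j = l → s.1 < s.2.1) ∧ (V 0 + pt V m s.2.2 - pt V j s.1 - pt V l s.2.1).re < 0) := by
    constructor
    · rintro ⟨c, hc, a, b, ⟨ha, hb, h⟩, h1, h2, h3⟩
      rw [H.V_n] at h1 h2 h3
      refine ⟨(a, b, c), ⟨⟨ha, hb, hc⟩, ?_, ?_⟩, h, ?_⟩
      · dsimp only; linear_combination -I * h1 + (pt V m c - V 0) * I_sq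
      · simp only [add_im, sub_im] at h2 ⊢; linarith
      · simp only [add_re, sub_re] at h3 ⊢; linarith
    · rintro ⟨⟨a, b, c⟩, ⟨⟨ha, hb, hc⟩, h1, h2⟩, h, h3⟩
      refine ⟨c, hc, a, b, ⟨ha, hb, h⟩, ?_⟩
      rw [H.V_n]
      refine ⟨?_, ?_, ?_⟩
      · dsimp only at h1; linear_combination I * h1 + (pt V l b - pt V j a) * I_sq
      · simp only [add_im, sub_im] at h2 ⊢; linarith
      · simp only [add_re, sub_re] at h3 ⊢; linarith
  have neg : ∀ {j l : ℕ}, j < n → l < n → ∀ (B : ℝ × ℝ × ℝ → Prop),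
      (∃ s, BaseSol V j l m s ∧ (B s ∧ (V 0 + pt V m s.2.2 - pt V j s.1 - pt V l s.2.1).re < 0)) ↔
      ∃ s, (BaseSol V j l m s ∧ B s) ∧
        ¬ 0 < (V 0 + pt V m s.2.2 - pt V j s.1 - pt V l s.2.1).re := by
    intro j l hj hl B
    refine exists_congr fun s => ?_
    rw [← and_assoc]
    refine and_congr_right fun h => ?_
    have := H.baseSol_re_ne hj hl hm h.1
    rw [not_lt]
    exact ⟨le_of_lt, fun h' => lt_of_le_of_ne h' this⟩
  have split : ∀ {j l : ℕ}, j < n → l < n → ∀ (B : ℝ × ℝ × ℝ → Prop),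
      ind (∃ s, BaseSol V j l m s ∧
        (B s ∧ 0 < (V 0 + pt V m s.2.2 - pt V j s.1 - pt V l s.2.1).re)) +
      ind (∃ s, BaseSol V j l m s ∧
        (B s ∧ (V 0 + pt V m s.2.2 - pt V j s.1 - pt V l s.2.1).re < 0)) =
      ind (∃ s, BaseSol V j l m s ∧ B s) := by
    intro j l hj hl B
    rw [ind_congr (neg hj hl B), ind_split (A := fun s => BaseSol V j l m s ∧ B s)
      (fun s => 0 < (V 0 + pt V m s.2.2 - pt V j s.1 - pt V l s.2.1).re)
      (fun s t hs ht => H.baseSol_unique hj hl hm s t hs.1 ht.1)]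
    simp_rw [and_assoc]
  rw [ind_congr e1, ind_congr e2, ind_congr e3, ind_congr e4]
  have s1 := split hj hl (fun s => j = l → s.1 < s.2.1)
  have s2 := split hl hj (fun s => j = l → s.2.1 < s.1)
  have s3 : ind (∃ s, BaseSol V j l m s ∧ (j = l → s.1 < s.2.1)) +
      ind (∃ s, BaseSol V l j m s ∧ (j = l → s.2.1 < s.1)) =
      if j < l then ind (∃ s, BaseSol V j l m s) + ind (∃ s, BaseSol V l j m s)
      else ind (∃ s, BaseSol V j j m s) := by
    split_ifs with h
    · simp [h.ne]
    · obtain rfl : j = l := by omega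
      rw [ind_split (fun s => s.1 < s.2.1) (H.baseSol_unique hj hj hm)]
      congr 2
      · simp
      · rw [eq_iff_iff]
        refine exists_congr fun s => and_congr_right fun hs => ?_
        simp only [true_implies, not_lt]
        refine ⟨le_of_lt, fun h => lt_of_le_of_ne h fun h' => ?_⟩
        have := hs.2.1
        rw [h', sub_self, mul_zero, sub_eq_zero] at this
        exact H.pt_ne_bot hm hs.1.2.2 this
  linear_combination s1 + s2 + s3

lemma base_sum :
    pairSum n (fun j l => ∑ m ∈ Finset.range n,
      (ind (StartAt V (Comp₁ V j l) 0 m) + ind (FinishAt V (Comp₁ V j l) m n))) +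
    pairSum n (fun i k => ∑ m ∈ Finset.range n,
      (ind (StartAt V (Comp₂ V i k) 0 m) + ind (FinishAt V (Comp₂ V i k) m n))) =
    tripleSum n (fun j l m => ind (∃ s, BaseSol V j l m s)) := by
  rw [← pairSum_add, tripleSum, sum_sum_eq_pairSum]
  refine pairSum_congr fun j l hjl hl => ?_
  rw [← Finset.sum_add_distrib]
  rw [Finset.sum_congr rfl fun m hm => H.base_split hjl hl (by simpa using hm)]
  split_ifs
  · rw [Finset.sum_add_distrib]
  · rfl

/-- The number of squares has the same parity as the number of degenerate ends. -/
theorem square_parity : pairSum n (fun i k => pairSum n fun j l => ind (CellSq V i k j l)) =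
    tripleSum n (fun j l m => ind (BaseEnd V j l m)) +
    pairSum n (fun i k => pairSum n fun j l => ind (CellEnd V i k j l)) := by
  have h := H.sum_cellSq_add_sum_cellEnd
  rw [H.base_sum, H.tripleSum_baseSol] at h
  linear_combination h - zmod2_add_self (tripleSum n (fun j l m => ind (BaseEnd V j l m)) +
    pairSum n (fun i k => pairSum n fun j l => ind (CellEnd V i k j l)))

end Core

lemma combination_inj {v w : ℂ} (h : crs v w ≠ 0) {a b c d : ℝ} :
    (a * v + b * w : ℂ) = c * v + d * w ↔ a = c ∧ b = d := by
  constructor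
  · intro e
    have e1 := congrArg re e
    have e2 := congrArg im e
    simp only [add_re, re_ofReal_mul, add_im, im_ofReal_mul] at e1 e2
    have h1 : (a - c) * crs v w = 0 := by
      simp only [crs]; linear_combination w.im * e1 - w.re * e2
    have h2 : (b - d) * crs v w = 0 := by
      simp only [crs]; linear_combination v.re * e2 - v.im * e1
    exact ⟨sub_eq_zero.1 ((mul_eq_zero.1 h1).resolve_right h),
      sub_eq_zero.1 ((mul_eq_zero.1 h2).resolve_right h)⟩
  · rintro ⟨rfl, rfl⟩; rfl

/-- The coordinates of `I` and of the real axis in a positively oriented basis. -/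
structure Frame (v w : ℂ) (P Q R b c k : ℝ) : Prop where
  pos : 0 < k
  crs_eq : crs v w = k
  dt_eq : dt v w = -P * k
  im_fst : v.im = -c * k
  im_snd : w.im = b * k
  sq_fst : normSq v = Q * k
  sq_snd : normSq w = -R * k
  Q_pos : 0 < Q
  R_neg : R < 0
  rel : P ^ 2 + 1 = -(Q * R)
  I_fst : I * v = P * v + Q * w
  I_snd : I * w = R * v - P * w
  one_eq : (1 : ℂ) = b * v + c * w

lemma exists_frame {v w : ℂ} (h : 0 < crs v w) : ∃ P Q R b c k, Frame v w P Q R b c k := by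
  have hv : v ≠ 0 := by rintro rfl; simp [crs] at h
  have hw : w ≠ 0 := by rintro rfl; simp [crs] at h
  have h0 := h.ne'
  refine ⟨-dt v w / crs v w, normSq v / crs v w, -normSq w / crs v w, w.im / crs v w,
    -v.im / crs v w, crs v w, h, rfl, ?_, ?_, ?_, ?_, ?_, ?_, ?_, ?_, ?_, ?_, ?_⟩
  · field_simp
  · field_simp
  · field_simp
  · field_simp
  · field_simp
  · exact div_pos (normSq_pos.2 hv) h
  · exact div_neg_of_neg_of_pos (neg_neg_of_pos (normSq_pos.2 hw)) h
  · field_simp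
    simp only [normSq_apply, crs, dt]; ring
  · apply Complex.ext
    · simp only [add_re, re_ofReal_mul, I_mul_re]; field_simp
      simp only [normSq_apply, crs, dt]; ring
    · simp only [add_im, im_ofReal_mul, I_mul_im]; field_simp
      simp only [normSq_apply, crs, dt]; ring
  · apply Complex.ext
    · simp only [sub_re, add_re, re_ofReal_mul, I_mul_re]; field_simp
      simp only [normSq_apply, crs, dt]; ring
    · simp only [sub_im, add_im, im_ofReal_mul, I_mul_im]; field_simp
      simp only [normSq_apply, crs, dt]; ring
  · apply Complex.ext
    · simp only [add_re, re_ofReal_mul, one_re]; field_simp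
      simp only [crs]; ring
    · simp only [add_im, im_ofReal_mul, one_im]; field_simp
      ring

namespace Frame

variable {v w : ℂ} {P Q R b c k : ℝ} (F : Frame v w P Q R b c k)

include F

lemma crs_ne : crs v w ≠ 0 := F.crs_eq ▸ F.pos.ne'

lemma real_pos_iff {x y : ℝ} : (((x * v + y * w : ℂ)).im = 0 ∧ 0 < ((x * v + y * w : ℂ)).re) ↔
    ∃ t : ℝ, 0 < t ∧ x = t * b ∧ y = t * c := by
  have e : ∀ t : ℝ, (t : ℂ) = (t * b : ℝ) * v + (t * c : ℝ) * w := by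
    intro t
    push_cast
    linear_combination (t : ℂ) * F.one_eq
  constructor
  · rintro ⟨h1, h2⟩
    have : (x * v + y * w : ℂ) = ((x * v + y * w : ℂ).re : ℂ) := Complex.ext rfl h1
    exact ⟨_, h2, (combination_inj F.crs_ne).1 (this.trans (e _))⟩
  · rintro ⟨t, ht, rfl, rfl⟩
    rw [← e]
    simpa using ht

lemma I_mul_iff {x y z u : ℝ} : ((x * v + y * w : ℂ) = I * (z * v + u * w)) ↔
    x = P * z + R * u ∧ y = Q * z - P * u := by
  have : I * (z * v + u * w) = ((P * z + R * u : ℝ) : ℂ) * v + ((Q * z - P * u : ℝ) : ℂ) * w := by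
    push_cast
    linear_combination z * F.I_fst + u * F.I_snd
  rw [this, combination_inj F.crs_ne]

/-- The square relation in coordinates. -/
lemma semiSq_iff {o a₁ a₃ a₂ a₄ : ℂ} {x₁ y₁ x₃ y₃ x₂ y₂ x₄ y₄ : ℝ}
    (h₁ : a₁ = o + x₁ * v + y₁ * w) (h₃ : a₃ = o + x₃ * v + y₃ * w) (h₂ : a₂ = o + x₂ * v + y₂ * w)
    (h₄ : a₄ = o + x₄ * v + y₄ * w) :
    SemiSq a₁ a₃ a₂ a₄ ↔ x₃ - x₁ = P * (x₄ - x₂) + R * (y₄ - y₂) ∧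
      y₃ - y₁ = Q * (x₄ - x₂) - P * (y₄ - y₂) ∧
      ∃ t : ℝ, 0 < t ∧ x₁ + x₃ - x₂ - x₄ = t * b ∧ y₁ + y₃ - y₂ - y₄ = t * c := by
  rw [← F.real_pos_iff, ← and_assoc, ← F.I_mul_iff, SemiSq]
  have e1 : a₁ + a₃ - a₂ - a₄ =
      ((x₁ + x₃ - x₂ - x₄ : ℝ) : ℂ) * v + ((y₁ + y₃ - y₂ - y₄ : ℝ) : ℂ) * w := by
    rw [h₁, h₂, h₃, h₄]; push_cast; ring
  have e2 : a₃ - a₁ = ((x₃ - x₁ : ℝ) : ℂ) * v + ((y₃ - y₁ : ℝ) : ℂ) * w := by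
    rw [h₁, h₃]; push_cast; ring
  have e3 : a₄ - a₂ = ((x₄ - x₂ : ℝ) : ℂ) * v + ((y₄ - y₂ : ℝ) : ℂ) * w := by
    rw [h₂, h₄]; push_cast; ring
  rw [e1, e2, e3]

/-- The triangle relation in coordinates. -/
lemma triRel_iff {o p q a : ℂ} {x₁ y₁ x₂ y₂ x₃ y₃ : ℝ}
    (h₁ : p = o + x₁ * v + y₁ * w) (h₂ : q = o + x₂ * v + y₂ * w) (h₃ : a = o + x₃ * v + y₃ * w) :
    TriRel o p q a ↔ (x₃ = P * (x₂ - x₁) + R * (y₂ - y₁) ∧ y₃ = Q * (x₂ - x₁) - P * (y₂ - y₁)) ∧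
      0 < (y₃ - y₁ - y₂) * b - (x₃ - x₁ - x₂) * c := by
  rw [← F.I_mul_iff, TriRel]
  have e1 : o + a - p - q = ((x₃ - x₁ - x₂ : ℝ) : ℂ) * v + ((y₃ - y₁ - y₂ : ℝ) : ℂ) * w := by
    rw [h₁, h₂, h₃]; push_cast; ring
  have e2 : a - o = (x₃ : ℂ) * v + (y₃ : ℂ) * w := by
    rw [h₃]; ring
  have e3 : q - p = ((x₂ - x₁ : ℝ) : ℂ) * v + ((y₂ - y₁ : ℝ) : ℂ) * w := by
    rw [h₁, h₂]; push_cast; ring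
  rw [e1, e2, e3]
  refine and_congr_right fun _ => ?_
  simp only [add_im, im_ofReal_mul, F.im_fst, F.im_snd]
  have : (x₃ - x₁ - x₂) * (-c * k) + (y₃ - y₁ - y₂) * (b * k) =
    ((y₃ - y₁ - y₂) * b - (x₃ - x₁ - x₂) * c) * k := by ring
  rw [this]
  exact mul_pos_iff_of_pos_right F.pos

end Frame

/-- Squares with both diagonals joining the rays along `a` and `b`. -/
def CornerSq (a b : ℂ) : Prop := ∃ x y x' y' : ℝ, 0 < x ∧ 0 < y ∧ 0 < x' ∧ 0 < y' ∧
  SemiSq (x * a) (y * b) (x' * a) (y' * b)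

/-- The first diagonal joins the rays along `a` and `b`, the second one lies on a ray. -/
def CornerFst (a b d : ℂ) (e : ℝ) : Prop := ∃ x y s s' : ℝ, 0 < x ∧ 0 < y ∧ 0 < s ∧ 0 < s' ∧
  0 < e * (s' - s) ∧ SemiSq (x * a) (y * b) (s * d) (s' * d)

/-- The second diagonal joins the rays along `a` and `b`, the first one lies on a ray. -/
def CornerSnd (a b d : ℂ) (e : ℝ) : Prop := ∃ x y s s' : ℝ, 0 < x ∧ 0 < y ∧ 0 < s ∧ 0 < s' ∧
  0 < e * (s' - s) ∧ SemiSq (s * d) (s' * d) (x * a) (y * b)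

/-- Triangles with their three vertices on given rays. -/
def CornerTri (d₁ d₂ d₃ : ℂ) : Prop := ∃ x y z : ℝ, 0 < x ∧ 0 < y ∧ 0 < z ∧
  TriRel 0 (x * d₁) (y * d₂) (z * d₃)

/-- Reflection in the vertical axis. -/
noncomputable def mirror (z : ℂ) : ℂ := -(starRingEnd ℂ z)

lemma mirror_real_mul (x : ℝ) (z : ℂ) : mirror (x * z) = x * mirror z := by simp [mirror]

lemma mirror_im (z : ℂ) : (mirror z).im = z.im := by simp [mirror]

lemma crs_mirror (z w : ℂ) : crs (mirror z) (mirror w) = -crs z w := by simp [mirror, crs]; ring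

lemma dt_mirror (z w : ℂ) : dt (mirror z) (mirror w) = dt z w := by simp [mirror, dt]

lemma semiSq_mirror {a₁ a₃ a₂ a₄ : ℂ} :
    SemiSq (mirror a₁) (mirror a₃) (mirror a₂) (mirror a₄) ↔ SemiSq a₂ a₄ a₁ a₃ := by
  simp only [SemiSq, mirror, Complex.ext_iff, sub_re, sub_im, neg_re, neg_im, conj_re, conj_im,
    I_mul_re, I_mul_im, add_re, add_im]
  constructor <;> rintro ⟨⟨h1, h2⟩, h3, h4⟩ <;> refine ⟨⟨?_, ?_⟩, ?_, ?_⟩ <;> linarith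

lemma triRel_mirror {p q a : ℂ} : TriRel 0 (mirror p) (mirror q) (mirror a) ↔ TriRel 0 q p a := by
  simp only [TriRel, mirror, Complex.ext_iff, sub_re, sub_im, neg_re, neg_im, conj_re, conj_im,
    I_mul_re, I_mul_im, add_re, add_im, zero_re, zero_im]
  constructor <;> rintro ⟨⟨h1, h2⟩, h3⟩ <;> refine ⟨⟨?_, ?_⟩, ?_⟩ <;> linarith

lemma cornerSq_mirror {a b : ℂ} : CornerSq (mirror a) (mirror b) ↔ CornerSq a b := by
  simp only [CornerSq, ← mirror_real_mul, semiSq_mirror]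
  constructor
  · rintro ⟨x, y, x', y', h1, h2, h3, h4, h⟩; exact ⟨x', y', x, y, h3, h4, h1, h2, h⟩
  · rintro ⟨x, y, x', y', h1, h2, h3, h4, h⟩; exact ⟨x', y', x, y, h3, h4, h1, h2, h⟩

lemma cornerFst_mirror {a b d : ℂ} {e : ℝ} :
    CornerFst (mirror a) (mirror b) (mirror d) e ↔ CornerSnd a b d e := by
  simp only [CornerFst, CornerSnd, ← mirror_real_mul, semiSq_mirror]

lemma cornerSnd_mirror {a b d : ℂ} {e : ℝ} :
    CornerSnd (mirror a) (mirror b) (mirror d) e ↔ CornerFst a b d e := by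
  simp only [CornerFst, CornerSnd, ← mirror_real_mul, semiSq_mirror]

lemma cornerTri_mirror {d₁ d₂ d₃ : ℂ} :
    CornerTri (mirror d₁) (mirror d₂) (mirror d₃) ↔ CornerTri d₂ d₁ d₃ := by
  simp only [CornerTri, ← mirror_real_mul, triRel_mirror]
  constructor
  · rintro ⟨x, y, z, h1, h2, h3, h⟩; exact ⟨y, x, z, h2, h1, h3, h⟩
  · rintro ⟨x, y, z, h1, h2, h3, h⟩; exact ⟨y, x, z, h2, h1, h3, h⟩

namespace Frame

variable {v w : ℂ} {P Q R b c k : ℝ} (F : Frame v w P Q R b c k)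

include F

lemma cornerSq_iff : CornerSq w v ↔
    P < 0 ∧ 0 < R * c - (1 + P) * b ∧ 0 < Q * b + (1 + P) * c := by
  have hrel := F.rel
  have hQ := F.Q_pos
  have hR := F.R_neg
  constructor
  · rintro ⟨x, y, x', y', hx, hy, hx', hy', h⟩
    rw [F.semiSq_iff (o := 0) (x₁ := 0) (y₁ := x) (x₃ := y) (y₃ := 0) (x₂ := 0)
      (y₂ := x') (x₄ := y') (y₄ := 0) (by push_cast; ring) (by push_cast; ring)
      (by push_cast; ring) (by push_cast; ring)] at h
    obtain ⟨h1, h2, t, ht, h3, h4⟩ := h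
    refine ⟨?_, pos_of_mul_pos_right (a := t) ?_ ht.le, pos_of_mul_pos_right (a := t) ?_ ht.le⟩
    · by_contra! hP
      have := mul_pos hQ hy'
      nlinarith [mul_nonneg hP hx'.le]
    · have : t * (R * c - (1 + P) * b) = 2 * y' := by
        linear_combination -R * h4 + (P + 1) * h3 - (P + 1) * h1 - R * h2 - y' * hrel
      linarith
    · have : t * (Q * b + (1 + P) * c) = 2 * x := by
        linear_combination -Q * h3 - (1 + P) * h4 + Q * h1 - (P - 1) * h2 - x' * hrel
      linarith
  · rintro ⟨hP, hU, hW⟩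
    have e1 : -P * ((Q * b + (1 + P) * c) - 2 * c) = Q * b + (1 + P) * c +
      Q * (R * c - (1 + P) * b) := by linear_combination -c * hrel
    have e2 : -P * ((R * c - (1 + P) * b) + 2 * b) = R * c - (1 + P) * b -
      R * (Q * b + (1 + P) * c) := by linear_combination b * hrel
    refine ⟨Q * b + (1 + P) * c, (R * c - (1 + P) * b) + 2 * b, (Q * b + (1 + P) * c) - 2 * c,
      R * c - (1 + P) * b, hW, ?_, ?_, hU, ?_⟩
    · refine pos_of_mul_pos_right (a := -P) ?_ (by linarith)
      rw [e2]; nlinarith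
    · refine pos_of_mul_pos_right (a := -P) ?_ (by linarith)
      rw [e1]; positivity
    rw [F.semiSq_iff (o := 0) (x₁ := 0) (y₁ := (Q * b + (1 + P) * c)) (x₃ := ((R * c - (1 + P) * b) + 2 * b)) (y₃ := 0) (x₂ := 0)
      (y₂ := ((Q * b + (1 + P) * c) - 2 * c)) (x₄ := (R * c - (1 + P) * b)) (y₄ := 0) (by push_cast; ring) (by push_cast; ring)
      (by push_cast; ring) (by push_cast; ring)]
    refine ⟨?_, ?_, 2, two_pos, ?_, ?_⟩
    · linear_combination b * hrel
    · linear_combination -c * hrel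
    · ring
    · ring

lemma cornerFst_fst : CornerFst w v w (-1) ↔ P < 0 ∧ 0 < b ∧ 0 < R * c - (1 + P) * b := by
  have hrel := F.rel
  have hQ := F.Q_pos
  have hR := F.R_neg
  constructor
  · rintro ⟨x, y, s, s', hx, hy, hs, hs', hd, h⟩
    rw [F.semiSq_iff (o := 0) (x₁ := 0) (y₁ := x) (x₃ := y) (y₃ := 0) (x₂ := 0)
      (y₂ := s) (x₄ := 0) (y₄ := s') (by push_cast; ring) (by push_cast; ring)
      (by push_cast; ring) (by push_cast; ring)] at h
    obtain ⟨h1, h2, t, ht, h3, h4⟩ := h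
    have hb : 0 < b := pos_of_mul_pos_right (a := t) (by linarith) ht.le
    have hP : P < 0 := by
      by_contra! hP
      nlinarith
    refine ⟨hP, hb, pos_of_mul_pos_right (a := t) ?_ ht.le⟩
    have : t * (R * c - (1 + P) * b) = -R * (2 * s') := by
      linear_combination -R * h4 + (1 + P) * h3 - (1 + P) * h1 - R * h2
    rw [this]; exact mul_pos (by linarith) (by linarith)
  · rintro ⟨hP, hb, hU⟩
    refine ⟨-P * b, -R * b, (R * c - (1 + P) * b) / 2 + b, (R * c - (1 + P) * b) / 2,
      by nlinarith, by nlinarith, by linarith, by linarith, by linarith, ?_⟩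
    rw [F.semiSq_iff (o := 0) (x₁ := 0) (y₁ := (-P * b)) (x₃ := (-R * b)) (y₃ := 0) (x₂ := 0)
      (y₂ := ((R * c - (1 + P) * b) / 2 + b)) (x₄ := 0) (y₄ := ((R * c - (1 + P) * b) / 2)) (by push_cast; ring) (by push_cast; ring)
      (by push_cast; ring) (by push_cast; ring)]
    refine ⟨by ring, by ring, -R, by linarith, by ring, by ring⟩

lemma cornerSnd_snd : CornerSnd w v v 1 ↔ P < 0 ∧ c < 0 ∧ 0 < Q * b + (1 + P) * c := by
  have hrel := F.rel
  have hQ := F.Q_pos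
  have hR := F.R_neg
  constructor
  · rintro ⟨x, y, s, s', hx, hy, hs, hs', hd, h⟩
    rw [F.semiSq_iff (o := 0) (x₁ := s) (y₁ := 0) (x₃ := s') (y₃ := 0) (x₂ := 0)
      (y₂ := x) (x₄ := y) (y₄ := 0) (by push_cast; ring) (by push_cast; ring)
      (by push_cast; ring) (by push_cast; ring)] at h
    obtain ⟨h1, h2, t, ht, h3, h4⟩ := h
    have hc : 0 < -c := pos_of_mul_pos_right (a := t) (by linarith) ht.le
    have hP : P < 0 := by
      by_contra! hP
      nlinarith [mul_nonneg hP hx.le, mul_pos hQ hy]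
    refine ⟨hP, by linarith, pos_of_mul_pos_right (a := t) ?_ ht.le⟩
    have : t * (Q * b + (1 + P) * c) = Q * (2 * s) := by
      linear_combination -Q * h3 - (1 + P) * h4 + Q * h1 - (P - 1) * h2 - x * hrel
    rw [this]; positivity
  · rintro ⟨hP, hc, hW⟩
    refine ⟨Q * (-c), P * c, (Q * b + (1 + P) * c) / 2, (Q * b + (1 + P) * c) / 2 - c,
      by nlinarith, by nlinarith, by linarith, by linarith, by linarith, ?_⟩
    rw [F.semiSq_iff (o := 0) (x₁ := ((Q * b + (1 + P) * c) / 2)) (y₁ := 0) (x₃ := ((Q * b + (1 + P) * c) / 2 - c)) (y₃ := 0) (x₂ := 0)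
      (y₂ := (Q * (-c))) (x₄ := (P * c)) (y₄ := 0) (by push_cast; ring) (by push_cast; ring)
      (by push_cast; ring) (by push_cast; ring)]
    refine ⟨by linear_combination -c * hrel, by ring, Q, hQ, by ring, by ring⟩

lemma not_cornerFst_snd : ¬ CornerFst w v v 1 := by
  have hQ := F.Q_pos
  rintro ⟨x, y, s, s', hx, hy, hs, hs', hd, h⟩
  rw [F.semiSq_iff (o := 0) (x₁ := 0) (y₁ := x) (x₃ := y) (y₃ := 0) (x₂ := s)
      (y₂ := 0) (x₄ := s') (y₄ := 0) (by push_cast; ring) (by push_cast; ring)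
      (by push_cast; ring) (by push_cast; ring)] at h
  obtain ⟨h1, h2, t, ht, h3, h4⟩ := h
  nlinarith

lemma not_cornerSnd_fst : ¬ CornerSnd w v w (-1) := by
  have hrel := F.rel
  have hQ := F.Q_pos
  have hR := F.R_neg
  rintro ⟨x, y, s, s', hx, hy, hs, hs', hd, h⟩
  rw [F.semiSq_iff (o := 0) (x₁ := 0) (y₁ := s) (x₃ := 0) (y₃ := s') (x₂ := 0)
      (y₂ := x) (x₄ := y) (y₄ := 0) (by push_cast; ring) (by push_cast; ring)
      (by push_cast; ring) (by push_cast; ring)] at h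
  obtain ⟨h1, h2, t, ht, h3, h4⟩ := h
  have hP : P < 0 := by
    by_contra! hP
    nlinarith [mul_nonneg hP hx.le, mul_pos hQ hy]
  have : P * (s' - s) = -x := by linear_combination P * h2 - Q * h1 + x * hrel
  nlinarith

lemma not_obtuse (hP : P < 0) {m : ℝ} (hm : m ^ 2 = (1 + P) ^ 2) {x y : ℝ} (hx : 0 < x)
    (hy : 0 < y) (h1 : Q * x ≤ m * y) (h2 : -R * y ≤ m * x) : False := by
  have hrel := F.rel
  have hR := F.R_neg
  have h3 : 0 < m := by
    by_contra! h3
    nlinarith [mul_pos F.Q_pos hx]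
  have := mul_le_mul h1 h2 (by nlinarith) (by positivity)
  have h4 : 0 < x * y := mul_pos hx hy
  nlinarith

/-- The local contribution of a corner above the base. -/
lemma corner_sum : ind (CornerSq w v) + ind (CornerFst w v w (-1)) + ind (CornerFst w v v 1) +
    ind (CornerSnd w v w (-1)) + ind (CornerSnd w v v 1) =
      ind (0 < dt w v ∧ 0 < w.im ∧ 0 < v.im) := by
  have hrel := F.rel
  have hQ := F.Q_pos
  have hR := F.R_neg
  have hk := F.pos
  have e1 : 0 < dt w v ↔ P < 0 := by
    have : dt w v = dt v w := by simp only [dt]; ring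
    rw [this, F.dt_eq, mul_pos_iff_of_pos_right hk, neg_pos]
  have e2 : 0 < w.im ↔ 0 < b := by rw [F.im_snd, mul_pos_iff_of_pos_right hk]
  have e3 : 0 < v.im ↔ c < 0 := by rw [F.im_fst, mul_pos_iff_of_pos_right hk, neg_pos]
  rw [ind_congr F.cornerSq_iff, ind_congr F.cornerFst_fst, ind_congr F.cornerSnd_snd,
    ind_false F.not_cornerFst_snd, ind_false F.not_cornerSnd_fst, e1, e2, e3, add_zero, add_zero]
  by_cases hP : P < 0
  swap
  · simp [hP, ind]
  simp only [hP, true_and]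
  by_cases hb : 0 < b <;> by_cases hc : c < 0
  · by_cases hU : 0 < R * c - (1 + P) * b <;> by_cases hW : 0 < Q * b + (1 + P) * c
    · simp [hb, hc, hU, hW, ind, zmod2_add_self]
    · simp [hb, hc, hU, hW, ind]
    · simp [hb, hc, hU, hW, ind]
    · exact (F.not_obtuse hP rfl hb (neg_pos.2 hc) (by linarith) (by linarith)).elim
  · by_cases hU : 0 < R * c - (1 + P) * b
    · by_cases hW : 0 < Q * b + (1 + P) * c
      · simp [hb, hc, hU, hW, ind, zmod2_add_self]
      · push Not at hc hW
        have hc' : 0 < c := by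
          rcases hc.lt_or_eq with h | h
          · exact h
          · subst h; nlinarith [mul_pos hQ hb]
        exact (F.not_obtuse hP (neg_sq (1 + P)) hb hc' (by linarith) (by linarith)).elim
    · simp [hc, hU, ind]
  · by_cases hW : 0 < Q * b + (1 + P) * c
    · by_cases hU : 0 < R * c - (1 + P) * b
      · simp [hb, hc, hU, hW, ind, zmod2_add_self]
      · push Not at hb hU
        have hb' : 0 < -b := by
          rcases hb.lt_or_eq with h | h
          · linarith
          · subst h; nlinarith [mul_pos_of_neg_of_neg hR hc]
        exact (F.not_obtuse hP (neg_sq (1 + P)) hb' (neg_pos.2 hc) (by linarith)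
          (by linarith)).elim
    · simp [hb, hW, ind]
  · by_cases hU : 0 < R * c - (1 + P) * b
    · by_cases hW : 0 < Q * b + (1 + P) * c
      · push Not at hb hc
        have hb' : 0 < -b := by
          rcases hb.lt_or_eq with h | h
          · linarith
          · subst h; nlinarith
        have hc' : 0 < c := by
          rcases hc.lt_or_eq with h | h
          · exact h
          · subst h; nlinarith
        exact (F.not_obtuse hP rfl hb' hc' (by linarith) (by linarith)).elim
      · simp [hb, hc, hW, ind]
    · simp [hb, hc, hU, ind]

lemma cornerSq_iff' : CornerSq v w ↔
    P < 0 ∧ 0 < R * c - (1 + P) * b ∧ 0 < Q * b + (1 + P) * c := by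
  have hrel := F.rel
  have hQ := F.Q_pos
  have hR := F.R_neg
  constructor
  · rintro ⟨x, y, x', y', hx, hy, hx', hy', h⟩
    rw [F.semiSq_iff (o := 0) (x₁ := x) (y₁ := 0) (x₃ := 0) (y₃ := y) (x₂ := x')
      (y₂ := 0) (x₄ := 0) (y₄ := y') (by push_cast; ring) (by push_cast; ring)
      (by push_cast; ring) (by push_cast; ring)] at h
    obtain ⟨h1, h2, t, ht, h3, h4⟩ := h
    refine ⟨?_, pos_of_mul_pos_right (a := t) ?_ ht.le, pos_of_mul_pos_right (a := t) ?_ ht.le⟩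
    · by_contra! hP
      have := mul_pos hQ hx'
      nlinarith [mul_nonneg hP hy'.le]
    · have : t * (R * c - (1 + P) * b) = 2 * x' := by
        linear_combination -R * h4 + (P + 1) * h3 + (P + 1) * h1 + R * h2 - x' * hrel
      linarith
    · have : t * (Q * b + (1 + P) * c) = 2 * y := by
        linear_combination -Q * h3 - (1 + P) * h4 - Q * h1 + (P - 1) * h2 - y' * hrel
      linarith
  · rintro ⟨hP, hU, hW⟩
    have e1 : -P * ((Q * b + (1 + P) * c) - 2 * c) = Q * b + (1 + P) * c +
      Q * (R * c - (1 + P) * b) := by linear_combination -c * hrel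
    have e2 : -P * ((R * c - (1 + P) * b) + 2 * b) = R * c - (1 + P) * b -
      R * (Q * b + (1 + P) * c) := by linear_combination b * hrel
    refine ⟨(R * c - (1 + P) * b) + 2 * b, Q * b + (1 + P) * c, R * c - (1 + P) * b,
      (Q * b + (1 + P) * c) - 2 * c, ?_, hW, hU, ?_, ?_⟩
    · refine pos_of_mul_pos_right (a := -P) ?_ (by linarith)
      rw [e2]; nlinarith
    · refine pos_of_mul_pos_right (a := -P) ?_ (by linarith)
      rw [e1]; positivity
    rw [F.semiSq_iff (o := 0) (x₁ := ((R * c - (1 + P) * b) + 2 * b)) (y₁ := 0) (x₃ := 0) (y₃ := (Q * b + (1 + P) * c)) (x₂ := (R * c - (1 + P) * b))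
      (y₂ := 0) (x₄ := 0) (y₄ := ((Q * b + (1 + P) * c) - 2 * c)) (by push_cast; ring) (by push_cast; ring)
      (by push_cast; ring) (by push_cast; ring)]
    refine ⟨?_, ?_, 2, two_pos, ?_, ?_⟩
    · linear_combination -b * hrel
    · linear_combination c * hrel
    · ring
    · ring

lemma cornerTri_fst : CornerTri w v v ↔ P < 0 ∧ Q * b + (1 + P) * c < 0 := by
  have hrel := F.rel
  have hQ := F.Q_pos
  have hR := F.R_neg
  constructor
  · rintro ⟨x, y, z, hx, hy, hz, h⟩
    rw [F.triRel_iff (x₁ := 0) (y₁ := x) (x₂ := y) (y₂ := 0) (x₃ := z) (y₃ := 0)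
      (by push_cast; ring) (by push_cast; ring) (by push_cast; ring)] at h
    obtain ⟨⟨h1, h2⟩, h3⟩ := h
    have hP : P < 0 := by
      by_contra! hP
      nlinarith [mul_nonneg hP hx.le, mul_pos hQ hy]
    refine ⟨hP, ?_⟩
    have e1 : x = Q * z := by linear_combination -Q * h1 + P * h2 + x * hrel
    have e2 : y = -P * z := by
      refine mul_left_cancel₀ hQ.ne' ?_
      linear_combination -h2 - P * e1
    have : z * (Q * b + (1 + P) * c) < 0 := by
      subst e1 e2; linarith
    exact neg_of_mul_neg_right this hz.le
  · rintro ⟨hP, h⟩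
    refine ⟨Q, -P, 1, hQ, by linarith, one_pos, ?_⟩
    rw [F.triRel_iff (x₁ := 0) (y₁ := Q) (x₂ := (-P)) (y₂ := 0) (x₃ := 1) (y₃ := 0)
      (by push_cast; ring) (by push_cast; ring) (by push_cast; ring)]
    exact ⟨⟨by linear_combination hrel, by ring⟩, by linarith⟩

lemma cornerTri_snd : CornerTri w v w ↔ P < 0 ∧ R * c - (1 + P) * b < 0 := by
  have hrel := F.rel
  have hQ := F.Q_pos
  have hR := F.R_neg
  constructor
  · rintro ⟨x, y, z, hx, hy, hz, h⟩
    rw [F.triRel_iff (x₁ := 0) (y₁ := x) (x₂ := y) (y₂ := 0) (x₃ := 0) (y₃ := z)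
      (by push_cast; ring) (by push_cast; ring) (by push_cast; ring)] at h
    obtain ⟨⟨h1, h2⟩, h3⟩ := h
    have hP : P < 0 := by
      by_contra! hP
      nlinarith [mul_nonneg hP hy.le, mul_pos_of_neg_of_neg hR (neg_neg_of_pos hx)]
    refine ⟨hP, ?_⟩
    have e1 : x = -P * z := by linear_combination P * h2 - Q * h1 + x * hrel
    have e2 : y = -R * z := by
      refine mul_left_cancel₀ hP.ne ?_
      linear_combination -h1 + R * e1
    have : z * (R * c - (1 + P) * b) < 0 := by
      subst e1 e2; linarith
    exact neg_of_mul_neg_right this hz.le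
  · rintro ⟨hP, h⟩
    refine ⟨-P, -R, 1, by linarith, by linarith, one_pos, ?_⟩
    rw [F.triRel_iff (x₁ := 0) (y₁ := (-P)) (x₂ := (-R)) (y₂ := 0) (x₃ := 0) (y₃ := 1)
      (by push_cast; ring) (by push_cast; ring) (by push_cast; ring)]
    exact ⟨⟨by ring, by linear_combination hrel⟩, by linarith⟩

lemma not_cornerTri_fst : ¬ CornerTri v w v := by
  have hrel := F.rel
  have hQ := F.Q_pos
  rintro ⟨x, y, z, hx, hy, hz, h⟩
  rw [F.triRel_iff (x₁ := x) (y₁ := 0) (x₂ := 0) (y₂ := y) (x₃ := z) (y₃ := 0)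
      (by push_cast; ring) (by push_cast; ring) (by push_cast; ring)] at h
  obtain ⟨⟨h1, h2⟩, h3⟩ := h
  have : Q * z = -y := by linear_combination Q * h1 - P * h2 + y * hrel
  nlinarith

lemma not_cornerTri_snd : ¬ CornerTri v w w := by
  have hrel := F.rel
  have hR := F.R_neg
  rintro ⟨x, y, z, hx, hy, hz, h⟩
  rw [F.triRel_iff (x₁ := x) (y₁ := 0) (x₂ := 0) (y₂ := y) (x₃ := 0) (y₃ := z)
      (by push_cast; ring) (by push_cast; ring) (by push_cast; ring)] at h
  obtain ⟨⟨h1, h2⟩, h3⟩ := h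
  have : R * z = x := by linear_combination R * h2 + P * h1 - x * hrel
  nlinarith

/-- The local contribution of the lowest vertex. -/
lemma base_corner_sum (hv : 0 < v.im) (hw : 0 < w.im)
    (h1 : ((k - dt v w) * v - normSq v * w : ℂ).im ≠ 0)
    (h2 : ((k - dt v w) * w - normSq w * v : ℂ).im ≠ 0) :
    ind (CornerSq v w) + (ind (CornerTri w v v) + ind (CornerTri w v w) +
      ind (CornerTri v w v) + ind (CornerTri v w w)) = ind (0 < dt v w) := by
  have hk := F.pos
  have e1 : 0 < dt v w ↔ P < 0 := by rw [F.dt_eq, mul_pos_iff_of_pos_right hk, neg_pos]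
  rw [F.im_snd, mul_pos_iff_of_pos_right hk] at hw
  rw [F.im_fst, mul_pos_iff_of_pos_right hk] at hv
  have hW : Q * b + (1 + P) * c ≠ 0 := by
    intro h
    apply h1
    rw [← ofReal_sub, sub_im, im_ofReal_mul, im_ofReal_mul, F.dt_eq, F.im_fst, F.im_snd, F.sq_fst]
    linear_combination -k ^ 2 * h
  have hU : R * c - (1 + P) * b ≠ 0 := by
    intro h
    apply h2
    rw [← ofReal_sub, sub_im, im_ofReal_mul, im_ofReal_mul, F.dt_eq, F.im_fst, F.im_snd, F.sq_snd]
    linear_combination -k ^ 2 * h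
  rw [ind_congr F.cornerSq_iff', ind_congr F.cornerTri_fst, ind_congr F.cornerTri_snd,
    ind_false F.not_cornerTri_fst, ind_false F.not_cornerTri_snd, e1, add_zero, add_zero]
  by_cases hP : P < 0
  swap
  · simp [hP, ind]
  simp only [hP, true_and]
  rcases hU.lt_or_gt with hU | hU <;> rcases hW.lt_or_gt with hW | hW
  · exact (F.not_obtuse hP rfl hw hv (by linarith) (by linarith)).elim
  · simp only [ind, hU, hW, hU.not_gt, hW.not_gt, and_true, and_false, if_true, if_false,
      zero_add, add_zero]
  · simp only [ind, hU, hW, hU.not_gt, hW.not_gt, and_true, and_false, if_true, if_false,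
      zero_add, add_zero]
  · simp only [ind, hU, hW, hU.not_gt, hW.not_gt, and_true, and_false, if_true, if_false,
      zero_add, add_zero]

end Frame

lemma corner_sum {v w : ℂ} (h : crs v w ≠ 0) :
    ind (CornerSq w v) + ind (CornerFst w v w (-1)) + ind (CornerFst w v v 1) +
      ind (CornerSnd w v w (-1)) + ind (CornerSnd w v v 1) =
        ind (0 < dt w v ∧ 0 < w.im ∧ 0 < v.im) := by
  rcases h.lt_or_gt with h | h
  · obtain ⟨P, Q, R, b, c, k, F⟩ := exists_frame (v := mirror v) (w := mirror w)
      (by rw [crs_mirror]; linarith)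
    have := F.corner_sum
    simp only [cornerSq_mirror, cornerFst_mirror, cornerSnd_mirror, dt_mirror, mirror_im] at this
    rw [← this]; ring
  · obtain ⟨P, Q, R, b, c, k, F⟩ := exists_frame h
    exact F.corner_sum

lemma not_cornerTri_self {v d : ℂ} (h : dt v d ≠ 0) : ¬ CornerTri v v d := by
  rintro ⟨x, y, z, hx, hy, hz, h1, h2⟩
  have h3 := congrArg (fun u : ℂ => v.re * u.re + v.im * u.im) h1
  simp only [sub_zero, re_ofReal_mul, im_ofReal_mul, I_mul_re, I_mul_im, sub_re, sub_im] at h3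
  have : z * dt v d = 0 := by simp only [dt]; linear_combination h3
  exact (mul_ne_zero hz.ne' h) this

lemma base_corner_sum {v w : ℂ} (h : crs v w ≠ 0) (hv : 0 < v.im) (hw : 0 < w.im)
    (h1 : ((|crs v w| - dt v w : ℝ) * v - normSq v * w : ℂ).im ≠ 0)
    (h2 : ((|crs v w| - dt v w : ℝ) * w - normSq w * v : ℂ).im ≠ 0) :
    ind (CornerSq v w) + (ind (CornerTri w v v) + ind (CornerTri w v w) +
      ind (CornerTri v w v) + ind (CornerTri v w w)) = ind (0 < dt v w) := by
  rcases h.lt_or_gt with h | h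
  · obtain ⟨P, Q, R, b, c, k, F⟩ := exists_frame (v := mirror v) (w := mirror w)
      (by rw [crs_mirror]; linarith)
    have hk : |crs v w| = k := by rw [← F.crs_eq, crs_mirror, abs_of_neg h]
    have n : ∀ z, normSq (mirror z) = normSq z := fun z => by simp [mirror]
    rw [hk] at h1 h2
    have := F.base_corner_sum (by rwa [mirror_im]) (by rwa [mirror_im])
      (by
        simp only [ofReal_sub, ← ofReal_sub, sub_im, im_ofReal_mul, mirror_im, n, dt_mirror] at h1 ⊢
        exact h1)
      (by
        simp only [ofReal_sub, ← ofReal_sub, sub_im, im_ofReal_mul, mirror_im, n, dt_mirror] at h2 ⊢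
        exact h2)
    simp only [cornerSq_mirror, cornerTri_mirror, dt_mirror] at this
    rw [← this]; ring
  · obtain ⟨P, Q, R, b, c, k, F⟩ := exists_frame h
    have hk : |crs v w| = k := by rw [← F.crs_eq, abs_of_pos h]
    rw [hk, ofReal_sub] at h1 h2
    exact F.base_corner_sum hv hw h1 h2

lemma ch_nonneg_of_box {i k : ℕ} (h : i ≤ k) {x y : ℝ} (hx : 0 ≤ x ∧ x ≤ 1) (hy : 0 ≤ y ∧ y ≤ 1)
    (hxy : i = k → x ≤ y) (q : Fin 4) : 0 ≤ ch (i < k) x y q := by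
  rcases h.lt_or_eq with h | h
  · fin_cases q <;> simp [ch, h] <;> linarith
  · have := hxy h
    subst h
    fin_cases q <;> simp [ch] <;> linarith

/-- The edge `i` starts (`e = 1`) or ends (`e = -1`) at `o`, and leaves `o` in the direction `d`. -/
def Ray (V : ℕ → ℂ) (o : ℂ) (i : ℕ) (d : ℂ) (e : ℝ) : Prop :=
  (e = 1 ∧ V i = o ∧ ed V i = d) ∨ (e = -1 ∧ V (i + 1) = o ∧ -ed V i = d)

namespace Ray

variable {V : ℕ → ℂ} {o a b c d : ℂ} {i k j l : ℕ} {e f g h : ℝ}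

lemma pt_eq (R : Ray V o i d e) (x : ℝ) : pt V i ((1 - e) / 2 + e * x) = o + x * d := by
  rcases R with ⟨rfl, rfl, rfl⟩ | ⟨rfl, rfl, rfl⟩
  · simp [pt]
  · simp only [pt, ed]; push_cast; ring

lemma mem (R : Ray V o i d e) {x : ℝ} (hx : 0 < x ∧ x < 1) :
    0 < (1 - e) / 2 + e * x ∧ (1 - e) / 2 + e * x < 1 := by
  rcases R with ⟨rfl, rfl, rfl⟩ | ⟨rfl, rfl, rfl⟩ <;> constructor <;> linarith

lemma mem_zero (R : Ray V o i d e) :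
    0 ≤ (1 - e) / 2 + e * 0 ∧ (1 - e) / 2 + e * 0 ≤ 1 := by
  rcases R with ⟨rfl, rfl, rfl⟩ | ⟨rfl, rfl, rfl⟩ <;> constructor <;> norm_num

lemma exists_param (R : Ray V o i d e) {x : ℝ} (hx : 0 < x ∧ x < 1) :
    ∃ u, 0 < u ∧ x = (1 - e) / 2 + e * u := by
  rcases R with ⟨rfl, rfl, rfl⟩ | ⟨rfl, rfl, rfl⟩
  · exact ⟨x, hx.1, by ring⟩
  · exact ⟨1 - x, by linarith, by ring⟩

lemma cellEnd_iff (A : Ray V o i a e) (B : Ray V o k b f) (C : Ray V o j c g) (D : Ray V o l d h)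
    (hik : i ≤ k) (hjl : j ≤ l) (hef : i = k → e = f) (hgh : j = l → g = h) :
    CellEnd V i k j l ↔ ∃ x y z w : ℝ, 0 < x ∧ 0 < y ∧ 0 < z ∧ 0 < w ∧ (i = k → 0 < e * (y - x)) ∧
      (j = l → 0 < g * (w - z)) ∧ SemiSq (x * a) (y * b) (z * c) (w * d) := by
  constructor
  · rintro ⟨⟨x, y, z, w, ⟨hx, hy, hxy⟩, ⟨hz, hw, hzw⟩, hs⟩, -⟩
    obtain ⟨x, hx', rfl⟩ := A.exists_param hx
    obtain ⟨y, hy', rfl⟩ := B.exists_param hy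
    obtain ⟨z, hz', rfl⟩ := C.exists_param hz
    obtain ⟨w, hw', rfl⟩ := D.exists_param hw
    refine ⟨x, y, z, w, hx', hy', hz', hw', fun h => ?_, fun h => ?_, ?_⟩
    · have := hxy h; rw [hef h] at this ⊢; linarith
    · have := hzw h; rw [hgh h] at this ⊢; linarith
    · rw [A.pt_eq, B.pt_eq, C.pt_eq, D.pt_eq] at hs
      obtain ⟨h1, h2, h3⟩ := hs
      simp only [add_re, sub_re, add_im, sub_im] at h2 h3
      refine ⟨by linear_combination h1, ?_, ?_⟩
      · simp only [add_re, sub_re, add_im, sub_im]; linarith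
      · simp only [add_re, sub_re, add_im, sub_im]; linarith
  · rintro ⟨x, y, z, w, hx, hy, hz, hw, hxy, hzw, hs⟩
    obtain ⟨s, hs0, hsx, hsy, hsz, hsw⟩ : ∃ s : ℝ, 0 < s ∧ s * x < 1 ∧ s * y < 1 ∧ s * z < 1 ∧
        s * w < 1 := by
      have : 0 < 1 + x + y + z + w := by positivity
      refine ⟨1 / (1 + x + y + z + w), by positivity, ?_, ?_, ?_, ?_⟩ <;>
        rw [one_div_mul_eq_div, div_lt_one this] <;> linarith
    refine ⟨⟨_, _, _, _, ⟨A.mem ⟨mul_pos hs0 hx, hsx⟩, B.mem ⟨mul_pos hs0 hy, hsy⟩, fun h => ?_⟩,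
      ⟨C.mem ⟨mul_pos hs0 hz, hsz⟩, D.mem ⟨mul_pos hs0 hw, hsw⟩, fun h => ?_⟩, ?_⟩,
      _, _, _, _, ch_nonneg_of_box hik A.mem_zero B.mem_zero fun h => by rw [hef h],
      ch_nonneg_of_box hjl C.mem_zero D.mem_zero fun h => by rw [hgh h], ?_, ?_, ?_, ?_⟩
    · have := mul_pos hs0 (hxy h); rw [hef h] at this ⊢; linarith
    · have := mul_pos hs0 (hzw h); rw [hgh h] at this ⊢; linarith
    · rw [A.pt_eq, B.pt_eq, C.pt_eq, D.pt_eq]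
      obtain ⟨h1, h2, h3⟩ := hs
      have e1 : o + (s * x : ℝ) * a + (o + (s * y : ℝ) * b) - (o + (s * z : ℝ) * c) -
          (o + (s * w : ℝ) * d) = s * (x * a + y * b - z * c - w * d) := by push_cast; ring
      refine ⟨?_, ?_, ?_⟩
      · push_cast; linear_combination s * h1
      · rw [e1, im_ofReal_mul, h2, mul_zero]
      · rw [e1, re_ofReal_mul]; exact mul_pos hs0 h3
    · rw [A.pt_eq, B.pt_eq]; simp
    · rw [C.pt_eq, D.pt_eq]; simp
    · rw [A.pt_eq, C.pt_eq]; simp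
    · rw [A.pt_eq, C.pt_eq]; simp

end Ray

/-- `f` is a positive combination of `u` and `v`. -/
def InCone (f u v : ℂ) : Prop := ∃ x y : ℝ, 0 < x ∧ 0 < y ∧ f = x * u + y * v

/-- The open edge `j` meets the horizontal line through `p` to the left of `p`. -/
def HasLeft (V : ℕ → ℂ) (p : ℂ) (j : ℕ) : Prop :=
  ∃ z : ℝ, (0 < z ∧ z < 1) ∧ (pt V j z).im = p.im ∧ (pt V j z).re < p.re

/-- The open edge `j` meets the horizontal line through `p` to the right of `p`. -/
def HasRight (V : ℕ → ℂ) (p : ℂ) (j : ℕ) : Prop :=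
  ∃ z : ℝ, (0 < z ∧ z < 1) ∧ (pt V j z).im = p.im ∧ p.re < (pt V j z).re

lemma eventually_small {c : ℝ} (K : ℝ) (hc : 0 < c) : ∀ᶠ t in 𝓝[>] (0 : ℝ), 0 < c + K * t := by
  have : ContinuousAt (fun t : ℝ => c + K * t) 0 := by fun_prop
  exact (this.eventually (lt_mem_nhds (by simpa using hc))).filter_mono nhdsWithin_le_nhds

/-- A small isosceles right configuration at a corner can be completed on a given edge. -/
lemma exists_small_square {p w v f q : ℂ} {α β : ℝ} (hα : 0 < α) (hβ : 0 < β)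
    (hf : f.im ≠ 0) (h : I * f = β * v - α * w) (hq : q.im = p.im) (hl : q.re < p.re) {z : ℝ}
    (hz : 0 < z ∧ z < 1) : ∃ x y u u' : ℝ, (0 < x ∧ x < 1) ∧ (0 < y ∧ y < 1) ∧
      (0 < z + u ∧ z + u < 1) ∧ (0 < z + u' ∧ z + u' < 1) ∧ u < u' ∧
      SemiSq (p + x * w) (p + y * v) (q + u * f) (q + u' * f) := by
  obtain ⟨m, hm⟩ : ∃ m : ℝ, m * f.im = α * w.im + β * v.im :=
    ⟨(α * w.im + β * v.im) / f.im, div_mul_cancel₀ _ hf⟩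
  have ev : ∀ᶠ t in 𝓝[>] (0 : ℝ), 0 < t ∧ 0 < 1 + (-α) * t ∧ 0 < 1 + (-β) * t ∧
      0 < z + (m - 1) / 2 * t ∧ 0 < (1 - z) + -((m - 1) / 2) * t ∧ 0 < z + (m + 1) / 2 * t ∧
      0 < (1 - z) + -((m + 1) / 2) * t ∧
      0 < 2 * (p.re - q.re) + (α * w.re + β * v.re - m * f.re) * t := by
    refine Filter.Eventually.and self_mem_nhdsWithin ?_
    refine (eventually_small _ one_pos).and ?_
    refine (eventually_small _ one_pos).and ?_
    refine (eventually_small _ hz.1).and ?_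
    refine (eventually_small _ (by linarith)).and ?_
    refine (eventually_small _ hz.1).and ?_
    exact (eventually_small _ (by linarith)).and (eventually_small _ (by linarith))
  obtain ⟨t, ht, h1, h2, h3, h4, h5, h6, h7⟩ := ev.exists
  refine ⟨α * t, β * t, (m - 1) / 2 * t, (m + 1) / 2 * t, ⟨by positivity, by linarith⟩,
    ⟨by positivity, by linarith⟩, ⟨h3, by linarith⟩, ⟨h5, by linarith⟩, by linarith, ?_, ?_, ?_⟩
  · push_cast; linear_combination -(t : ℂ) * h
  · simp only [add_im, sub_im, im_ofReal_mul, hq]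
    linear_combination -t * hm
  · simp only [add_re, sub_re, re_ofReal_mul]
    linarith

lemma exists_small_square' {p w v f q : ℂ} {α β : ℝ} (hα : 0 < α) (hβ : 0 < β)
    (hf : f.im ≠ 0) (h : I * f = α * w - β * v) (hq : q.im = p.im) (hl : p.re < q.re) {z : ℝ}
    (hz : 0 < z ∧ z < 1) : ∃ x y u u' : ℝ, (0 < x ∧ x < 1) ∧ (0 < y ∧ y < 1) ∧
      (0 < z + u ∧ z + u < 1) ∧ (0 < z + u' ∧ z + u' < 1) ∧ u < u' ∧
      SemiSq (q + u * f) (q + u' * f) (p + x * w) (p + y * v) := by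
  have madd : ∀ a b, mirror (a + b) = mirror a + mirror b := fun a b => by
    simp only [mirror, map_add]; ring
  have hm : I * mirror f = β * mirror v - α * mirror w := by
    have : I * mirror f = -mirror (I * f) := by simp [mirror]
    rw [this, h, ← mirror_real_mul, ← mirror_real_mul]
    simp [mirror]; ring
  obtain ⟨x, y, u, u', h1, h2, h3, h4, h5, h6⟩ := exists_small_square hα hβ
    (by rwa [mirror_im]) hm (q := mirror q) (p := mirror p) (by rw [mirror_im, mirror_im, hq])
    (by simpa [mirror] using hl) hz
  refine ⟨x, y, u, u', h1, h2, h3, h4, h5, ?_⟩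
  simpa only [← mirror_real_mul, ← madd, semiSq_mirror] using h6

namespace Core

variable {V : ℕ → ℂ} {n : ℕ} (H : Core V n)

include H

lemma ed_n : ed V n = ed V 0 := by
  have h1 := H.per 0
  have h2 := H.per 1
  rw [zero_add] at h1
  rw [ed, ed, h1, add_comm n 1, h2]

/-- The cyclic order of the edges. -/
lemma succ_cases {c : ℕ} (hc : c < n) :
    (c + 1 < n) ∨ (c + 1 = n ∧ ed V (c + 1) = ed V 0 ∧ V (c + 1) = V 0) := by
  rcases (show c + 1 ≤ n from hc).lt_or_eq with h | h
  · exact Or.inl h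
  · exact Or.inr ⟨h, by rw [h, H.ed_n], by rw [h, H.V_n]⟩

lemma crs_succ {c : ℕ} (hc : c < n) : crs (ed V c) (ed V (c + 1)) ≠ 0 := by
  have := H.three
  rcases H.succ_cases hc with h | ⟨h, h', -⟩
  · exact H.crs_ne c hc _ h (by omega)
  · rw [h']; exact H.crs_ne c hc 0 (by omega) (by omega)

lemma ed_im {j : ℕ} (hj : j < n) : (ed V j).im ≠ 0 := by
  have := H.three
  rw [ed, sub_im, sub_ne_zero]
  rcases H.succ_cases hj with h | ⟨h, -, h'⟩
  · exact H.im_ne _ h _ hj (by omega)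
  · rw [h']; exact H.im_ne _ (by omega) _ hj (by omega)

/-- A vertex has height different from those of the vertices of a nonadjacent edge. -/
lemma im_ne_vertex {c j : ℕ} (hc : c + 1 < n) (hj : j < n) (h1 : j ≠ c) (h2 : j ≠ c + 1) :
    (V j).im ≠ (V (c + 1)).im ∧ (V (j + 1)).im ≠ (V (c + 1)).im := by
  refine ⟨H.im_ne _ hj _ hc h2, ?_⟩
  rcases H.succ_cases hj with h | ⟨h, -, h'⟩
  · exact H.im_ne _ h _ hc (by omega)
  · rw [h']; exact H.im_ne _ (by omega) _ hc (by omega)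

lemma degenerate_pair {i k : ℕ} (hik : i ≤ k) (hk : k < n) {x y : ℝ}
    (hc : ∀ q, 0 ≤ ch (i < k) x y q) (h : pt V i x = pt V k y) :
    (k = i ∧ y = x) ∨ (k = i + 1 ∧ pt V i x = V (i + 1)) ∨
      (i = 0 ∧ k + 1 = n ∧ pt V i x = V 0) := by
  obtain ⟨hx, hy, -⟩ := ch_nonneg_box hik hc
  rcases hik.lt_or_eq with hlt | rfl
  · rcases H.simple i k hlt hk x y hx.1 hx.2 hy.1 hy.2 h with ⟨h1, h2, h3⟩ | ⟨h1, h2, h3, h4⟩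
    · right; left; exact ⟨h1, by rw [h2, pt_one]⟩
    · right; right; exact ⟨h1, h2, by rw [h1, h3, pt_zero]⟩
  · exact Or.inl ⟨rfl, (H.pt_inj hk h).symm⟩

lemma not_cellEnd_diag {i j : ℕ} (hi : i < n) (hj : j < n) : ¬ CellEnd V i i j j := by
  rintro ⟨⟨x, y, z, w, ⟨-, -, hxy⟩, -, h, -⟩, -⟩
  have h1 : ((y - x : ℝ) : ℂ) * ed V i = I * ((w - z : ℝ) * ed V j) := by
    simp only [pt] at h; push_cast; linear_combination h
  have h2 := congrArg (fun u : ℂ => (ed V j).re * u.re + (ed V j).im * u.im) h1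
  simp only [re_ofReal_mul, im_ofReal_mul, I_mul_re, I_mul_im] at h2
  have : (y - x) * dt (ed V i) (ed V j) = 0 := by simp only [dt]; linear_combination h2
  exact (mul_ne_zero (sub_pos.2 (hxy rfl)).ne' (H.dt_ne i hi j hj)) this

lemma not_cellEnd_corners {c d : ℕ} (hcd : c ≠ d) (hc : c + 1 < n) (hd : d + 1 < n) :
    ¬ CellEnd V c (c + 1) d (d + 1) := by
  rintro ⟨-, x, y, z, w, h1, h2, h3, h4, h5, -⟩
  have e1 : pt V c x = V (c + 1) := by
    rcases H.degenerate_pair (by omega) hc h1 h3 with h | h | ⟨rfl, h, -⟩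
    · omega
    · exact h.2
    · have := H.three; omega
  have e2 : pt V d z = V (d + 1) := by
    rcases H.degenerate_pair (by omega) hd h2 h4 with h | h | ⟨rfl, h, -⟩
    · omega
    · exact h.2
    · have := H.three; omega
  rw [e1, e2] at h5
  exact H.im_ne _ hc _ hd (by omega) h5

lemma pt_eq_bot {x y : ℝ} (h1 : ∀ q, 0 ≤ ch (0 < n - 1) x y q) (h3 : pt V 0 x = pt V (n - 1) y) :
    pt V 0 x = V 0 := by
  have := H.three
  rcases H.degenerate_pair (by omega) (by omega) h1 h3 with h | ⟨h, -⟩ | ⟨-, -, h⟩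
  · omega
  · omega
  · exact h

lemma not_cellEnd_corner_bot {c : ℕ} (hc : c + 1 < n) :
    ¬ CellEnd V c (c + 1) 0 (n - 1) ∧ ¬ CellEnd V 0 (n - 1) c (c + 1) := by
  have := H.three
  have e : ∀ x y, (∀ q, 0 ≤ ch (c < c + 1) x y q) → pt V c x = pt V (c + 1) y →
      pt V c x = V (c + 1) := by
    intro x y h1 h3
    rcases H.degenerate_pair (by omega) hc h1 h3 with h | h | ⟨rfl, h, -⟩
    · omega
    · exact h.2
    · omega
  have := H.im_ne _ hc 0 (by omega) (by omega)
  constructor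
  · rintro ⟨-, x, y, z, w, h1, h2, h3, h4, h5, -⟩
    rw [e x y h1 h3, H.pt_eq_bot h2 h4] at h5
    exact this h5
  · rintro ⟨-, x, y, z, w, h1, h2, h3, h4, h5, -⟩
    rw [e z w h2 h4, H.pt_eq_bot h1 h3] at h5
    exact this h5.symm

end Core

lemma pairSum_chords {n : ℕ} (hn : 3 ≤ n) (f : ℕ → ℕ → ZMod 2)
    (hf : ∀ i k, i < k → k < n → k ≠ i + 1 → ¬ (i = 0 ∧ k + 1 = n) → f i k = 0) :
    pairSum n f = ∑ j ∈ Finset.range n, f j j +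
      ∑ c ∈ Finset.range n, if c + 1 < n then f c (c + 1) else f 0 (n - 1) := by
  obtain ⟨m, rfl⟩ : ∃ m, n = m + 3 := ⟨n - 3, by omega⟩
  have e1 : pairSum (m + 3) f = ∑ j ∈ Finset.range (m + 3), f j j +
      ∑ k ∈ Finset.range (m + 3), ∑ i ∈ Finset.range k, f i k := by
    rw [pairSum, ← Finset.sum_add_distrib]
    refine Finset.sum_congr rfl fun k _ => ?_
    rw [Finset.sum_range_succ, add_comm]
  rw [e1, Finset.sum_range_succ' (fun k => ∑ i ∈ Finset.range k, f i k), Finset.range_zero,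
    Finset.sum_empty, add_zero, Finset.sum_range_succ (fun c => if c + 1 < m + 3 then _ else _),
    if_neg (by omega), add_right_inj]
  have e2 : ∀ k ∈ Finset.range (m + 2), ∑ i ∈ Finset.range (k + 1), f i (k + 1) =
      (if k + 1 < m + 3 then f k (k + 1) else f 0 (m + 3 - 1)) +
        ∑ i ∈ Finset.range k, f i (k + 1) := by
    intro k hk
    rw [Finset.mem_range] at hk
    rw [Finset.sum_range_succ, add_comm, if_pos (by omega)]
  rw [Finset.sum_congr rfl e2, Finset.sum_add_distrib, add_right_inj, Finset.sum_range_succ,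
    Finset.sum_eq_zero, zero_add, Finset.sum_eq_single 0]
  · rfl
  · intro i hi h0
    rw [Finset.mem_range] at hi
    exact hf _ _ (by omega) (by omega) (by omega) (by omega)
  · simp
  · intro k hk
    rw [Finset.mem_range] at hk
    refine Finset.sum_eq_zero fun i hi => ?_
    rw [Finset.mem_range] at hi
    exact hf _ _ (by omega) (by omega) (by omega) (by omega)

namespace Core

variable {V : ℕ → ℂ} {n : ℕ} (H : Core V n)

include H

lemma ne_vertex {j m : ℕ} (hj : j < n) (hm : m < n) {z : ℝ} (hz : 0 < z ∧ z < 1) :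
    pt V j z ≠ V m := by
  intro h
  rw [← pt_zero V m] at h
  rcases lt_trichotomy j m with h' | rfl | h'
  · rcases H.simple j m h' hm z 0 hz.1.le hz.2.le le_rfl zero_le_one h with ⟨-, h, -⟩ | ⟨-, -, h, -⟩
    · exact hz.2.ne h
    · exact hz.1.ne' h
  · exact hz.1.ne' (H.pt_inj hj h)
  · rcases H.simple m j h' hj 0 z le_rfl zero_le_one hz.1.le hz.2.le h.symm with
      ⟨-, h, -⟩ | ⟨-, -, -, h⟩
    · norm_num at h
    · exact hz.2.ne h

lemma pt_prev (c : ℕ) (x : ℝ) : pt V c x = V (c + 1) - (1 - x : ℝ) * ed V c := by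
  simp only [pt, ed]; push_cast; ring

lemma level_interior {c j : ℕ} (hc : c + 1 < n) (hj : j < n) (h1 : j ≠ c) (h2 : j ≠ c + 1) {z : ℝ}
    (h0 : 0 ≤ z ∧ z ≤ 1) (h : (pt V j z).im = (V (c + 1)).im) :
    (0 < z ∧ z < 1) ∧ (pt V j z).re ≠ (V (c + 1)).re := by
  obtain ⟨h3, h4⟩ := H.im_ne_vertex hc hj h1 h2
  have hz : 0 < z ∧ z < 1 := by
    refine ⟨h0.1.lt_of_ne' fun e => h3 ?_, h0.2.lt_of_ne fun e => h4 ?_⟩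
    · rw [← h, e, pt_zero]
    · rw [← h, e, pt_one]
  exact ⟨hz, fun e => H.ne_vertex hj hc hz (Complex.ext e h)⟩

lemma cellEnd_corner_diag {c j : ℕ} (hc : c + 1 < n) (hj : j < n) (h1 : j ≠ c) (h2 : j ≠ c + 1) :
    CellEnd V c (c + 1) j j ↔
      InCone (I * ed V j) (ed V c) (ed V (c + 1)) ∧ HasLeft V (V (c + 1)) j := by
  constructor
  · rintro ⟨⟨x, y, z, w, ⟨hx, hy, -⟩, ⟨hz, hw, hzw⟩, hs, -⟩, x', y', z', w', a1, a2, a3, a4, a5, a6⟩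
    refine ⟨?_, ?_⟩
    · have hzw := sub_pos.2 (hzw rfl)
      refine ⟨(1 - x) / (w - z), y / (w - z), div_pos (by linarith) hzw, div_pos hy.1 hzw, ?_⟩
      have : ((w - z : ℝ) : ℂ) ≠ 0 := ofReal_ne_zero.2 hzw.ne'
      rw [H.pt_prev c, pt, pt, pt] at hs
      push_cast at this hs ⊢
      field_simp
      linear_combination -hs
    · have e : pt V c x' = V (c + 1) := by
        rcases H.degenerate_pair (by omega) hc a1 a3 with h | h | ⟨rfl, h, -⟩
        · omega
        · exact h.2
        · have := H.three; omega
      rw [e] at a5 a6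
      obtain ⟨b1, b2⟩ := H.level_interior hc hj h1 h2 (ch_nonneg_box le_rfl a2).1 a5.symm
      exact ⟨z', b1, a5.symm, lt_of_le_of_ne a6 b2⟩
  · rintro ⟨⟨α, β, hα, hβ, hf⟩, z, hz, hi, hr⟩
    refine ⟨?_, 1, 0, z, z, ?_, ?_, ?_, rfl, ?_, ?_⟩
    · obtain ⟨x, y, u, u', hx, hy, hu, hu', huu, hs⟩ := exists_small_square (p := V (c + 1))
        (w := -ed V c) (v := ed V (c + 1)) (f := ed V j) (q := pt V j z) hα hβ (H.ed_im hj)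
        (by rw [hf]; ring) hi hr hz
      refine ⟨1 - x, y, z + u, z + u', ⟨⟨by linarith, by linarith⟩, hy, by omega⟩,
        ⟨hu, hu', fun _ => by linarith⟩, ?_⟩
      have e1 : pt V c (1 - x) = V (c + 1) + x * -ed V c := by rw [H.pt_prev]; push_cast; ring
      have e2 : ∀ t, pt V j (z + t) = pt V j z + t * ed V j := by
        intro t; simp only [pt]; push_cast; ring
      rw [e1, e2, e2]
      exact hs
    · exact ch_nonneg_of_box (by omega) (by norm_num) (by norm_num) (by omega)
    · exact ch_nonneg_of_box le_rfl ⟨hz.1.le, hz.2.le⟩ ⟨hz.1.le, hz.2.le⟩ fun _ => le_rfl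
    · rw [pt_one, pt_zero]
    · rw [pt_one, hi]
    · rw [pt_one]; exact hr.le

lemma cellEnd_diag_corner {c j : ℕ} (hc : c + 1 < n) (hj : j < n) (h1 : j ≠ c) (h2 : j ≠ c + 1) :
    CellEnd V j j c (c + 1) ↔
      InCone (-(I * ed V j)) (ed V c) (ed V (c + 1)) ∧ HasRight V (V (c + 1)) j := by
  constructor
  · rintro ⟨⟨z, w, x, y, ⟨hz, hw, hzw⟩, ⟨hx, hy, -⟩, hs, -⟩, z', w', x', y', a2, a1, a4, a3, a5, a6⟩
    refine ⟨?_, ?_⟩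
    · have hzw := sub_pos.2 (hzw rfl)
      refine ⟨(1 - x) / (w - z), y / (w - z), div_pos (by linarith) hzw, div_pos hy.1 hzw, ?_⟩
      have : ((w - z : ℝ) : ℂ) ≠ 0 := ofReal_ne_zero.2 hzw.ne'
      rw [H.pt_prev c, pt, pt, pt] at hs
      push_cast at this hs ⊢
      field_simp
      linear_combination -I * hs - (y * ed V (c + 1) + (1 - x) * ed V c) * I_sq
    · have e : pt V c x' = V (c + 1) := by
        rcases H.degenerate_pair (by omega) hc a1 a3 with h | h | ⟨rfl, h, -⟩
        · omega
        · exact h.2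
        · have := H.three; omega
      rw [e] at a5 a6
      obtain ⟨b1, b2⟩ := H.level_interior hc hj h1 h2 (ch_nonneg_box le_rfl a2).1 a5
      exact ⟨z', b1, a5, lt_of_le_of_ne' a6 b2⟩
  · rintro ⟨⟨α, β, hα, hβ, hf⟩, z, hz, hi, hr⟩
    refine ⟨?_, z, z, 1, 0, ?_, ?_, rfl, ?_, ?_, ?_⟩
    · obtain ⟨x, y, u, u', hx, hy, hu, hu', huu, hs⟩ := exists_small_square' (p := V (c + 1))
        (w := -ed V c) (v := ed V (c + 1)) (f := ed V j) (q := pt V j z) hα hβ (H.ed_im hj)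
        (by linear_combination -hf) hi hr hz
      refine ⟨z + u, z + u', 1 - x, y, ⟨hu, hu', fun _ => by linarith⟩,
        ⟨⟨by linarith, by linarith⟩, hy, by omega⟩, ?_⟩
      have e1 : pt V c (1 - x) = V (c + 1) + x * -ed V c := by rw [H.pt_prev]; push_cast; ring
      have e2 : ∀ t, pt V j (z + t) = pt V j z + t * ed V j := by
        intro t; simp only [pt]; push_cast; ring
      rw [e1, e2, e2]
      exact hs
    · exact ch_nonneg_of_box le_rfl ⟨hz.1.le, hz.2.le⟩ ⟨hz.1.le, hz.2.le⟩ fun _ => le_rfl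
    · exact ch_nonneg_of_box (by omega) (by norm_num) (by norm_num) (by omega)
    · rw [pt_one, pt_zero]
    · rw [pt_one, hi]
    · rw [pt_one]; exact hr.le

lemma ray_prev (c : ℕ) : Ray V (V (c + 1)) c (-ed V c) (-1) := Or.inr ⟨rfl, rfl, rfl⟩

lemma ray_next (c : ℕ) : Ray V (V c) c (ed V c) 1 := Or.inl ⟨rfl, rfl, rfl⟩

lemma ray_bot : Ray V (V 0) (n - 1) (-ed V (n - 1)) (-1) := by
  have := H.n_pos
  exact Or.inr ⟨rfl, by rw [Nat.sub_add_cancel this, H.V_n], rfl⟩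

/-- The end of a chord cell at a corner, for the chords on the two adjacent edges. -/
lemma cellEnd_adjacent {c : ℕ} :
    (CellEnd V c (c + 1) c (c + 1) ↔ CornerSq (-ed V c) (ed V (c + 1))) ∧
    (CellEnd V c (c + 1) c c ↔ CornerFst (-ed V c) (ed V (c + 1)) (-ed V c) (-1)) ∧
    (CellEnd V c (c + 1) (c + 1) (c + 1) ↔
      CornerFst (-ed V c) (ed V (c + 1)) (ed V (c + 1)) 1) ∧
    (CellEnd V c c c (c + 1) ↔ CornerSnd (-ed V c) (ed V (c + 1)) (-ed V c) (-1)) ∧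
    (CellEnd V (c + 1) (c + 1) c (c + 1) ↔
      CornerSnd (-ed V c) (ed V (c + 1)) (ed V (c + 1)) 1) := by
  have A := H.ray_prev c
  have B := H.ray_next (c + 1)
  refine ⟨?_, ?_, ?_, ?_, ?_⟩
  · rw [A.cellEnd_iff B A B (by omega) (by omega) (by omega) (by omega), CornerSq]
    simp
  · rw [A.cellEnd_iff B A A (by omega) (by omega) (by omega) (by simp), CornerFst]
    simp
  · rw [A.cellEnd_iff B B B (by omega) (by omega) (by omega) (by simp), CornerFst]
    simp
  · rw [A.cellEnd_iff A A B (by omega) (by omega) (by simp) (by omega), CornerSnd]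
    simp only [forall_const, Nat.succ_ne_self, right_eq_add, one_ne_zero, IsEmpty.forall_iff, true_and]
    constructor
    · rintro ⟨x, y, z, w, h1, h2, h3, h4, h5, -, h6⟩
      exact ⟨z, w, x, y, h3, h4, h1, h2, h5, h6⟩
    · rintro ⟨x, y, z, w, h1, h2, h3, h4, h5, h6⟩
      exact ⟨z, w, x, y, h3, h4, h1, h2, h5, by omega, h6⟩
  · rw [B.cellEnd_iff B A B (by omega) (by omega) (by simp) (by omega), CornerSnd]
    simp only [forall_const, Nat.succ_ne_self, right_eq_add, one_ne_zero, IsEmpty.forall_iff, true_and]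
    constructor
    · rintro ⟨x, y, z, w, h1, h2, h3, h4, h5, -, h6⟩
      exact ⟨z, w, x, y, h3, h4, h1, h2, h5, h6⟩
    · rintro ⟨x, y, z, w, h1, h2, h3, h4, h5, h6⟩
      exact ⟨z, w, x, y, h3, h4, h1, h2, h5, by omega, h6⟩

end Core

lemma sum_range_ends {n : ℕ} (hn : 3 ≤ n) {F : ℕ → ZMod 2}
    (h : ∀ j < n, j ≠ 0 → j ≠ n - 1 → F j = 0) :
    ∑ j ∈ Finset.range n, F j = F 0 + F (n - 1) := by
  obtain ⟨m, rfl⟩ : ∃ m, n = m + 2 := ⟨n - 2, by omega⟩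
  rw [Finset.sum_range_succ, Finset.sum_range_succ', Finset.sum_eq_zero, zero_add]
  · rfl
  · intro j hj
    rw [Finset.mem_range] at hj
    exact h _ (by omega) (by omega) (by omega)

namespace Core

variable {V : ℕ → ℂ} {n : ℕ} (H : Core V n)

include H

lemma edge_bot {j : ℕ} (hj : j < n) {x : ℝ} (hx : 0 ≤ x ∧ x ≤ 1) (h : (pt V j x).im ≤ (V 0).im) :
    (j = 0 ∨ j = n - 1) ∧ pt V j x = V 0 := by
  have hn := H.three
  obtain ⟨hx' | hx', h'⟩ := H.isEnd_of_im_le hj hx.1 hx.2 h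
  · rw [hx', pt_zero] at h'
    refine ⟨Or.inl ?_, by rw [hx', pt_zero, h']⟩
    by_contra hne
    exact H.im_ne j hj 0 (by omega) hne (by rw [h'])
  · rw [hx', pt_one] at h'
    refine ⟨Or.inr ?_, by rw [hx', pt_one, h']⟩
    rcases H.succ_cases hj with h1 | ⟨h1, -⟩
    · exact absurd (by rw [h']) (H.im_ne _ h1 0 (by omega) (by omega))
    · omega

lemma not_hasLeft_bot {j : ℕ} (hj : j < n) : ¬ HasLeft V (V 0) j ∧ ¬ HasRight V (V 0) j := by
  constructor <;>
  · rintro ⟨z, hz, h, -⟩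
    exact H.pt_ne_bot hj hz (H.edge_bot hj ⟨hz.1.le, hz.2.le⟩ h.le).2

lemma pt_ne_vertex_self {c j : ℕ} (hc : c + 1 < n) (hj : j = c ∨ j = c + 1) {z : ℝ}
    (hz : 0 < z ∧ z < 1) : (pt V j z).im ≠ (V (c + 1)).im := by
  intro h
  rcases hj with rfl | rfl
  · have e : pt V j z = V (j + 1) - (1 - z : ℝ) * ed V j := H.pt_prev j z
    rw [e, sub_im, im_ofReal_mul] at h
    exact (mul_ne_zero (sub_ne_zero.2 hz.2.ne') (H.ed_im (by omega : j < n))) (by linarith)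
  · simp only [pt, add_im, im_ofReal_mul] at h
    exact (mul_ne_zero hz.1.ne' (H.ed_im hc)) (by linarith)

lemma ed_zero_im : 0 < (ed V 0).im := by
  have := H.three
  have := H.bot 1 one_pos (by omega)
  simp only [ed, sub_im, zero_add]; linarith

lemma ed_last_im : 0 < (-ed V (n - 1)).im := by
  have := H.three
  have h := H.bot (n - 1) (by omega) (by omega)
  simp only [ed, neg_im, sub_im]
  rw [show n - 1 + 1 = n by omega, H.V_n]; linarith

lemma crs_bot : crs (ed V 0) (-ed V (n - 1)) ≠ 0 := by
  have := H.three
  have h := H.crs_ne 0 (by omega) (n - 1) (by omega) (by omega)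
  intro h'
  apply h
  simp only [crs, neg_re, neg_im] at h' ⊢
  linarith

lemma baseEnd_forces {j l m : ℕ} (hj : j < n) (hl : l < n) (hm : m < n) (h : BaseEnd V j l m) :
    (j = 0 ∨ j = n - 1) ∧ (l = 0 ∨ l = n - 1) ∧ (m = 0 ∨ m = n - 1) := by
  obtain ⟨-, x, hx, hb, hi, h0⟩ := h
  have e : pt V j (x 0) = pt V l (x 1) := by
    have h1 : pt V m (x 2) - V 0 = I * (pt V l (x 1) - pt V j (x 0)) := hx
    rw [h0, sub_self, zero_eq_mul, sub_eq_zero] at h1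
    exact (h1.resolve_left I_ne_zero).symm
  have h2 : (pt V j (x 0)).im ≤ (V 0).im := by
    rw [h0, ← e] at hi
    simp only [add_im, sub_im] at hi
    linarith
  exact ⟨(H.edge_bot hj (hb 0) h2).1, (H.edge_bot hl (hb 1) (e ▸ h2)).1,
    (H.edge_bot hm (hb 2) (by rw [h0])).1⟩

lemma baseEnd_iff {j l m : ℕ} {d₁ d₂ d₃ : ℂ} {e f g : ℝ} (A : Ray V (V 0) j d₁ e)
    (B : Ray V (V 0) l d₂ f) (C : Ray V (V 0) m d₃ g) : BaseEnd V j l m ↔ CornerTri d₁ d₂ d₃ := by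
  constructor
  · rintro ⟨⟨x, hx, hb, hi⟩, -⟩
    obtain ⟨u, hu, e1⟩ := A.exists_param (hb 0)
    obtain ⟨v, hv, e2⟩ := B.exists_param (hb 1)
    obtain ⟨w, hw, e3⟩ := C.exists_param (hb 2)
    have h1 : pt V m (x 2) - V 0 = I * (pt V l (x 1) - pt V j (x 0)) := hx
    rw [e1, e2, e3, A.pt_eq, B.pt_eq, C.pt_eq] at h1
    rw [e1, e2, e3, A.pt_eq, B.pt_eq, C.pt_eq] at hi
    refine ⟨u, v, w, hu, hv, hw, by linear_combination h1, ?_⟩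
    simp only [add_im, sub_im, zero_im] at hi ⊢
    linarith
  · rintro ⟨x, y, z, hx, hy, hz, h1, h2⟩
    obtain ⟨s, hs0, hsx, hsy, hsz⟩ : ∃ s : ℝ, 0 < s ∧ s * x < 1 ∧ s * y < 1 ∧ s * z < 1 := by
      have : 0 < 1 + x + y + z := by positivity
      refine ⟨1 / (1 + x + y + z), by positivity, ?_, ?_, ?_⟩ <;>
        rw [one_div_mul_eq_div, div_lt_one this] <;> linarith
    refine ⟨⟨![(1 - e) / 2 + e * (s * x), (1 - f) / 2 + f * (s * y), (1 - g) / 2 + g * (s * z)],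
      ?_, ?_, ?_⟩, ![(1 - e) / 2 + e * 0, (1 - f) / 2 + f * 0, (1 - g) / 2 + g * 0], ?_, ?_, ?_, ?_⟩
    · change pt V m ((1 - g) / 2 + g * (s * z)) - V 0 = I * (pt V l ((1 - f) / 2 + f * (s * y)) -
        pt V j ((1 - e) / 2 + e * (s * x)))
      rw [A.pt_eq, B.pt_eq, C.pt_eq]
      push_cast
      linear_combination (s : ℂ) * h1
    · have a := A.mem ⟨mul_pos hs0 hx, hsx⟩
      have b := B.mem ⟨mul_pos hs0 hy, hsy⟩
      have c := C.mem ⟨mul_pos hs0 hz, hsz⟩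
      intro r
      fin_cases r
      · exact a
      · exact b
      · exact c
    · change 0 < (V 0 + pt V m ((1 - g) / 2 + g * (s * z)) - pt V j ((1 - e) / 2 + e * (s * x)) -
        pt V l ((1 - f) / 2 + f * (s * y))).im
      rw [A.pt_eq, B.pt_eq, C.pt_eq]
      have e1 : V 0 + (V 0 + (s * z : ℝ) * d₃) - (V 0 + (s * x : ℝ) * d₁) -
          (V 0 + (s * y : ℝ) * d₂) = s * (0 + z * d₃ - x * d₁ - y * d₂) := by push_cast; ring
      rw [e1, im_ofReal_mul]
      exact mul_pos hs0 h2
    · change pt V m ((1 - g) / 2 + g * 0) - V 0 = I * (pt V l ((1 - f) / 2 + f * 0) -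
        pt V j ((1 - e) / 2 + e * 0))
      rw [A.pt_eq, B.pt_eq, C.pt_eq]
      simp
    · intro r
      fin_cases r
      · exact A.mem_zero
      · exact B.mem_zero
      · exact C.mem_zero
    · change 0 ≤ (V 0 + pt V m ((1 - g) / 2 + g * 0) - pt V j ((1 - e) / 2 + e * 0) -
        pt V l ((1 - f) / 2 + f * 0)).im
      rw [A.pt_eq, B.pt_eq, C.pt_eq]
      simp
    · change pt V m ((1 - g) / 2 + g * 0) = V 0
      rw [C.pt_eq]
      simp

lemma baseEnd_sum : tripleSum n (fun j l m => ind (BaseEnd V j l m)) =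
    ind (CornerTri (-ed V (n - 1)) (ed V 0) (ed V 0)) +
      ind (CornerTri (-ed V (n - 1)) (ed V 0) (-ed V (n - 1))) +
      ind (CornerTri (ed V 0) (-ed V (n - 1)) (ed V 0)) +
      ind (CornerTri (ed V 0) (-ed V (n - 1)) (-ed V (n - 1))) := by
  have hn := H.three
  have key : ∀ j l m, j < n → l < n → m < n →
      ¬ ((j = 0 ∨ j = n - 1) ∧ (l = 0 ∨ l = n - 1) ∧ (m = 0 ∨ m = n - 1)) →
      ind (BaseEnd V j l m) = 0 :=
    fun j l m hj hl hm h => ind_false fun h' => h (H.baseEnd_forces hj hl hm h')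
  have A := H.ray_next 0
  have B := H.ray_bot
  rw [tripleSum, sum_range_ends hn fun j hj h1 h2 => Finset.sum_eq_zero fun l hl =>
    Finset.sum_eq_zero fun m hm => key _ _ _ hj (by simpa using hl) (by simpa using hm) (by tauto)]
  rw [sum_range_ends hn fun l hl h1 h2 => Finset.sum_eq_zero fun m hm =>
    key _ _ _ (by omega) hl (by simpa using hm) (by tauto),
    sum_range_ends hn fun l hl h1 h2 => Finset.sum_eq_zero fun m hm =>
    key _ _ _ (by omega) hl (by simpa using hm) (by tauto)]
  rw [sum_range_ends hn fun l hl h1 h2 => key 0 0 _ (by omega) (by omega) hl (by tauto),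
    sum_range_ends hn fun l hl h1 h2 => key 0 (n - 1) _ (by omega) (by omega) hl (by tauto),
    sum_range_ends hn fun l hl h1 h2 => key (n - 1) 0 _ (by omega) (by omega) hl (by tauto),
    sum_range_ends hn fun l hl h1 h2 => key (n - 1) (n - 1) _ (by omega) (by omega) hl (by tauto)]
  have z : ∀ j < n, ∀ k < n, dt (ed V j) (ed V k) ≠ 0 := H.dt_ne
  have hd1 : dt (ed V 0) (ed V 0) ≠ 0 := z _ (by omega) _ (by omega)
  have hd2 : dt (ed V 0) (-ed V (n - 1)) ≠ 0 := by
    have := z 0 (by omega) (n - 1) (by omega)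
    intro h; apply this; simp only [dt, neg_re, neg_im] at h ⊢; linarith
  have hd3 : dt (-ed V (n - 1)) (ed V 0) ≠ 0 := by
    intro h; apply hd2; simp only [dt, neg_re, neg_im] at h ⊢; linarith
  have hd4 : dt (-ed V (n - 1)) (-ed V (n - 1)) ≠ 0 := by
    have := z (n - 1) (by omega) (n - 1) (by omega)
    intro h; apply this; simp only [dt, neg_re, neg_im] at h ⊢; linarith
  rw [ind_congr (H.baseEnd_iff A A A), ind_congr (H.baseEnd_iff A A B),
    ind_congr (H.baseEnd_iff A B A), ind_congr (H.baseEnd_iff A B B),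
    ind_congr (H.baseEnd_iff B A A), ind_congr (H.baseEnd_iff B A B),
    ind_congr (H.baseEnd_iff B B A), ind_congr (H.baseEnd_iff B B B),
    ind_false (not_cornerTri_self hd1), ind_false (not_cornerTri_self hd2),
    ind_false (not_cornerTri_self hd3), ind_false (not_cornerTri_self hd4)]
  ring

lemma cellEnd_bot : CellEnd V 0 (n - 1) 0 (n - 1) ↔ CornerSq (ed V 0) (-ed V (n - 1)) := by
  have := H.three
  rw [(H.ray_next 0).cellEnd_iff H.ray_bot (H.ray_next 0) H.ray_bot (by omega) (by omega)
    (by omega) (by omega), CornerSq]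
  simp only [show ¬ (0 = n - 1) by omega, IsEmpty.forall_iff, true_and]

end Core

section Bottom

variable {v w : ℂ}

lemma crs_of_real_pos {D : ℂ} (hv : 0 < v.im) (h : D.im = 0) (h' : 0 < D.re) : crs v D < 0 := by
  simp only [crs, h, mul_zero, zero_sub, neg_lt_zero]
  exact mul_pos hv h'

lemma crs_I_mul_self (hv : 0 < v.im) {δ : ℝ} (hδ : 0 < δ) : 0 < crs v (I * (δ * v)) := by
  have : crs v (I * (δ * v)) = δ * (v.re * v.re + v.im * v.im) := by simp [crs]; ring
  rw [this]
  exact mul_pos hδ (by nlinarith [mul_pos hv hv, mul_self_nonneg v.re])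

lemma not_cornerFst_bot (hv : 0 < v.im) (hw : 0 < w.im) :
    ¬ CornerFst v w v 1 ∧ ¬ CornerFst v w w (-1) := by
  constructor
  · rintro ⟨x, y, s, s', hx, hy, hs, hs', hss, h1, h2, h3⟩
    have a := crs_of_real_pos hv h2 h3
    have b := crs_I_mul_self hv (δ := s' - s) (by linarith)
    rw [show I * (((s' - s : ℝ) : ℂ) * v) = y * w - x * v by
      rw [h1]; push_cast; ring] at b
    simp only [crs, sub_re, sub_im, add_re, add_im, re_ofReal_mul, im_ofReal_mul] at a b
    linarith
  · rintro ⟨x, y, s, s', hx, hy, hs, hs', hss, h1, h2, h3⟩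
    have a := crs_of_real_pos hw h2 h3
    have b := crs_I_mul_self hw (δ := s - s') (by linarith)
    rw [show I * (((s - s' : ℝ) : ℂ) * w) = -(y * w - x * v) by
      rw [h1]; push_cast; ring] at b
    simp only [crs, sub_re, sub_im, neg_re, neg_im, add_re, add_im, re_ofReal_mul,
      im_ofReal_mul] at a b
    linarith

lemma not_cornerSnd_bot (hv : 0 < v.im) (hw : 0 < w.im) :
    ¬ CornerSnd v w v 1 ∧ ¬ CornerSnd v w w (-1) := by
  constructor
  · rintro ⟨x, y, s, s', hx, hy, hs, hs', hss, h1, h2, h3⟩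
    have a := crs_of_real_pos hv h2 h3
    have b := crs_I_mul_self hv (δ := s' - s) (by linarith)
    rw [show I * (((s' - s : ℝ) : ℂ) * v) = -(y * w - x * v) by
      push_cast; linear_combination I * h1 + (y * w - x * v) * I_sq] at b
    simp only [crs, sub_re, sub_im, neg_re, neg_im, add_re, add_im, re_ofReal_mul,
      im_ofReal_mul] at a b
    linarith
  · rintro ⟨x, y, s, s', hx, hy, hs, hs', hss, h1, h2, h3⟩
    have a := crs_of_real_pos hw h2 h3
    have b := crs_I_mul_self hw (δ := s - s') (by linarith)
    rw [show I * (((s - s' : ℝ) : ℂ) * w) = y * w - x * v by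
      push_cast; linear_combination -I * h1 - (y * w - x * v) * I_sq] at b
    simp only [crs, sub_re, sub_im, add_re, add_im, re_ofReal_mul, im_ofReal_mul] at a b
    linarith

end Bottom

/-- The contribution of the vertex after the edge `c` to the number of ends of cells of squares. -/
noncomputable def vertexSum (V : ℕ → ℂ) (n c : ℕ) : ZMod 2 :=
  ∑ j ∈ Finset.range n, (ind (InCone (I * ed V j) (ed V c) (ed V (c + 1)) ∧ HasLeft V (V (c + 1)) j) +
    ind (InCone (-(I * ed V j)) (ed V c) (ed V (c + 1)) ∧ HasRight V (V (c + 1)) j))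

/-- The corner after the edge `c` is acute, and its vertex is lower than the adjacent ones. -/
def AcuteMin (V : ℕ → ℂ) (c : ℕ) : Prop :=
  0 < dt (-ed V c) (ed V (c + 1)) ∧ 0 < (-ed V c).im ∧ 0 < (ed V (c + 1)).im

namespace Core

variable {V : ℕ → ℂ} {n : ℕ} (H : Core V n)

include H

lemma sum_cellEnd_corner {c : ℕ} (hc : c + 1 < n) :
    ∑ j ∈ Finset.range n, (ind (CellEnd V c (c + 1) j j) + ind (CellEnd V j j c (c + 1))) +
      ind (CellEnd V c (c + 1) c (c + 1)) = vertexSum V n c + ind (AcuteMin V c) := by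
  obtain ⟨h1, h2, h3, h4, h5⟩ := H.cellEnd_adjacent (c := c)
  have hcr : crs (ed V (c + 1)) (-ed V c) ≠ 0 := by
    have := H.crs_succ (c := c) (by omega)
    intro h; apply this; simp only [crs, neg_re, neg_im] at h ⊢; linarith
  have key : ∀ j ∈ Finset.range n, ind (CellEnd V c (c + 1) j j) + ind (CellEnd V j j c (c + 1)) =
      (ind (InCone (I * ed V j) (ed V c) (ed V (c + 1)) ∧ HasLeft V (V (c + 1)) j) +
        ind (InCone (-(I * ed V j)) (ed V c) (ed V (c + 1)) ∧ HasRight V (V (c + 1)) j)) +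
      ((if j = c then ind (CornerFst (-ed V c) (ed V (c + 1)) (-ed V c) (-1)) +
          ind (CornerSnd (-ed V c) (ed V (c + 1)) (-ed V c) (-1)) else 0) +
        (if j = c + 1 then ind (CornerFst (-ed V c) (ed V (c + 1)) (ed V (c + 1)) 1) +
          ind (CornerSnd (-ed V c) (ed V (c + 1)) (ed V (c + 1)) 1) else 0)) := by
    intro j hj
    rw [Finset.mem_range] at hj
    by_cases hjc : j = c ∨ j = c + 1
    · rw [ind_false (p := _ ∧ HasLeft _ _ _), ind_false (p := _ ∧ HasRight _ _ _)]
      · rcases hjc with rfl | rfl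
        · rw [if_pos rfl, if_neg (by omega), ind_congr h2, ind_congr h4]; ring
        · rw [if_neg (by omega), if_pos rfl, ind_congr h3, ind_congr h5]; ring
      · rintro ⟨-, z, hz, hi, -⟩; exact H.pt_ne_vertex_self hc hjc hz hi
      · rintro ⟨-, z, hz, hi, -⟩; exact H.pt_ne_vertex_self hc hjc hz hi
    · push Not at hjc
      rw [ind_congr (H.cellEnd_corner_diag hc hj hjc.1 hjc.2),
        ind_congr (H.cellEnd_diag_corner hc hj hjc.1 hjc.2), if_neg hjc.1, if_neg hjc.2]
      ring
  rw [Finset.sum_congr rfl key, Finset.sum_add_distrib]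
  change vertexSum V n c + _ + _ = _
  rw [Finset.sum_add_distrib,
    Finset.sum_ite_eq', Finset.sum_ite_eq', if_pos (by simp; omega), if_pos (by simp; omega),
    ind_congr h1, AcuteMin, ← corner_sum hcr]
  ring

lemma sum_cellEnd_bot :
    ∑ j ∈ Finset.range n, (ind (CellEnd V 0 (n - 1) j j) + ind (CellEnd V j j 0 (n - 1))) +
      ind (CellEnd V 0 (n - 1) 0 (n - 1)) + tripleSum n (fun j l m => ind (BaseEnd V j l m)) =
      vertexSum V n (n - 1) + ind (AcuteMin V (n - 1)) := by
  have hn := H.three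
  have e : n - 1 + 1 = n := by omega
  have hv := H.ed_zero_im
  have hw := H.ed_last_im
  have A := H.ray_next 0
  have B := H.ray_bot
  have z : ∀ j ∈ Finset.range n,
      ind (CellEnd V 0 (n - 1) j j) + ind (CellEnd V j j 0 (n - 1)) = 0 := by
    intro j hj
    rw [Finset.mem_range] at hj
    have hne : ¬ (0 = n - 1) := by omega
    have hne' : ¬ (n - 1 = 0) := by omega
    by_cases hj' : j = 0 ∨ j = n - 1
    · rcases hj' with rfl | rfl
      · rw [ind_false, ind_false, add_zero]
        · rw [A.cellEnd_iff A A B le_rfl (by omega) (fun _ => rfl) (by omega)]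
          rintro ⟨s, s', x, y, h1, h2, h3, h4, h5, -, h6⟩
          exact (not_cornerSnd_bot hv hw).1 ⟨x, y, s, s', h3, h4, h1, h2, h5 rfl, h6⟩
        · rw [A.cellEnd_iff B A A (by omega) le_rfl (by omega) (fun _ => rfl)]
          rintro ⟨x, y, s, s', h1, h2, h3, h4, -, h5, h6⟩
          exact (not_cornerFst_bot hv hw).1 ⟨x, y, s, s', h1, h2, h3, h4, h5 rfl, h6⟩
      · rw [ind_false, ind_false, add_zero]
        · rw [B.cellEnd_iff B A B le_rfl (by omega) (fun _ => rfl) (by omega)]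
          rintro ⟨s, s', x, y, h1, h2, h3, h4, h5, -, h6⟩
          exact (not_cornerSnd_bot hv hw).2 ⟨x, y, s, s', h3, h4, h1, h2, h5 rfl, h6⟩
        · rw [A.cellEnd_iff B B B (by omega) le_rfl (by omega) (fun _ => rfl)]
          rintro ⟨x, y, s, s', h1, h2, h3, h4, -, h5, h6⟩
          exact (not_cornerFst_bot hv hw).2 ⟨x, y, s, s', h1, h2, h3, h4, h5 rfl, h6⟩
    · rw [ind_false, ind_false, add_zero]
      · rintro ⟨-, x, y, z, w, h1, h2, h3, h4, h5, -⟩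
        rw [H.pt_eq_bot h2 h4] at h5
        exact hj' (H.edge_bot hj (ch_nonneg_box le_rfl h1).1 h5.le).1
      · rintro ⟨-, x, y, z, w, h1, h2, h3, h4, h5, -⟩
        rw [H.pt_eq_bot h1 h3] at h5
        exact hj' (H.edge_bot hj (ch_nonneg_box le_rfl h2).1 h5.ge).1
  have z' : vertexSum V n (n - 1) = 0 := by
    refine Finset.sum_eq_zero fun j hj => ?_
    rw [Finset.mem_range] at hj
    obtain ⟨h1, h2⟩ := H.not_hasLeft_bot hj
    rw [e, H.V_n, ind_false fun h => h1 h.2, ind_false fun h => h2 h.2, add_zero]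
  have hd : dt (ed V 0) (-ed V (n - 1)) = dt (-ed V (n - 1)) (ed V 0) := by simp only [dt]; ring
  rw [Finset.sum_eq_zero z, z', ind_congr H.cellEnd_bot, H.baseEnd_sum, AcuteMin, e, H.ed_n,
    ind_congr (p := 0 < dt (-ed V (n - 1)) (ed V 0) ∧ _)
      (q := 0 < dt (ed V 0) (-ed V (n - 1)))]
  · rw [← base_corner_sum H.crs_bot hv hw H.base_fst (by
      rw [normSq_neg]; exact H.base_snd)]
    ring
  · rw [hd]
    exact ⟨fun h => h.1, fun h => ⟨h, hw, hv⟩⟩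

lemma not_cellEnd_of_fst {i k j l : ℕ} (hik : i < k) (hk : k < n) (h1 : k ≠ i + 1)
    (h2 : ¬ (i = 0 ∧ k + 1 = n)) : ¬ CellEnd V i k j l ∧ ¬ CellEnd V j l i k := by
  constructor
  · rintro ⟨-, x, y, z, w, a1, a2, a3, a4, -⟩
    rcases H.degenerate_pair hik.le hk a1 a3 with h | h | h
    · omega
    · exact h1 h.1
    · exact h2 ⟨h.1, h.2.1⟩
  · rintro ⟨-, x, y, z, w, a1, a2, a3, a4, -⟩
    rcases H.degenerate_pair hik.le hk a2 a4 with h | h | h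
    · omega
    · exact h1 h.1
    · exact h2 ⟨h.1, h.2.1⟩

/-- The number of squares in terms of the vertices. -/
theorem square_count : pairSum n (fun i k => pairSum n fun j l => ind (CellSq V i k j l)) =
    ∑ c ∈ Finset.range n, (vertexSum V n c + ind (AcuteMin V c)) := by
  have hn := H.three
  obtain ⟨lo, hlo⟩ : ∃ lo : ℕ → ℕ, lo = fun c => if c + 1 < n then c else 0 := ⟨_, rfl⟩
  obtain ⟨hi, hhi⟩ : ∃ hi : ℕ → ℕ, hi = fun c => if c + 1 < n then c + 1 else n - 1 := ⟨_, rfl⟩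
  have lh : ∀ (f : ℕ → ℕ → ZMod 2) c,
      (if c + 1 < n then f c (c + 1) else f 0 (n - 1)) = f (lo c) (hi c) := by
    intro f c
    rw [hlo, hhi]
    by_cases h : c + 1 < n
    · simp only [h, if_true]
    · simp only [h, if_false]
  have inner : ∀ i k, pairSum n (fun j l => ind (CellEnd V i k j l)) =
      ∑ j ∈ Finset.range n, ind (CellEnd V i k j j) +
        ∑ c ∈ Finset.range n, ind (CellEnd V i k (lo c) (hi c)) := by
    intro i k
    rw [pairSum_chords hn (fun j l => ind (CellEnd V i k j l)) fun j l h1 h2 h3 h4 =>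
      ind_false (H.not_cellEnd_of_fst h1 h2 h3 h4).2]
    simp only [lh fun j l => ind (CellEnd V i k j l)]
  have off : ∀ c < n, ∑ d ∈ Finset.range n, ind (CellEnd V (lo c) (hi c) (lo d) (hi d)) =
      ind (CellEnd V (lo c) (hi c) (lo c) (hi c)) := by
    intro c hc
    refine Finset.sum_eq_single_of_mem c (by simpa using hc) fun d hd hdc => ?_
    rw [Finset.mem_range] at hd
    refine ind_false ?_
    rw [hlo, hhi]
    by_cases h1 : c + 1 < n <;> by_cases h2 : d + 1 < n <;> simp only [h1, h2, if_true, if_false]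
    · exact H.not_cellEnd_corners hdc.symm h1 h2
    · exact (H.not_cellEnd_corner_bot h1).1
    · exact (H.not_cellEnd_corner_bot h2).2
    · omega
  rw [H.square_parity, pairSum_chords hn _ fun i k h1 h2 h3 h4 => by
    rw [pairSum_congr (g := fun _ _ => 0) fun j l _ _ =>
      ind_false (H.not_cellEnd_of_fst h1 h2 h3 h4).1, pairSum_zero]]
  have e1 : ∀ i ∈ Finset.range n, pairSum n (fun j l => ind (CellEnd V i i j l)) =
        ∑ c ∈ Finset.range n, ind (CellEnd V i i (lo c) (hi c)) := by
    intro i hi'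
    rw [inner, Finset.sum_eq_zero, zero_add]
    intro j hj
    exact ind_false (H.not_cellEnd_diag (by simpa using hi') (by simpa using hj))
  have e2 : ∀ c ∈ Finset.range n, (if c + 1 < n then
      pairSum n (fun j l => ind (CellEnd V c (c + 1) j l)) else
      pairSum n (fun j l => ind (CellEnd V 0 (n - 1) j l))) =
        ∑ j ∈ Finset.range n, ind (CellEnd V (lo c) (hi c) j j) +
          ind (CellEnd V (lo c) (hi c) (lo c) (hi c)) := by
    intro c hc
    have := lh (fun i k => pairSum n fun j l => ind (CellEnd V i k j l)) c
    rw [this, inner, off c (by simpa using hc)]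
  rw [Finset.sum_congr rfl e1, Finset.sum_congr rfl e2, Finset.sum_comm, ← Finset.sum_add_distrib]
  obtain ⟨m, rfl⟩ : ∃ m, n = m + 1 := ⟨n - 1, by omega⟩
  have hb := H.sum_cellEnd_bot
  rw [Nat.add_sub_cancel] at hb
  rw [Finset.sum_range_succ, Finset.sum_range_succ (fun c => vertexSum V (m + 1) c + _), ← hb]
  have e3 : ∀ c ∈ Finset.range m, (∑ i ∈ Finset.range (m + 1), ind (CellEnd V i i (lo c) (hi c)) +
      (∑ j ∈ Finset.range (m + 1), ind (CellEnd V (lo c) (hi c) j j) +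
        ind (CellEnd V (lo c) (hi c) (lo c) (hi c)))) =
        vertexSum V (m + 1) c + ind (AcuteMin V c) := by
    intro c hc
    rw [Finset.mem_range] at hc
    rw [← H.sum_cellEnd_corner (by omega : c + 1 < m + 1), hlo, hhi, Finset.sum_add_distrib]
    simp only [show c + 1 < m + 1 by omega, if_true]
    ring
  have e4 : lo m = 0 ∧ hi m = m := by
    rw [hlo, hhi]; simp
  rw [Finset.sum_congr rfl e3, e4.1, e4.2,
    Finset.sum_add_distrib (f := fun j => ind (CellEnd V 0 m j j))]
  ring

end Core

/-- The indicator of a boolean modulo two. -/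
def bz (b : Bool) : ZMod 2 := if b then 1 else 0

lemma ind_eq_bz {p : Prop} {b : Bool} (h : p ↔ b = true) : ind p = bz b := by
  rw [ind_congr h]
  cases b <;> simp [bz, ind]

/-- The label of a pair of directions, in terms of the signs of their imaginary parts, of their dot
product and of their cross product. -/
def signLabel (s t d c : Bool) : ZMod 2 :=
  if s = t then bz (d || !c) else if s then bz (d && c) else 1 + bz (d && c)

/-- The label of a left direction and a right one. -/
noncomputable def dirLabel (l r : ℂ) : ZMod 2 :=
  signLabel (decide (0 < l.im)) (decide (0 < r.im)) (decide (0 < dt l r)) (decide (0 < crs l r))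

set_option synthInstance.maxHeartbeats 400000 in
set_option synthInstance.maxSize 1000 in
set_option maxRecDepth 10000 in
lemma signLabel_toggle : ∀ sf su sv a b p q c : Bool,
    ¬ ((p = true ↔ sv = true) ∧ (c = true ↔ sf = true) ∧ ¬ (q = true ↔ su = true)) →
    ¬ (¬ (p = true ↔ sv = true) ∧ ¬ (c = true ↔ sf = true) ∧ (q = true ↔ su = true)) →
    ((a = true ↔ q = true) ∧ ¬ (p = true ↔ b = true) → c = true) →
    (¬ (a = true ↔ q = true) ∧ (p = true ↔ b = true) → ¬ c = true) →
    signLabel sf su a p + signLabel sf sv b q =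
      bz ((a == c) && !(b == c)) + bz (!(su == c) && (sv == c)) ∧
    signLabel su sf a (!p) + signLabel sv sf b (!q) =
      bz (!(a == c) && (b == c)) + bz (!(su == c) && (sv == c)) := by
  decide

lemma inCone_iff {f u v : ℂ} (h : crs u v ≠ 0) :
    InCone f u v ↔ 0 < crs f v * crs u v ∧ 0 < crs u f * crs u v := by
  constructor
  · rintro ⟨x, y, hx, hy, rfl⟩
    have e1 : crs (x * u + y * v) v = x * crs u v := by simp [crs]; ring
    have e2 : crs u (x * u + y * v) = y * crs u v := by simp [crs]; ring
    have := mul_self_pos.2 h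
    rw [e1, e2, mul_assoc, mul_assoc]
    exact ⟨mul_pos hx this, mul_pos hy this⟩
  · rintro ⟨h1, h2⟩
    obtain ⟨x, y, rfl⟩ := exists_real_combination h f
    have e1 : crs (x * u + y * v) v = x * crs u v := by simp [crs]; ring
    have e2 : crs u (x * u + y * v) = y * crs u v := by simp [crs]; ring
    have := mul_self_pos.2 h
    rw [e1, mul_assoc] at h1
    rw [e2, mul_assoc] at h2
    exact ⟨x, y, pos_of_mul_pos_left h1 this.le, pos_of_mul_pos_left h2 this.le, rfl⟩

lemma mul_pos_iff_signs {x y : ℝ} (hx : x ≠ 0) (hy : y ≠ 0) : 0 < x * y ↔ (0 < x ↔ 0 < y) := by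
  rcases hx.lt_or_gt with hx | hx <;> rcases hy.lt_or_gt with hy | hy <;>
    simp [mul_pos_iff, hx, hy, hx.not_gt, hy.not_gt]

lemma neg_pos_iff_not {x : ℝ} (hx : x ≠ 0) : 0 < -x ↔ ¬ 0 < x := by
  rw [neg_pos, not_lt]; exact ⟨le_of_lt, fun h => lt_of_le_of_ne h hx⟩

lemma crs_comm (u v : ℂ) : crs v u = -crs u v := by simp only [crs]; ring

lemma dt_comm (u v : ℂ) : dt v u = dt u v := by simp only [dt]; ring

section Directions

variable {f u v : ℂ} (hf : f.im ≠ 0) (hu : u.im ≠ 0) (hv : v.im ≠ 0) (hd₁ : dt f u ≠ 0)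
  (hd₂ : dt f v ≠ 0) (hc₁ : crs f u ≠ 0) (hc₂ : crs f v ≠ 0) (hc : crs u v ≠ 0)

include hu hv hc in
lemma inCone_one_iff : InCone 1 u v ↔ ¬ (0 < u.im ↔ 0 < crs u v) ∧ (0 < v.im ↔ 0 < crs u v) := by
  have e1 : crs 1 v = v.im := by simp [crs]
  have e2 : crs u 1 = -u.im := by simp [crs]
  rw [inCone_iff hc, e1, e2, mul_pos_iff_signs hv hc, mul_pos_iff_signs (neg_ne_zero.2 hu) hc,
    neg_pos_iff_not hu]
  tauto

include hf hu hv hd₁ hd₂ hc₁ hc₂ hc in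
lemma dirLabel_toggle :
    dirLabel f u + dirLabel f v = ind (InCone (I * f) u v) + ind (InCone 1 u v) ∧
    dirLabel u f + dirLabel v f = ind (InCone (-(I * f)) u v) + ind (InCone 1 u v) := by
  have e1 : crs (I * f) v = -dt f v := by simp [crs, dt]; ring
  have e2 : crs u (I * f) = dt f u := by simp [crs, dt]; ring
  have e3 : crs (-(I * f)) v = dt f v := by simp [crs, dt]; ring
  have e4 : crs u (-(I * f)) = -dt f u := by simp [crs, dt]; ring
  have c1 : InCone (I * f) u v ↔ (0 < dt f u ↔ 0 < crs u v) ∧ ¬ (0 < dt f v ↔ 0 < crs u v) := by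
    rw [inCone_iff hc, e1, e2, mul_pos_iff_signs (neg_ne_zero.2 hd₂) hc, mul_pos_iff_signs hd₁ hc,
      neg_pos_iff_not hd₂]
    tauto
  have c2 : InCone (-(I * f)) u v ↔ ¬ (0 < dt f u ↔ 0 < crs u v) ∧ (0 < dt f v ↔ 0 < crs u v) := by
    rw [inCone_iff hc, e3, e4, mul_pos_iff_signs (neg_ne_zero.2 hd₁) hc, mul_pos_iff_signs hd₂ hc,
      neg_pos_iff_not hd₁]
    tauto
  have P1 : crs f u * v.im + crs u v * f.im + -crs f v * u.im = 0 := by simp only [crs]; ring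
  have P2 : dt f f * crs u v = dt f u * crs f v + -crs f u * dt f v := by simp only [crs, dt]; ring
  have hff : 0 < dt f f := by
    have := mul_self_pos.2 hf
    simp only [dt]; nlinarith [mul_self_nonneg f.re]
  have k1 : ¬ ((0 < crs f u ↔ 0 < v.im) ∧ (0 < crs u v ↔ 0 < f.im) ∧ ¬ (0 < crs f v ↔ 0 < u.im)) := by
    rw [← mul_pos_iff_signs hc₁ hv, ← mul_pos_iff_signs hc hf, ← mul_pos_iff_signs hc₂ hu]
    rintro ⟨a, b, c⟩; linarith
  have k2 : ¬ (¬ (0 < crs f u ↔ 0 < v.im) ∧ ¬ (0 < crs u v ↔ 0 < f.im) ∧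
      (0 < crs f v ↔ 0 < u.im)) := by
    rw [← mul_pos_iff_signs hc₁ hv, ← mul_pos_iff_signs hc hf, ← mul_pos_iff_signs hc₂ hu]
    rintro ⟨a, b, c⟩; linarith
  have k3 : (0 < dt f u ↔ 0 < crs f v) ∧ ¬ (0 < crs f u ↔ 0 < dt f v) → 0 < crs u v := by
    rw [← mul_pos_iff_signs hd₁ hc₂, ← mul_pos_iff_signs hc₁ hd₂]
    rintro ⟨a, b⟩
    exact pos_of_mul_pos_right (by rw [P2]; linarith) hff.le
  have k4 : ¬ (0 < dt f u ↔ 0 < crs f v) ∧ (0 < crs f u ↔ 0 < dt f v) → ¬ 0 < crs u v := by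
    rw [← mul_pos_iff_signs hd₁ hc₂, ← mul_pos_iff_signs hc₁ hd₂]
    rintro ⟨a, b⟩ h
    have := mul_pos hff h
    linarith
  have key := signLabel_toggle (decide (0 < f.im)) (decide (0 < u.im)) (decide (0 < v.im))
    (decide (0 < dt f u)) (decide (0 < dt f v)) (decide (0 < crs f u)) (decide (0 < crs f v))
    (decide (0 < crs u v)) (by simpa only [decide_eq_true_eq] using k1)
    (by simpa only [decide_eq_true_eq] using k2) (by simpa only [decide_eq_true_eq] using k3)
    (by simpa only [decide_eq_true_eq] using k4)
  have n1 : decide (0 < crs u f) = !decide (0 < crs f u) := by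
    rw [crs_comm f u, decide_eq_decide.2 (neg_pos_iff_not hc₁), decide_not]
  have n2 : decide (0 < crs v f) = !decide (0 < crs f v) := by
    rw [crs_comm f v, decide_eq_decide.2 (neg_pos_iff_not hc₂), decide_not]
  refine ⟨key.1.trans (congrArg₂ _ ?_ ?_), ?_⟩
  · refine (ind_eq_bz (c1.trans ?_)).symm
    simp
  · refine (ind_eq_bz ((inCone_one_iff hu hv hc).trans ?_)).symm
    simp
  rw [dirLabel, dirLabel, n1, n2, dt_comm f u, dt_comm f v]
  refine key.2.trans (congrArg₂ _ ?_ ?_)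
  · refine (ind_eq_bz (c2.trans ?_)).symm
    simp
  · refine (ind_eq_bz ((inCone_one_iff hu hv hc).trans ?_)).symm
    simp

end Directions

/-- The number `x` lies strictly between `c` and `d`. -/
def Betw (x c d : ℝ) : Prop := (c < x ∧ x < d) ∨ (d < x ∧ x < c)

/-- The height at the position after `c` is a local extremum. -/
def Extr (h : ℕ → ℝ) (c : ℕ) : Prop := ¬ (h c < h (c + 1) ↔ h (c + 1) < h (c + 2))

lemma ind_btw {x c d : ℝ} (hc : x ≠ c) (hd : x ≠ d) : ind (Betw x c d) = ind (c < x) + ind (d < x) := by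
  rcases hc.lt_or_gt with h1 | h1 <;> rcases hd.lt_or_gt with h2 | h2 <;>
    simp [ind, Betw, h1, h2, h1.not_gt, h2.not_gt, CharTwo.two_eq_zero, one_add_one_eq_two]

lemma ind_add_ind_gt {a b : ℝ} (h : a ≠ b) : ind (a < b) + ind (b < a) = 1 := by
  rcases h.lt_or_gt with h | h <;> simp [ind, h, h.not_gt]

lemma ind_ext (h : ℕ → ℝ) (c : ℕ) : ind (Extr h c) = ind (h c < h (c + 1)) + ind (h (c + 1) < h (c + 2)) := by
  by_cases h1 : h c < h (c + 1) <;> by_cases h2 : h (c + 1) < h (c + 2) <;>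
    simp [ind, Extr, h1, h2, one_add_one_eq_two, CharTwo.two_eq_zero]

lemma btw_left (x d : ℝ) : ¬ Betw x x d := by simp [Betw]
lemma btw_right (x d : ℝ) : ¬ Betw x d x := by simp [Betw]

section Heights

variable {h : ℕ → ℝ} {n : ℕ}

lemma ind_btw_four {a b c d : ℝ} (h1 : a ≠ c) (h2 : a ≠ d) (h3 : b ≠ c) (h4 : b ≠ d) :
    ind (Betw a c d) + ind (Betw b c d) + (ind (Betw c a b) + ind (Betw d a b)) = 0 := by
  rw [ind_btw h1 h2, ind_btw h3 h4, ind_btw h1.symm h3.symm, ind_btw h2.symm h4.symm]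
  linear_combination ind_add_ind_gt h1 + ind_add_ind_gt h2 + ind_add_ind_gt h3 +
    ind_add_ind_gt h4 + 2 * CharTwo.two_eq_zero (R := ZMod 2)

lemma ind_btw_three {a b d : ℝ} (h1 : a ≠ b) (h2 : a ≠ d) (h3 : b ≠ d) :
    ind (Betw a b d) + ind (Betw b b d) + (ind (Betw b a b) + ind (Betw d a b)) =
      ind (a < b) + ind (b < d) := by
  rw [ind_btw h1 h2, ind_false (btw_left b d), ind_false (btw_right b a),
    ind_btw h2.symm h3.symm]
  linear_combination ind_add_ind_gt h2 - ind_add_ind_gt h1 +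
    (ind (b < a)) * CharTwo.two_eq_zero (R := ZMod 2)

/-- A combination over all pairs of crossing heights reduces to the extrema. -/
lemma height_sum (hn : 3 ≤ n) (h0 : h n = h 0) (h1 : h (n + 1) = h 1)
    (inj : ∀ a < n, ∀ b < n, a ≠ b → h a ≠ h b) {G : ℕ → ℕ → ZMod 2}
    (symm : ∀ i j, G i j = G j i) (per : ∀ j, G n j = G 0 j) :
    ∑ c ∈ Finset.range n, ∑ j ∈ Finset.range n,
      ind (Betw (h (c + 1)) (h j) (h (j + 1))) * (G c j + G (c + 1) j) =
    ∑ c ∈ Finset.range n, ind (Extr h c) * G c (c + 1) := by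
  set s : ℕ → ℕ → ZMod 2 := fun c j =>
    (ind (Betw (h c) (h j) (h (j + 1))) + ind (Betw (h (c + 1)) (h j) (h (j + 1)))) * G c j with hs
  have shift : ∀ F : ℕ → ZMod 2, F n = F 0 →
      ∑ c ∈ Finset.range n, F (c + 1) = ∑ c ∈ Finset.range n, F c := by
    intro F hF
    have := Finset.sum_range_succ F n
    rw [Finset.sum_range_succ', hF] at this
    exact add_right_cancel this
  have e : ∑ c ∈ Finset.range n, ∑ j ∈ Finset.range n,
      ind (Betw (h (c + 1)) (h j) (h (j + 1))) * (G c j + G (c + 1) j) =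
      ∑ c ∈ Finset.range n, ∑ j ∈ Finset.range n, s c j := by
    have := shift (fun c => ∑ j ∈ Finset.range n, ind (Betw (h c) (h j) (h (j + 1))) * G c j)
      (by simp only [h0, per])
    simp only [hs, mul_add, add_mul, Finset.sum_add_distrib]
    rw [this, add_comm]
  rw [e, sum_sum_eq_pairSum, pairSum_chords hn]
  · rw [Finset.sum_eq_zero, zero_add]
    · refine Finset.sum_congr rfl fun c hc => ?_
      rw [Finset.mem_range] at hc
      by_cases hc' : c + 1 < n
      · rw [if_pos hc', if_pos (by omega)]
        have hd : h (c + 2) ≠ h c ∧ h (c + 2) ≠ h (c + 1) := by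
          by_cases hc2 : c + 2 < n
          · exact ⟨inj _ hc2 _ hc (by omega), inj _ hc2 _ hc' (by omega)⟩
          · rw [show c + 2 = n by omega, h0]
            exact ⟨inj _ (by omega) _ hc (by omega), inj _ (by omega) _ hc' (by omega)⟩
        rw [ind_ext, ← ind_btw_three (inj c hc _ hc' (by omega)) hd.1.symm hd.2.symm]
        simp only [hs, symm (c + 1) c]
        ring
      · obtain rfl : n = c + 1 := by omega
        rw [if_neg hc', if_pos (by omega), ind_ext, symm c (c + 1), per, h0,
          show h (c + 2) = h 1 from h1,
          ← ind_btw_three (a := h c) (b := h 0) (d := h 1) (inj _ (by omega) _ (by omega) (by omega))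
          (inj _ (by omega) _ (by omega) (by omega)) (inj _ (by omega) _ (by omega) (by omega))]
        simp only [hs, symm c 0, Nat.add_sub_cancel, h0, zero_add]
        ring
    · intro j _
      simp only [lt_irrefl, if_false, hs]
      rw [ind_false (btw_left _ _), ind_false (btw_right _ _)]
      ring
  · intro i k hik hk h1' h2'
    rw [if_pos hik]
    have a : h (i + 1) ≠ h k := inj _ (by omega) _ hk (by omega)
    have b : h i ≠ h k := inj _ (by omega) _ hk (by omega)
    have c : h (k + 1) ≠ h i ∧ h (k + 1) ≠ h (i + 1) := by
      by_cases hc2 : k + 1 < n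
      · exact ⟨inj _ hc2 _ (by omega) (by omega), inj _ hc2 _ (by omega) (by omega)⟩
      · rw [show k + 1 = n by omega, h0]
        exact ⟨inj _ (by omega) _ (by omega) (by omega), inj _ (by omega) _ (by omega) (by omega)⟩
    have := ind_btw_four b c.1.symm a c.2.symm
    simp only [hs, symm k i]
    linear_combination G i k * this

lemma sum_btw_of_ext (h0 : h n = h 0) (inj : ∀ a < n, ∀ b < n, a ≠ b → h a ≠ h b) {c : ℕ}
    (hc : c + 1 < n) (he : Extr h c) :
    ∑ j ∈ Finset.range n, ind (Betw (h (c + 1)) (h j) (h (j + 1))) = 0 := by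
  have hd : h (c + 2) ≠ h (c + 1) := by
    by_cases hc2 : c + 2 < n
    · exact inj _ hc2 _ hc (by omega)
    · rw [show c + 2 = n by omega, h0]
      exact inj _ (by omega) _ hc (by omega)
  have key : ∀ j ∈ Finset.range n, ind (Betw (h (c + 1)) (h j) (h (j + 1))) =
      (ind (h j < h (c + 1)) + ind (h (j + 1) < h (c + 1))) +
      ((if j = c then ind (h c < h (c + 1)) else 0) +
        (if j = c + 1 then ind (h (c + 2) < h (c + 1)) else 0)) := by
    intro j hj
    rw [Finset.mem_range] at hj
    by_cases h1 : j = c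
    · subst h1
      rw [ind_false (btw_right _ _), if_pos rfl, if_neg (by omega), ind_false (lt_irrefl (h (j + 1)))]
      linear_combination -zmod2_add_self (ind (h j < h (j + 1)))
    by_cases h2 : j = c + 1
    · subst h2
      rw [ind_false (btw_left _ _), if_neg (by omega), if_pos rfl, ind_false (lt_irrefl _)]
      linear_combination -zmod2_add_self (ind (h (c + 2) < h (c + 1)))
    rw [if_neg h1, if_neg h2, ind_btw (inj _ hc _ hj (by omega))]
    · ring
    by_cases hc2 : j + 1 < n
    · exact inj _ hc _ hc2 (by omega)
    · rw [show j + 1 = n by omega, h0]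
      exact inj _ hc _ (by omega) (by omega)
  rw [Finset.sum_congr rfl key, Finset.sum_add_distrib, sum_cyclic (by rw [h0]),
    Finset.sum_add_distrib, Finset.sum_ite_eq', Finset.sum_ite_eq', if_pos (by simp; omega),
    if_pos (by simpa using hc), zero_add]
  have e : h (c + 2) < h (c + 1) ↔ h c < h (c + 1) := by
    rw [Extr] at he
    have : h (c + 2) < h (c + 1) ↔ ¬ h (c + 1) < h (c + 2) :=
      ⟨fun h => h.not_gt, fun h => lt_of_le_of_ne (not_lt.1 h) hd⟩
    tauto
  rw [ind_congr e, zmod2_add_self]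

end Heights

/-- Some point of the edge `i` has a point of the edge `j` on its right. -/
def LeftOf (V : ℕ → ℂ) (i j : ℕ) : Prop := ∃ z w : ℝ, (0 ≤ z ∧ z ≤ 1) ∧ (0 ≤ w ∧ w ≤ 1) ∧
  (pt V i z).im = (pt V j w).im ∧ (pt V i z).re < (pt V j w).re

/-- The label of a pair of edges. -/
noncomputable def edgeLabel (V : ℕ → ℂ) (i j : ℕ) : ZMod 2 :=
  ind (LeftOf V i j) * dirLabel (ed V i) (ed V j) + ind (LeftOf V j i) * dirLabel (ed V j) (ed V i)

lemma edgeLabel_comm (V : ℕ → ℂ) (i j : ℕ) : edgeLabel V i j = edgeLabel V j i := add_comm _ _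

lemma betw_iff {m a b : ℝ} : Betw m a b ↔ ∃ z : ℝ, (0 < z ∧ z < 1) ∧ a + z * (b - a) = m ∧ a ≠ b := by
  constructor
  · intro h
    have hab : b - a ≠ 0 := by rcases h with h | h <;> intro h' <;> linarith
    refine ⟨(m - a) / (b - a), ?_, by field_simp; ring, fun h => hab (by linarith)⟩
    rcases h with ⟨h1, h2⟩ | ⟨h1, h2⟩
    · have : 0 < b - a := by linarith
      exact ⟨div_pos (by linarith) this, (div_lt_one this).2 (by linarith)⟩
    · have : b - a < 0 := by linarith
      exact ⟨div_pos_of_neg_of_neg (by linarith) this, (div_lt_one_of_neg this).2 (by linarith)⟩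
  · rintro ⟨z, hz, rfl, hne⟩
    rcases hne.lt_or_gt with h | h
    · left; constructor <;> nlinarith
    · right; constructor <;> nlinarith

lemma pt_im (V : ℕ → ℂ) (j : ℕ) (z : ℝ) :
    (pt V j z).im = (V j).im + z * ((V (j + 1)).im - (V j).im) := by
  simp [pt, ed]

lemma interp_mem {t x y : ℝ} (h0 : 0 < t) (h1 : t < 1) (hx : 0 ≤ x ∧ x ≤ 1) (hy : 0 ≤ y ∧ y ≤ 1) :
    0 ≤ x + t * (y - x) ∧ x + t * (y - x) ≤ 1 := by
  have a := mul_nonneg (sub_pos.2 h1).le hx.1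
  have b := mul_nonneg h0.le hy.1
  have c := mul_nonneg (sub_pos.2 h1).le (sub_nonneg.2 hx.2)
  have d := mul_nonneg h0.le (sub_nonneg.2 hy.2)
  constructor <;> linarith

lemma interp_eq_zero {t x y : ℝ} (h0 : 0 < t) (h1 : t < 1) (hx : 0 ≤ x ∧ x ≤ 1)
    (hy : 0 ≤ y ∧ y ≤ 1) : x + t * (y - x) = 0 ↔ x = 0 ∧ y = 0 := by
  constructor
  · intro h
    have a := mul_nonneg (sub_pos.2 h1).le hx.1
    have b := mul_nonneg h0.le hy.1
    have c : (1 - t) * x = 0 := by linarith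
    have d : t * y = 0 := by linarith
    exact ⟨(mul_eq_zero.1 c).resolve_left (by linarith), (mul_eq_zero.1 d).resolve_left h0.ne'⟩
  · rintro ⟨rfl, rfl⟩; ring

lemma interp_eq_one {t x y : ℝ} (h0 : 0 < t) (h1 : t < 1) (hx : 0 ≤ x ∧ x ≤ 1)
    (hy : 0 ≤ y ∧ y ≤ 1) : x + t * (y - x) = 1 ↔ x = 1 ∧ y = 1 := by
  have := interp_eq_zero h0 h1 (x := 1 - x) (y := 1 - y) ⟨by linarith, by linarith⟩
    ⟨by linarith, by linarith⟩
  constructor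
  · intro h
    have := this.1 (by linarith)
    exact ⟨by linarith, by linarith⟩
  · rintro ⟨rfl, rfl⟩; ring

namespace Core

variable {V : ℕ → ℂ} {n : ℕ} (H : Core V n)

include H

lemma pt_n (z : ℝ) : pt V n z = pt V 0 z := by rw [pt, pt, H.ed_n, H.V_n]

lemma leftOf_asymm {i j : ℕ} (hi : i < n) (hj : j < n) (hij : i ≠ j) (h : LeftOf V i j) :
    ¬ LeftOf V j i := by
  wlog hlt : i < j generalizing i j
  · exact fun h' => this hj hi hij.symm h' (by omega) h
  rintro ⟨w', z', hw', hz', e', l'⟩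
  obtain ⟨z, w, hz, hw, e, l⟩ := h
  obtain ⟨p, hp⟩ : ∃ p, p = (pt V j w).re - (pt V i z).re := ⟨_, rfl⟩
  obtain ⟨q, hq⟩ : ∃ q, q = (pt V i z').re - (pt V j w').re := ⟨_, rfl⟩
  have hp0 : 0 < p := by linarith
  have hq0 : 0 < q := by linarith
  have hpq : p + q ≠ 0 := by linarith
  obtain ⟨t, ht⟩ : ∃ t, t = p / (p + q) := ⟨_, rfl⟩
  have ht' : t * (p + q) = p := by rw [ht]; field_simp
  have ht0 : 0 < t := by rw [ht]; positivity
  have ht1 : t < 1 := by rw [ht, div_lt_one (by linarith)]; linarith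
  have pe : ∀ (k : ℕ) (a b : ℝ), pt V k (a + t * (b - a)) = (1 - t : ℝ) * pt V k a + t * pt V k b := by
    intro k a b; simp only [pt]; push_cast; ring
  have meet : pt V i (z + t * (z' - z)) = pt V j (w + t * (w' - w)) := by
    rw [pe, pe]
    apply Complex.ext
    · simp only [add_re, re_ofReal_mul]
      rw [hp, hq] at ht'
      linarith
    · simp only [add_im, im_ofReal_mul]
      rw [e, e']
  rcases H.simple i j hlt hj _ _
    (interp_mem ht0 ht1 hz hz').1 (interp_mem ht0 ht1 hz hz').2
    (interp_mem ht0 ht1 hw hw').1 (interp_mem ht0 ht1 hw hw').2 meet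
    with ⟨-, h1, h2⟩ | ⟨-, -, h1, h2⟩
  · have e1 := (interp_eq_one ht0 ht1 hz hz').1 h1
    have e2 := (interp_eq_zero ht0 ht1 hw hw').1 h2
    rw [e1.1, e2.1] at l
    rw [e1.2, e2.2] at l'
    linarith
  · have e1 := (interp_eq_zero ht0 ht1 hz hz').1 h1
    have e2 := (interp_eq_one ht0 ht1 hw hw').1 h2
    rw [e1.1, e2.1] at l
    rw [e1.2, e2.2] at l'
    linarith

lemma leftOf_asymm_succ {c : ℕ} (hc : c < n) (h : LeftOf V c (c + 1)) : ¬ LeftOf V (c + 1) c := by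
  have := H.three
  rcases H.succ_cases hc with h' | ⟨h', -⟩
  · exact H.leftOf_asymm hc h' (by omega) h
  · rw [h'] at h ⊢
    simp only [LeftOf, H.pt_n] at h ⊢
    exact H.leftOf_asymm hc (by omega) (by omega) h

lemma leftOf_of_hasLeft {c j : ℕ} (h : HasLeft V (V (c + 1)) j) :
    LeftOf V j c ∧ LeftOf V j (c + 1) := by
  obtain ⟨z, hz, h1, h2⟩ := h
  exact ⟨⟨z, 1, ⟨hz.1.le, hz.2.le⟩, ⟨zero_le_one, le_rfl⟩, by rwa [pt_one], by rwa [pt_one]⟩,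
    ⟨z, 0, ⟨hz.1.le, hz.2.le⟩, ⟨le_rfl, zero_le_one⟩, by rwa [pt_zero], by rwa [pt_zero]⟩⟩

lemma leftOf_of_hasRight {c j : ℕ} (h : HasRight V (V (c + 1)) j) :
    LeftOf V c j ∧ LeftOf V (c + 1) j := by
  obtain ⟨z, hz, h1, h2⟩ := h
  exact ⟨⟨1, z, ⟨zero_le_one, le_rfl⟩, ⟨hz.1.le, hz.2.le⟩, by rw [pt_one, h1], by rwa [pt_one]⟩,
    ⟨0, z, ⟨le_rfl, zero_le_one⟩, ⟨hz.1.le, hz.2.le⟩, by rw [pt_zero, h1], by rwa [pt_zero]⟩⟩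

lemma betw_iff_hasLeft_or {c j : ℕ} (hc : c + 1 < n) (hj : j < n) (h1 : j ≠ c) (h2 : j ≠ c + 1) :
    Betw (V (c + 1)).im (V j).im (V (j + 1)).im ↔ HasLeft V (V (c + 1)) j ∨ HasRight V (V (c + 1)) j := by
  have hne : (V j).im ≠ (V (j + 1)).im := by
    have := H.ed_im hj
    rw [ed, sub_im, sub_ne_zero] at this
    exact this.symm
  rw [betw_iff]
  constructor
  · rintro ⟨z, hz, e, -⟩
    rw [← pt_im] at e
    rcases (H.level_interior hc hj h1 h2 ⟨hz.1.le, hz.2.le⟩ e).2.lt_or_gt with h | h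
    · exact Or.inl ⟨z, hz, e, h⟩
    · exact Or.inr ⟨z, hz, e, h⟩
  · rintro (⟨z, hz, e, -⟩ | ⟨z, hz, e, -⟩) <;>
    · rw [pt_im] at e
      exact ⟨z, hz, e, hne⟩

lemma not_betw_self {c j : ℕ} (h : j = c ∨ j = c + 1) :
    ¬ Betw (V (c + 1)).im (V j).im (V (j + 1)).im := by
  rcases h with rfl | rfl
  · exact btw_right _ _
  · exact btw_left _ _

lemma not_betw_bot {j : ℕ} (hj : j < n) : ¬ Betw (V 0).im (V j).im (V (j + 1)).im := by
  have h : ∀ a ≤ n, (V 0).im ≤ (V a).im := by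
    intro a ha
    rcases Nat.eq_zero_or_pos a with rfl | h0
    · exact le_rfl
    · rcases ha.lt_or_eq with h | rfl
      · exact (H.bot a h0 h).le
      · rw [H.V_n]
  rintro (⟨h1, -⟩ | ⟨h1, -⟩)
  · exact h1.not_ge (h _ hj.le)
  · exact h1.not_ge (h _ hj)

lemma extr_signs {c : ℕ} (hc : c < n) : Extr (fun i => (V i).im) c ↔
    ((ed V c).im < 0 ∧ 0 < (ed V (c + 1)).im) ∨ (0 < (ed V c).im ∧ (ed V (c + 1)).im < 0) := by
  have h1 := H.ed_im hc
  have h2 : (ed V (c + 1)).im ≠ 0 := by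
    rcases H.succ_cases hc with h | ⟨-, h, -⟩
    · exact H.ed_im h
    · rw [h]; exact H.ed_im H.n_pos
  simp only [Extr]
  rw [← sub_pos, ← sub_im, ← sub_pos (b := (V (c + 1)).im), ← sub_im]
  change ¬ (0 < (ed V c).im ↔ 0 < (ed V (c + 1)).im) ↔ _
  rcases h1.lt_or_gt with h1 | h1 <;> rcases h2.lt_or_gt with h2 | h2 <;>
    simp [h1, h2, h1.not_gt, h2.not_gt]

lemma leftOf_succ_of {c : ℕ} (s : ℝ) (hs : s * (ed V c).im < 0 ∧ 0 < s * (ed V (c + 1)).im) :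
    (0 < s * crs (ed V c) (ed V (c + 1)) → LeftOf V c (c + 1)) ∧
      (s * crs (ed V c) (ed V (c + 1)) < 0 → LeftOf V (c + 1) c) := by
  obtain ⟨p, hp⟩ : ∃ p, p = s * (ed V (c + 1)).im := ⟨_, rfl⟩
  obtain ⟨q, hq⟩ : ∃ q, q = -(s * (ed V c).im) := ⟨_, rfl⟩
  have hp0 : 0 < p := by linarith
  have hq0 : 0 < q := by linarith
  obtain ⟨ε, he, hep, heq⟩ : ∃ ε : ℝ, 0 < ε ∧ ε * p < 1 ∧ ε * q < 1 := by
    have : 0 < 1 + p + q := by positivity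
    refine ⟨1 / (1 + p + q), by positivity, ?_, ?_⟩ <;>
      rw [one_div_mul_eq_div, div_lt_one this] <;> linarith
  have e1 : pt V c (1 - ε * p) = V (c + 1) - (ε * p : ℝ) * ed V c := by
    rw [H.pt_prev]; simp
  have e2 : pt V (c + 1) (ε * q) = V (c + 1) + (ε * q : ℝ) * ed V (c + 1) := rfl
  have i : (pt V c (1 - ε * p)).im = (pt V (c + 1) (ε * q)).im := by
    rw [e1, e2, sub_im, add_im, im_ofReal_mul, im_ofReal_mul, hp, hq]; ring
  have r : (pt V (c + 1) (ε * q)).re - (pt V c (1 - ε * p)).re =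
      ε * (s * crs (ed V c) (ed V (c + 1))) := by
    rw [e1, e2, sub_re, add_re, re_ofReal_mul, re_ofReal_mul, hp, hq, crs]; ring
  have b1 : 0 ≤ 1 - ε * p ∧ 1 - ε * p ≤ 1 := ⟨by linarith, by linarith [mul_pos he hp0]⟩
  have b2 : 0 ≤ ε * q ∧ ε * q ≤ 1 := ⟨(mul_pos he hq0).le, heq.le⟩
  constructor
  · intro h
    exact ⟨_, _, b1, b2, i, by linarith [mul_pos he h]⟩
  · intro h
    exact ⟨_, _, b2, b1, i.symm, by linarith [mul_neg_of_pos_of_neg he h]⟩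

/-- At an extremum the order of the two edges and their label are determined by signs. -/
lemma extr_label {c : ℕ} (hc : c < n) : ind (Extr (fun i => (V i).im) c) * edgeLabel V c (c + 1) +
    ind (AcuteMin V c) = ind (Extr (fun i => (V i).im) c) * ind (LeftOf V (c + 1) c) := by
  have hcr := H.crs_succ hc
  have hd : dt (ed V c) (ed V (c + 1)) ≠ 0 := by
    rcases H.succ_cases hc with h | ⟨-, h, -⟩
    · exact H.dt_ne c hc _ h
    · rw [h]; exact H.dt_ne c hc _ H.n_pos
  have hd' : 0 < dt (-ed V c) (ed V (c + 1)) ↔ ¬ 0 < dt (ed V c) (ed V (c + 1)) := by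
    rw [← neg_pos_iff_not hd, show dt (-ed V c) (ed V (c + 1)) = -dt (ed V c) (ed V (c + 1)) by
      simp only [dt, neg_re, neg_im]; ring]
  by_cases he : Extr (fun i => (V i).im) c
  · rw [ind_true he, one_mul, one_mul]
    have key := (H.extr_signs hc).1 he
    have asym := fun h => H.leftOf_asymm_succ hc h
    rw [edgeLabel, dirLabel, dirLabel, dt_comm (ed V c), crs_comm (ed V c)]
    rcases key with ⟨h1, h2⟩ | ⟨h1, h2⟩
    · obtain ⟨l1, l2⟩ := H.leftOf_succ_of (c := c) 1 (by simpa using ⟨h1, h2⟩)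
      rw [one_mul] at l1 l2
      have am : AcuteMin V c ↔ ¬ 0 < dt (ed V c) (ed V (c + 1)) := by
        rw [AcuteMin, hd', neg_im, neg_pos]; tauto
      rw [ind_congr am]
      rcases hcr.lt_or_gt with h | h
      · have := l2 h
        rw [ind_true this, ind_false fun h => asym h this]
        by_cases hdd : 0 < dt (ed V c) (ed V (c + 1)) <;>
          simp [signLabel, h1.not_gt, h2, h, h.not_gt, hdd, bz, ind]
      · have := l1 h
        rw [ind_true this, ind_false (asym this)]
        by_cases hdd : 0 < dt (ed V c) (ed V (c + 1)) <;>
          simp [signLabel, h1.not_gt, h2, h, h.not_gt, hdd, bz, ind, one_add_one_eq_two, CharTwo.two_eq_zero]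
    · obtain ⟨l1, l2⟩ := H.leftOf_succ_of (c := c) (-1) (by simpa using ⟨h1, h2⟩)
      rw [neg_one_mul] at l1 l2
      have am : ¬ AcuteMin V c := by
        rw [AcuteMin, neg_im, neg_pos]; exact fun h => h1.not_gt h.2.1
      rw [ind_false am]
      rcases hcr.lt_or_gt with h | h
      · have := l1 (by linarith)
        rw [ind_true this, ind_false (asym this)]
        simp [signLabel, h1, h2.not_gt, h, h.not_gt, bz, ind]
      · have := l2 (by linarith)
        rw [ind_true this, ind_false fun h => asym h this]
        simp [signLabel, h1, h2.not_gt, h, h.not_gt, bz, ind]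
  · have : ¬ AcuteMin V c := by
      rintro ⟨-, h1, h2⟩
      exact he ((H.extr_signs hc).2 (Or.inl ⟨by simpa using h1, h2⟩))
    rw [ind_false he, ind_false this]; ring

lemma leftOf_succ_or {c : ℕ} (hc : c < n) (he : Extr (fun i => (V i).im) c) :
    ind (LeftOf V (c + 1) c) = 1 + ind (LeftOf V c (c + 1)) := by
  have hcr := H.crs_succ hc
  have : LeftOf V (c + 1) c ∨ LeftOf V c (c + 1) := by
    rcases (H.extr_signs hc).1 he with ⟨h1, h2⟩ | ⟨h1, h2⟩
    · obtain ⟨l1, l2⟩ := H.leftOf_succ_of (c := c) 1 (by simpa using ⟨h1, h2⟩)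
      rw [one_mul] at l1 l2
      exact hcr.lt_or_gt.imp l2 l1
    · obtain ⟨l1, l2⟩ := H.leftOf_succ_of (c := c) (-1) (by simpa using ⟨h1, h2⟩)
      rw [neg_one_mul] at l1 l2
      exact hcr.lt_or_gt.symm.imp (fun h => l2 (by linarith)) (fun h => l1 (by linarith))
  by_cases h : LeftOf V c (c + 1)
  · rw [ind_true h, ind_false (H.leftOf_asymm_succ hc h), zmod2_add_self]
  · rw [ind_false h, ind_true (this.resolve_right h), add_zero]

end Core

namespace Core

variable {V : ℕ → ℂ} {n : ℕ} (H : Core V n)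

include H

lemma im_inj : ∀ a < n, ∀ b < n, a ≠ b → (fun i => (V i).im) a ≠ (fun i => (V i).im) b := H.im_ne

lemma im_per : (fun i => (V i).im) n = (fun i => (V i).im) 0 ∧
    (fun i => (V i).im) (n + 1) = (fun i => (V i).im) 1 := by
  refine ⟨congrArg im H.V_n, congrArg im ?_⟩
  rw [add_comm, H.per]

lemma leftOf_n (j : ℕ) : (LeftOf V n j ↔ LeftOf V 0 j) ∧ (LeftOf V j n ↔ LeftOf V j 0) := by
  simp only [LeftOf, H.pt_n, iff_self, and_self]

lemma edgeLabel_n (j : ℕ) : edgeLabel V n j = edgeLabel V 0 j := by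
  rw [edgeLabel, edgeLabel, ind_congr (H.leftOf_n j).1, ind_congr (H.leftOf_n j).2, H.ed_n]

lemma vertexSum_eq {c : ℕ} (hc : c < n) : vertexSum V n c = ∑ j ∈ Finset.range n,
    ind (Betw (V (c + 1)).im (V j).im (V (j + 1)).im) * (edgeLabel V c j + edgeLabel V (c + 1) j) := by
  rcases H.succ_cases hc with hc' | ⟨-, -, h⟩
  swap
  · rw [vertexSum, h]
    refine Finset.sum_congr rfl fun j hj => ?_
    rw [Finset.mem_range] at hj
    obtain ⟨h1, h2⟩ := H.not_hasLeft_bot hj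
    rw [ind_false fun h => h1 h.2, ind_false fun h => h2 h.2, ind_false (H.not_betw_bot hj)]
    ring
  have key : ∀ j ∈ Finset.range n,
      ind (InCone (I * ed V j) (ed V c) (ed V (c + 1)) ∧ HasLeft V (V (c + 1)) j) +
      ind (InCone (-(I * ed V j)) (ed V c) (ed V (c + 1)) ∧ HasRight V (V (c + 1)) j) =
      ind (Betw (V (c + 1)).im (V j).im (V (j + 1)).im) *
        (edgeLabel V c j + edgeLabel V (c + 1) j) +
      ind (InCone 1 (ed V c) (ed V (c + 1))) * ind (Betw (V (c + 1)).im (V j).im (V (j + 1)).im) := by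
    intro j hj
    rw [Finset.mem_range] at hj
    by_cases hjc : j = c ∨ j = c + 1
    · rw [ind_false (p := _ ∧ HasLeft _ _ _), ind_false (p := _ ∧ HasRight _ _ _),
        ind_false (H.not_betw_self hjc)]
      · ring
      · rintro ⟨-, z, hz, hi, -⟩; exact H.pt_ne_vertex_self hc' hjc hz hi
      · rintro ⟨-, z, hz, hi, -⟩; exact H.pt_ne_vertex_self hc' hjc hz hi
    push Not at hjc
    obtain ⟨h1, h2⟩ := hjc
    have hb := H.betw_iff_hasLeft_or hc' hj h1 h2
    have tog := dirLabel_toggle (H.ed_im hj) (H.ed_im hc) (H.ed_im hc') (H.dt_ne j hj c hc)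
      (H.dt_ne j hj _ hc') (H.crs_ne j hj c hc h1) (H.crs_ne j hj _ hc' h2) (H.crs_succ hc)
    by_cases hl : HasLeft V (V (c + 1)) j
    · have l := H.leftOf_of_hasLeft hl
      have a1 := H.leftOf_asymm hj hc h1 l.1
      have a2 := H.leftOf_asymm hj hc' h2 l.2
      have hr : ¬ HasRight V (V (c + 1)) j := fun h => a1 (H.leftOf_of_hasRight h).1
      rw [ind_true (hb.2 (Or.inl hl)), ind_false (p := _ ∧ HasRight _ _ _) fun h => hr h.2, edgeLabel, edgeLabel,
        ind_true l.1, ind_true l.2, ind_false a1, ind_false a2,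
        ind_congr (p := _ ∧ HasLeft _ _ _) (and_iff_left hl)]
      linear_combination -tog.1 - zmod2_add_self (ind (InCone 1 (ed V c) (ed V (c + 1))))
    · by_cases hr : HasRight V (V (c + 1)) j
      · have l := H.leftOf_of_hasRight hr
        have a1 := H.leftOf_asymm hc hj h1.symm l.1
        have a2 := H.leftOf_asymm hc' hj h2.symm l.2
        rw [ind_true (hb.2 (Or.inr hr)), ind_false fun h => hl h.2, edgeLabel, edgeLabel,
          ind_true l.1, ind_true l.2, ind_false a1, ind_false a2,
          ind_congr (p := _ ∧ HasRight _ _ _) (and_iff_left hr)]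
        linear_combination -tog.2 - zmod2_add_self (ind (InCone 1 (ed V c) (ed V (c + 1))))
      · rw [ind_false fun h => hl h.2, ind_false fun h => hr h.2,
          ind_false fun h => (hb.1 h).elim hl hr]
        ring
  rw [vertexSum, Finset.sum_congr rfl key, Finset.sum_add_distrib, ← Finset.mul_sum]
  by_cases h1 : InCone 1 (ed V c) (ed V (c + 1))
  · have he : Extr (fun i => (V i).im) c := by
      rw [inCone_one_iff (H.ed_im hc) (H.ed_im hc') (H.crs_succ hc)] at h1
      rw [H.extr_signs hc]
      rcases (H.ed_im hc).lt_or_gt with a | a <;> rcases (H.ed_im hc').lt_or_gt with b | b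
      · simp only [a.not_gt, b.not_gt] at h1; tauto
      · tauto
      · tauto
      · simp only [a, b] at h1; tauto
    rw [show ∑ j ∈ Finset.range n, ind (Betw (V (c + 1)).im (V j).im (V (j + 1)).im) = 0 from
      sum_btw_of_ext H.im_per.1 H.im_inj hc' he, mul_zero, add_zero]
  · rw [ind_false h1, zero_mul, add_zero]

/-- At an odd number of local extrema the first edge is on the left of the second one. -/
lemma sum_leftOf_succ : ∑ c ∈ Finset.range n,
    ind (Extr (fun i => (V i).im) c) * ind (LeftOf V c (c + 1)) = 1 := by
  have hn := H.three
  obtain ⟨m, rfl⟩ : ∃ m, n = m + 1 := ⟨n - 1, by omega⟩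
  set G : ℕ → ℕ → ZMod 2 := fun i j =>
    ind (LeftOf V (min (i % (m + 1)) (j % (m + 1))) (max (i % (m + 1)) (j % (m + 1)))) with hG
  have key := height_sum hn H.im_per.1 H.im_per.2 H.im_inj (G := G)
    (fun i j => by simp only [hG, min_comm, max_comm]) (fun j => by simp [hG])
  have mod : ∀ i, i < m + 1 → i % (m + 1) = i := fun i hi => Nat.mod_eq_of_lt hi
  rw [Finset.sum_eq_zero] at key
  · rw [Finset.sum_range_succ] at key ⊢
    have e1 : ∀ c ∈ Finset.range m, G c (c + 1) = ind (LeftOf V c (c + 1)) := by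
      intro c hc
      rw [Finset.mem_range] at hc
      simp only [hG]
      rw [mod c (by omega), mod (c + 1) (by omega), min_eq_left (by omega), max_eq_right (by omega)]
    rw [Finset.sum_congr rfl fun c hc => by rw [e1 c hc]] at key
    have hm : m < m + 1 := by omega
    have he : Extr (fun i => (V i).im) m := by
      rw [H.extr_signs hm]
      left
      rw [H.ed_n]
      exact ⟨by simpa using H.ed_last_im, H.ed_zero_im⟩
    have e2 : G m (m + 1) = 1 + ind (LeftOf V m (m + 1)) := by
      rw [← H.leftOf_succ_or hm he]
      simp only [hG]
      rw [mod m hm, Nat.mod_self, min_eq_right (by omega), max_eq_left (by omega)]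
      exact (ind_congr (H.leftOf_n m).1).symm
    rw [e2, ind_true he] at key
    rw [ind_true he]
    linear_combination -key - zmod2_add_self (1 : ZMod 2)
  · intro c hc
    rw [Finset.mem_range] at hc
    refine Finset.sum_eq_zero fun j hj => ?_
    rw [Finset.mem_range] at hj
    by_cases hb : Betw (V (c + 1)).im (V j).im (V (j + 1)).im
    swap
    · rw [ind_false hb, zero_mul]
    rcases H.succ_cases hc with hc' | ⟨-, -, h⟩
    swap
    · rw [h] at hb; exact absurd hb (H.not_betw_bot hj)
    have h1 : j ≠ c := fun h => H.not_betw_self (Or.inl h) hb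
    have h2 : j ≠ c + 1 := fun h => H.not_betw_self (Or.inr h) hb
    rw [show G c j = G (c + 1) j from ?_, zmod2_add_self, mul_zero]
    simp only [hG]
    rw [mod c hc, mod (c + 1) hc', mod j hj]
    rcases (H.betw_iff_hasLeft_or hc' hj h1 h2).1 hb with hl | hl
    · have l := H.leftOf_of_hasLeft hl
      have a1 := H.leftOf_asymm hj hc h1 l.1
      have a2 := H.leftOf_asymm hj hc' h2 l.2
      rcases lt_or_gt_of_ne h1 with h | h
      · rw [min_eq_right (by omega), max_eq_left (by omega), min_eq_right (by omega),
          max_eq_left (by omega), ind_true l.1, ind_true l.2]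
      · rw [min_eq_left (by omega), max_eq_right (by omega), min_eq_left (by omega),
          max_eq_right (by omega), ind_false a1, ind_false a2]
    · have l := H.leftOf_of_hasRight hl
      have a1 := H.leftOf_asymm hc hj h1.symm l.1
      have a2 := H.leftOf_asymm hc' hj h2.symm l.2
      rcases lt_or_gt_of_ne h1 with h | h
      · rw [min_eq_right (by omega), max_eq_left (by omega), min_eq_right (by omega),
          max_eq_left (by omega), ind_false a1, ind_false a2]
      · rw [min_eq_left (by omega), max_eq_right (by omega), min_eq_left (by omega),
          max_eq_right (by omega), ind_true l.1, ind_true l.2]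

/-- A polygon in general position has an odd number of inscribed squares. -/
theorem square_sum : pairSum n (fun i k => pairSum n fun j l => ind (CellSq V i k j l)) = 1 := by
  have hn := H.three
  have e : ∀ c ∈ Finset.range n, ind (Extr (fun i => (V i).im) c) * edgeLabel V c (c + 1) +
      ind (AcuteMin V c) = (ind ((V c).im < (V (c + 1)).im) + ind ((V (c + 1)).im < (V (c + 2)).im)) +
      ind (Extr (fun i => (V i).im) c) * ind (LeftOf V c (c + 1)) := by
    intro c hc
    rw [Finset.mem_range] at hc
    rw [H.extr_label hc, ← ind_ext (fun i => (V i).im) c]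
    by_cases he : Extr (fun i => (V i).im) c
    · rw [H.leftOf_succ_or hc he]; ring
    · rw [ind_false he]; ring
  rw [H.square_count, Finset.sum_add_distrib, Finset.sum_congr rfl fun c hc =>
    H.vertexSum_eq (c := c) (by simpa using hc)]
  have key := height_sum hn H.im_per.1 H.im_per.2 H.im_inj (G := edgeLabel V)
    (edgeLabel_comm V) H.edgeLabel_n
  rw [key, ← Finset.sum_add_distrib, Finset.sum_congr rfl e, Finset.sum_add_distrib,
    H.sum_leftOf_succ, sum_cyclic (f := fun c => ind ((V c).im < (V (c + 1)).im)), zero_add]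
  rw [H.V_n, show n + 1 = 1 + n by omega, H.per]

end Core

/-- A family of linear maps deforming the identity. -/
noncomputable def shr (t : ℝ) (w : ℂ) : ℂ :=
  ((w.re + t * w.im : ℝ) : ℂ) + (((1 + t ^ 2) * w.im : ℝ) : ℂ) * I

@[simp] lemma shr_re (t : ℝ) (w : ℂ) : (shr t w).re = w.re + t * w.im := by
  simp [shr, ← ofReal_pow, ← ofReal_one, ← ofReal_add, ← ofReal_mul]

@[simp] lemma shr_im (t : ℝ) (w : ℂ) : (shr t w).im = (1 + t ^ 2) * w.im := by
  rw [shr]; simp only [add_im, ofReal_im, re_ofReal_mul, im_ofReal_mul, I_im]; ring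

lemma shr_zero (w : ℂ) : shr 0 w = w := by apply Complex.ext <;> simp

lemma shr_add (t : ℝ) (u w : ℂ) : shr t (u + w) = shr t u + shr t w := by
  apply Complex.ext <;> simp <;> ring

lemma shr_sub (t : ℝ) (u w : ℂ) : shr t (u - w) = shr t u - shr t w := by
  apply Complex.ext <;> simp <;> ring

lemma shr_smul (t a : ℝ) (w : ℂ) : shr t (a * w) = a * shr t w := by
  apply Complex.ext <;> simp <;> ring

lemma shr_eq_zero {t : ℝ} {w : ℂ} : shr t w = 0 ↔ w = 0 := by
  constructor
  · intro h
    have h1 := congrArg re h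
    have h2 := congrArg im h
    simp only [shr_re, shr_im, zero_re, zero_im] at h1 h2
    have h3 : w.im = 0 := (mul_eq_zero.1 h2).resolve_left (by positivity)
    rw [h3] at h1
    exact Complex.ext (by simpa using h1) h3
  · rintro rfl; apply Complex.ext <;> simp

lemma shr_inj {t : ℝ} {u w : ℂ} : shr t u = shr t w ↔ u = w := by
  rw [← sub_eq_zero, ← shr_sub, shr_eq_zero, sub_eq_zero]

lemma crs_shr (t : ℝ) (u w : ℂ) : crs (shr t u) (shr t w) = (1 + t ^ 2) * crs u w := by
  simp only [crs, shr_re, shr_im]; ring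

lemma continuous_shr : Continuous fun p : ℝ × ℂ => shr p.1 p.2 := by
  unfold shr
  fun_prop

lemma eventually_shr_ne {w e : ℂ} (hw : w ≠ 0) (he : e ≠ 0) (b : ℝ) :
    ∀ᶠ t in 𝓝[≠] (0 : ℝ), (1 + t ^ 2) * b + dt (shr t w) (shr t e) ≠ 0 := by
  obtain ⟨f, hf⟩ : ∃ f : ℝ → ℝ, f = fun t => (1 + t ^ 2) * b + dt (shr t w) (shr t e) := ⟨_, rfl⟩
  have hft : ∀ t, f t = (1 + t ^ 2) * b + ((w.re + t * w.im) * (e.re + t * e.im) +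
      (1 + t ^ 2) * w.im * ((1 + t ^ 2) * e.im)) := by
    intro t; rw [hf]; simp only [dt, shr_re, shr_im]
  obtain ⟨p, hp⟩ : ∃ p : Polynomial ℝ, ∀ t, p.eval t = f t := by
    refine ⟨(1 + Polynomial.X ^ 2) * Polynomial.C b +
      ((Polynomial.C w.re + Polynomial.X * Polynomial.C w.im) *
        (Polynomial.C e.re + Polynomial.X * Polynomial.C e.im) +
      (1 + Polynomial.X ^ 2) * Polynomial.C w.im * ((1 + Polynomial.X ^ 2) * Polynomial.C e.im)), ?_⟩
    intro t
    rw [hft]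
    simp
    ring
  have hp0 : p ≠ 0 := by
    rintro rfl
    have h : ∀ t, f t = 0 := fun t => by rw [← hp]; simp
    have h0 := h 0
    have h1 := h 1
    have h2 := h (-1)
    have h3 := h 2
    have h4 := h (-2)
    rw [hft] at h0 h1 h2 h3 h4
    have k1 : w.im * e.im = 0 := by linarith
    have k2 : w.re * e.im + w.im * e.re = 0 := by linarith
    have k3 : w.re * e.re = 0 := by linarith
    rcases mul_eq_zero.1 k1 with h | h
    · rw [h, zero_mul, add_zero] at k2
      have : w.re = 0 := by
        by_contra h'
        exact he (Complex.ext ((mul_eq_zero.1 k3).resolve_left h')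
          ((mul_eq_zero.1 k2).resolve_left h'))
      exact hw (Complex.ext this h)
    · rw [h, mul_zero, zero_add] at k2
      have : e.re = 0 := by
        by_contra h'
        exact hw (Complex.ext ((mul_eq_zero.1 k3).resolve_right h')
          ((mul_eq_zero.1 k2).resolve_right h'))
      exact he (Complex.ext this h)
  have hfin : {t | p.eval t = 0}.Finite := Polynomial.finite_setOfPred_isRoot hp0
  have := (hfin.subset (Set.inter_subset_left (t := {0}ᶜ))).isClosed.isOpen_compl.mem_nhds
    (show (0 : ℝ) ∈ ({t | p.eval t = 0} ∩ {0}ᶜ)ᶜ by simp)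
  filter_upwards [nhdsWithin_le_nhds this, self_mem_nhdsWithin] with t h1 h2 h3
  refine h1 ⟨?_, h2⟩
  change p.eval t = 0
  rw [hp, hf]; exact h3

lemma exists_generic {ι : Type*} [Finite ι] (F : ι → ℂ) :
    ∃ c : ℂ, c ≠ 0 ∧ ∀ i, F i ≠ 0 → (c * F i).im ≠ 0 := by
  obtain ⟨s, hs⟩ := (Set.finite_range fun i => (F i).im / (F i).re).exists_notMem
  refine ⟨1 - s * I, ?_, ?_⟩
  · intro h
    have := congrArg re h
    simp at this
  · intro i hi h
    simp only [mul_im, sub_re, sub_im, one_re, one_im, re_ofReal_mul, im_ofReal_mul, I_re, I_im,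
      ofReal_re, ofReal_im] at h
    by_cases hr : (F i).re = 0
    · rw [hr] at h
      exact hi (Complex.ext hr (by simpa using h))
    · apply hs
      refine ⟨i, ?_⟩
      change (F i).im / (F i).re = s
      rw [div_eq_iff hr]
      linarith

section GenericPolygon

/-- No nondegenerate square has its vertices on two lines that are neither parallel nor
perpendicular. -/
lemma not_sqRel_two_lines {a₁ a₃ a₂ a₄ o₁ e₁ o₂ e₂ : ℂ} (h : SqRel a₁ a₃ a₂ a₄) (hne : a₁ ≠ a₃)
    (hc : crs e₁ e₂ ≠ 0) (hd : dt e₁ e₂ ≠ 0)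
    (h₁ : crs (a₁ - o₁) e₁ = 0 ∨ crs (a₁ - o₂) e₂ = 0)
    (h₃ : crs (a₃ - o₁) e₁ = 0 ∨ crs (a₃ - o₂) e₂ = 0)
    (h₂ : crs (a₂ - o₁) e₁ = 0 ∨ crs (a₂ - o₂) e₂ = 0)
    (h₄ : crs (a₄ - o₁) e₁ = 0 ∨ crs (a₄ - o₂) e₂ = 0) : False := by
  obtain ⟨m, hm⟩ : ∃ m : ℂ, m = (a₁ + a₃) / 2 := ⟨_, rfl⟩
  obtain ⟨ε, hε⟩ : ∃ ε : ℂ, ε = (a₄ - a₂) / 2 := ⟨_, rfl⟩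
  obtain ⟨k1, k2⟩ := h
  have e1 : a₁ = m - I * ε := by rw [hm, hε]; linear_combination (-1 / 2 : ℂ) * k1
  have e3 : a₃ = m + I * ε := by rw [hm, hε]; linear_combination (1 / 2 : ℂ) * k1
  have e2 : a₂ = m - ε := by rw [hm, hε]; linear_combination (-1 / 2 : ℂ) * k2
  have e4 : a₄ = m + ε := by rw [hm, hε]; linear_combination (-1 / 2 : ℂ) * k2
  have hε0 : ε ≠ 0 := by
    rintro rfl
    exact hne (by rw [e1, e3]; simp)
  have hN : 0 < ε.re * ε.re + ε.im * ε.im := by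
    have := normSq_pos.2 hε0
    rwa [normSq_apply] at this
  have f1 : ∀ o e : ℂ, crs (a₁ - o) e = crs (m - o) e + dt ε e := by
    intro o e; rw [e1]; simp [crs, dt]; ring
  have f3 : ∀ o e : ℂ, crs (a₃ - o) e = crs (m - o) e - dt ε e := by
    intro o e; rw [e3]; simp [crs, dt]; ring
  have f2 : ∀ o e : ℂ, crs (a₂ - o) e = crs (m - o) e - crs ε e := by
    intro o e; rw [e2]; simp [crs]; ring
  have f4 : ∀ o e : ℂ, crs (a₄ - o) e = crs (m - o) e + crs ε e := by
    intro o e; rw [e4]; simp [crs]; ring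
  rw [f1, f1] at h₁
  rw [f2, f2] at h₂
  rw [f3, f3] at h₃
  rw [f4, f4] at h₄
  have g1 : (ε.re * ε.re + ε.im * ε.im) * dt e₁ e₂ = dt ε e₁ * dt ε e₂ + crs ε e₁ * crs ε e₂ := by
    simp only [crs, dt]; ring
  have g2 : (ε.re * ε.re + ε.im * ε.im) * crs e₁ e₂ = dt ε e₁ * crs ε e₂ - crs ε e₁ * dt ε e₂ := by
    simp only [crs, dt]; ring
  have g : (dt ε e₁ * dt ε e₂ + crs ε e₁ * crs ε e₂) * (dt ε e₁ * crs ε e₂ - crs ε e₁ * dt ε e₂) ≠ 0 := by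
    rw [← g1, ← g2]
    exact mul_ne_zero (mul_ne_zero hN.ne' hd) (mul_ne_zero hN.ne' hc)
  apply g
  generalize dt ε e₁ = T₁ at *
  generalize dt ε e₂ = T₂ at *
  generalize crs ε e₁ = C₁ at *
  generalize crs ε e₂ = C₂ at *
  generalize crs (m - o₁) e₁ = M₁ at *
  generalize crs (m - o₂) e₂ = M₂ at *
  clear * - h₁ h₂ h₃ h₄
  rcases h₁ with h₁ | h₁ <;> rcases h₂ with h₂ | h₂ <;> rcases h₃ with h₃ | h₃ <;>
    rcases h₄ with h₄ | h₄ <;> grind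

variable {n : ℕ}

/-- The point with parameter `x` on the edge `e` of a cyclic polygon. -/
noncomputable def qt (z : ZMod n → ℂ) (e : ZMod n) (x : ℝ) : ℂ := z e + x * (z (e + 1) - z e)

/-- A polygon in the complex plane satisfying the genericity hypotheses on its squares. -/
structure GenPoly (z : ZMod n → ℂ) : Prop where
  three : 3 ≤ n
  simple : ∀ i j, i ≠ j → ∀ x y : ℝ, 0 ≤ x → x ≤ 1 → 0 ≤ y → y ≤ 1 → qt z i x = qt z j y →
    (j = i + 1 ∧ x = 1 ∧ y = 0) ∨ (i = j + 1 ∧ x = 0 ∧ y = 1)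
  crs_ne : ∀ i j, i ≠ j → crs (z (i + 1) - z i) (z (j + 1) - z j) ≠ 0
  gen : ∀ i k j l, ∀ x : Fin 4 → ℝ, (∀ r, 0 ≤ x r ∧ x r ≤ 1) → qt z i (x 0) ≠ qt z k (x 2) →
    SqRel (qt z i (x 0)) (qt z k (x 2)) (qt z j (x 1)) (qt z l (x 3)) →
    (∀ r, 0 < x r ∧ x r < 1) ∧ i ≠ k ∧ i ≠ j ∧ i ≠ l ∧ k ≠ j ∧ k ≠ l ∧ j ≠ l
  fin : {p : ℂ | ∃ i k j l, ∃ x : Fin 4 → ℝ, (∀ r, 0 ≤ x r ∧ x r ≤ 1) ∧ qt z i (x 0) ≠ qt z k (x 2) ∧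
    SqRel (qt z i (x 0)) (qt z k (x 2)) (qt z j (x 1)) (qt z l (x 3)) ∧
    (p = qt z i (x 0) ∨ p = qt z j (x 1) ∨ p = qt z k (x 2) ∨ p = qt z l (x 3))}.Finite

/-- The square equations on a quadruple of edges of the deformed polygon. -/
def SqAt (z : ZMod n → ℂ) (t : ℝ) (i k j l : ZMod n) (x : Fin 4 → ℝ) : Prop :=
  SqRel (shr t (qt z i (x 0))) (shr t (qt z k (x 2))) (shr t (qt z j (x 1))) (shr t (qt z l (x 3)))

/-- There is a square with vertices in the interiors of the given edges of the deformed polygon. -/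
def OpenSq (z : ZMod n → ℂ) (t : ℝ) (i k j l : ZMod n) : Prop :=
  ∃ x : Fin 4 → ℝ, (∀ r, 0 < x r ∧ x r < 1) ∧ qt z i (x 0) ≠ qt z k (x 2) ∧ SqAt z t i k j l x

lemma sqAt_zero {z : ZMod n → ℂ} {i k j l : ZMod n} {x : Fin 4 → ℝ} : SqAt z 0 i k j l x ↔
    SqRel (qt z i (x 0)) (qt z k (x 2)) (qt z j (x 1)) (qt z l (x 3)) := by
  simp only [SqAt, shr_zero]

/-- Unit parameters. -/
def box : Set (Fin 4 → ℝ) := {x | ∀ r, 0 ≤ x r ∧ x r ≤ 1}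

lemma isCompact_box : IsCompact box := by
  have : box = Set.pi Set.univ fun _ => Set.Icc (0 : ℝ) 1 := by
    ext x
    simp only [box, Set.mem_ofPred_eq, Set.mem_pi, Set.mem_univ, forall_true_left, Set.mem_Icc]
  rw [this]
  exact isCompact_univ_pi fun _ => isCompact_Icc

lemma continuous_qt (z : ZMod n → ℂ) (e : ZMod n) (r : Fin 4) :
    Continuous fun p : ℝ × (Fin 4 → ℝ) => shr p.1 (qt z e (p.2 r)) := by
  have : Continuous fun p : ℝ × (Fin 4 → ℝ) => (p.1, qt z e (p.2 r)) := by
    unfold qt; fun_prop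
  exact continuous_shr.comp this

lemma isClosed_sqAt (z : ZMod n → ℂ) (i k j l : ZMod n) :
    IsClosed {p : ℝ × (Fin 4 → ℝ) | SqAt z p.1 i k j l p.2} := by
  have c0 := continuous_qt z i 0
  have c1 := continuous_qt z j 1
  have c2 := continuous_qt z k 2
  have c3 := continuous_qt z l 3
  exact (isClosed_eq (c2.sub c0) (continuous_const.mul (c3.sub c1))).inter
    (isClosed_eq (c0.add c2) (c1.add c3))

lemma eventually_not_sqAt (z : ZMod n → ℂ) (i k j l : ZMod n) {C : Set (Fin 4 → ℝ)}
    (hC : IsCompact C) (h : ∀ x ∈ C, ¬ SqAt z 0 i k j l x) :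
    ∀ᶠ t in 𝓝 (0 : ℝ), ∀ x ∈ C, ¬ SqAt z t i k j l x := by
  apply hC.eventually_forall_of_forall_eventually
  intro x hx
  have := (isClosed_sqAt z i k j l).isOpen_compl.mem_nhds (show (0, x) ∈ _ from h x hx)
  exact this

namespace GenPoly

variable {z : ZMod n → ℂ} (H : GenPoly z)

include H

lemma ed_ne (i : ZMod n) : z (i + 1) - z i ≠ 0 := by
  have : Fact (1 < n) := ⟨by have := H.three; omega⟩
  intro h
  apply H.crs_ne i (i + 1) (by simp)
  rw [h]; simp [crs]

lemma qt_inj {i : ZMod n} {x y : ℝ} (h : qt z i x = qt z i y) : x = y := by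
  have : ((x - y : ℝ) : ℂ) * (z (i + 1) - z i) = 0 := by
    simp only [qt] at h; push_cast; linear_combination h
  have := (mul_eq_zero.1 this).resolve_right (H.ed_ne i)
  exact sub_eq_zero.1 (ofReal_eq_zero.1 this)

lemma not_three {i j k : ZMod n} (hij : i ≠ j) (hik : i ≠ k) (hjk : j ≠ k) {x y w : ℝ}
    (hx : 0 ≤ x ∧ x ≤ 1) (hy : 0 ≤ y ∧ y ≤ 1) (hw : 0 ≤ w ∧ w ≤ 1)
    (h : qt z i x = qt z j y) (h' : qt z i x = qt z k w) : False := by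
  rcases H.simple i j hij x y hx.1 hx.2 hy.1 hy.2 h with ⟨a, b, -⟩ | ⟨a, b, -⟩ <;>
    rcases H.simple i k hik x w hx.1 hx.2 hw.1 hw.2 h' with ⟨a', b', -⟩ | ⟨a', b', -⟩
  · exact hjk (a.trans a'.symm)
  · linarith
  · linarith
  · exact hjk (add_right_cancel (a.symm.trans a'))

lemma no_square_of_pair {t : ℝ} (hdt : ∀ i j, dt (shr t (z (i + 1) - z i)) (shr t (z (j + 1) - z j)) ≠ 0)
    {i k j l c d : ZMod n} (hcd : c ≠ d) (hi : i = c ∨ i = d) (hk : k = c ∨ k = d)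
    (hj : j = c ∨ j = d) (hl : l = c ∨ l = d) {x : Fin 4 → ℝ} (hne : qt z i (x 0) ≠ qt z k (x 2)) :
    ¬ SqAt z t i k j l x := by
  intro hs
  have key : ∀ (i : ZMod n) (y : ℝ), i = c ∨ i = d →
      crs (shr t (qt z i y) - shr t (z c)) (shr t (z (c + 1) - z c)) = 0 ∨
      crs (shr t (qt z i y) - shr t (z d)) (shr t (z (d + 1) - z d)) = 0 := by
    intro i y h
    have : ∀ c, crs (shr t (qt z c y) - shr t (z c)) (shr t (z (c + 1) - z c)) = 0 := by
      intro c
      rw [← shr_sub, crs_shr]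
      simp only [qt, crs, add_sub_cancel_left, re_ofReal_mul, im_ofReal_mul]; ring
    rcases h with rfl | rfl
    · exact Or.inl (this _)
    · exact Or.inr (this _)
  refine not_sqRel_two_lines hs (fun h => hne (shr_inj.1 h)) ?_ (hdt c d) (key i _ hi) (key k _ hk)
    (key j _ hj) (key l _ hl)
  rw [crs_shr]
  exact mul_ne_zero (by positivity) (H.crs_ne c d hcd)

/-- Degenerate squares only occur on at most two edges. -/
lemma pair_of_degenerate {i k j l : ZMod n} {x : Fin 4 → ℝ} (hx : x ∈ box) (h : SqAt z 0 i k j l x)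
    (he : qt z i (x 0) = qt z k (x 2)) :
    ∃ c d, c ≠ d ∧ (i = c ∨ i = d) ∧ (k = c ∨ k = d) ∧ (j = c ∨ j = d) ∧ (l = c ∨ l = d) := by
  have : Fact (1 < n) := ⟨by have := H.three; omega⟩
  rw [sqAt_zero] at h
  obtain ⟨h1, h2⟩ := h
  rw [he, sub_self] at h1
  have h3 : qt z l (x 3) = qt z j (x 1) :=
    sub_eq_zero.1 ((mul_eq_zero.1 h1.symm).resolve_left I_ne_zero)
  rw [he, h3] at h2
  have h4 : qt z k (x 2) = qt z j (x 1) := by linear_combination h2 / 2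
  obtain ⟨p, hp⟩ : ∃ p, p = qt z i (x 0) := ⟨_, rfl⟩
  have P : ∀ m ∈ ({i, k, j, l} : Set (ZMod n)), ∃ y : ℝ, (0 ≤ y ∧ y ≤ 1) ∧ p = qt z m y := by
    rintro m (rfl | rfl | rfl | rfl)
    · exact ⟨_, hx 0, hp⟩
    · exact ⟨_, hx 2, hp.trans he⟩
    · exact ⟨_, hx 1, hp.trans (he.trans h4)⟩
    · exact ⟨_, hx 3, hp.trans (he.trans (h4.trans h3.symm))⟩
  have T : ∀ a ∈ ({i, k, j, l} : Set (ZMod n)), ∀ b ∈ ({i, k, j, l} : Set (ZMod n)),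
      ∀ c ∈ ({i, k, j, l} : Set (ZMod n)), a = b ∨ a = c ∨ b = c := by
    intro a ha b hb c hc
    by_contra hh
    push Not at hh
    obtain ⟨ya, a1, a2⟩ := P a ha
    obtain ⟨yb, b1, b2⟩ := P b hb
    obtain ⟨yc, c1, c2⟩ := P c hc
    exact H.not_three hh.1 hh.2.1 hh.2.2 a1 b1 c1 (a2.symm.trans b2) (a2.symm.trans c2)
  have mi : i ∈ ({i, k, j, l} : Set (ZMod n)) := by simp
  have mk : k ∈ ({i, k, j, l} : Set (ZMod n)) := by simp
  have mj : j ∈ ({i, k, j, l} : Set (ZMod n)) := by simp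
  have ml : l ∈ ({i, k, j, l} : Set (ZMod n)) := by simp
  by_cases hk : k = i
  · by_cases hj : j = i
    · by_cases hl : l = i
      · exact ⟨i, i + 1, by simp, by simp, by simp [hk], by simp [hj], by simp [hl]⟩
      · exact ⟨i, l, Ne.symm hl, by simp, by simp [hk], by simp [hj], by simp⟩
    · refine ⟨i, j, Ne.symm hj, by simp, by simp [hk], by simp, ?_⟩
      rcases T i mi j mj l ml with h | h | h
      · exact absurd h.symm hj
      · exact Or.inl h.symm
      · exact Or.inr h.symm
  · refine ⟨i, k, Ne.symm hk, by simp, by simp, ?_, ?_⟩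
    · rcases T i mi k mk j mj with h | h | h
      · exact absurd h.symm hk
      · exact Or.inl h.symm
      · exact Or.inr h.symm
    · rcases T i mi k mk l ml with h | h | h
      · exact absurd h.symm hk
      · exact Or.inl h.symm
      · exact Or.inr h.symm

lemma eventually_dt_ne [NeZero n] : ∀ᶠ t in 𝓝[≠] (0 : ℝ),
    ∀ i j, dt (shr t (z (i + 1) - z i)) (shr t (z (j + 1) - z j)) ≠ 0 := by
  simp only [eventually_all]
  intro i j
  simpa using eventually_shr_ne (H.ed_ne i) (H.ed_ne j) 0

/-- Squares with a vertex at a vertex of the polygon do not appear under small deformations. -/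
lemma eventually_no_vertex [NeZero n] : ∀ᶠ t in 𝓝[≠] (0 : ℝ), ∀ i k j l, ∀ x ∈ box, ∀ r, IsEnd (x r) →
    qt z i (x 0) ≠ qt z k (x 2) → ¬ SqAt z t i k j l x := by
  simp only [eventually_all]
  intro i k j l
  by_cases hp : ∃ c d, c ≠ d ∧ (i = c ∨ i = d) ∧ (k = c ∨ k = d) ∧ (j = c ∨ j = d) ∧ (l = c ∨ l = d)
  · obtain ⟨c, d, h0, h1, h2, h3, h4⟩ := hp
    filter_upwards [H.eventually_dt_ne] with t ht x _ r _ hne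
    exact H.no_square_of_pair ht h0 h1 h2 h3 h4 hne
  · have hC : IsCompact (box ∩ ⋃ r, {x : Fin 4 → ℝ | IsEnd (x r)}) := by
      apply isCompact_box.inter_right
      refine isClosed_iUnion_of_finite fun r => ?_
      exact (isClosed_eq (continuous_apply r) continuous_const).union
        (isClosed_eq (continuous_apply r) continuous_const)
    have := eventually_not_sqAt z i k j l hC (by
      rintro x ⟨hx, hx'⟩ hs
      obtain ⟨r, hr⟩ := Set.mem_iUnion.1 hx'
      have hne : qt z i (x 0) ≠ qt z k (x 2) := fun h => hp (H.pair_of_degenerate hx hs h)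
      have := (H.gen i k j l x hx hne (sqAt_zero.1 hs)).1 r
      rcases hr with h | h <;> rw [h] at this
      · exact lt_irrefl _ this.1
      · exact lt_irrefl _ this.2)
    filter_upwards [nhdsWithin_le_nhds this] with t ht x hx r hr _
    exact ht x ⟨hx, Set.mem_iUnion.2 ⟨r, hr⟩⟩

/-- Squares do not appear under small deformations. -/
lemma eventually_openSq_imp [NeZero n] : ∀ᶠ t in 𝓝[≠] (0 : ℝ), ∀ i k j l,
    OpenSq z t i k j l → OpenSq z 0 i k j l := by
  simp only [eventually_all]
  intro i k j l
  by_cases h0 : OpenSq z 0 i k j l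
  · exact Eventually.of_forall fun _ _ => h0
  by_cases hp : ∃ c d, c ≠ d ∧ (i = c ∨ i = d) ∧ (k = c ∨ k = d) ∧ (j = c ∨ j = d) ∧ (l = c ∨ l = d)
  · obtain ⟨c, d, h0, h1, h2, h3, h4⟩ := hp
    filter_upwards [H.eventually_dt_ne] with t ht
    rintro ⟨x, -, hne, hs⟩
    exact absurd hs (H.no_square_of_pair ht h0 h1 h2 h3 h4 hne)
  · have := eventually_not_sqAt z i k j l isCompact_box (by
      intro x hx hs
      have hne : qt z i (x 0) ≠ qt z k (x 2) := fun h => hp (H.pair_of_degenerate hx hs h)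
      exact h0 ⟨x, (H.gen i k j l x hx hne (sqAt_zero.1 hs)).1, hne, hs⟩)
    filter_upwards [nhdsWithin_le_nhds this] with t ht
    rintro ⟨x, hx, -, hs⟩
    exact absurd hs (ht x fun r => ⟨(hx r).1.le, (hx r).2.le⟩)

end GenPoly

end GenericPolygon

section SquareSystem

variable {n : ℕ} (z : ZMod n → ℂ) (i k j l : ZMod n)

/-- The matrix of the square equations. -/
noncomputable def sqMat (e₀ e₁ e₂ e₃ : ℂ) : Matrix (Fin 4) (Fin 4) ℝ :=
  !![-e₀.re, -e₁.im, e₂.re, e₃.im;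
     -e₀.im, e₁.re, e₂.im, -e₃.re;
     e₀.re, -e₁.re, e₂.re, -e₃.re;
     e₀.im, -e₁.im, e₂.im, -e₃.im]

/-- The defect of the square equations. -/
noncomputable def sqRes (a₁ a₃ a₂ a₄ : ℂ) : Fin 4 → ℝ :=
  ![(a₃ - a₁ - I * (a₄ - a₂)).re, (a₃ - a₁ - I * (a₄ - a₂)).im,
    (a₁ + a₃ - (a₂ + a₄)).re, (a₁ + a₃ - (a₂ + a₄)).im]

lemma sqRes_eq_zero {a₁ a₃ a₂ a₄ : ℂ} : sqRes a₁ a₃ a₂ a₄ = 0 ↔ SqRel a₁ a₃ a₂ a₄ := by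
  rw [SqRel, ← sub_eq_zero, ← sub_eq_zero (a := a₁ + a₃), Complex.ext_iff, Complex.ext_iff,
    funext_iff]
  simp [sqRes, Fin.forall_fin_succ, and_assoc, sub_eq_zero]

lemma sqRes_add (a₁ a₃ a₂ a₄ e₀ e₁ e₂ e₃ : ℂ) (w : Fin 4 → ℝ) :
    sqRes (a₁ + w 0 * e₀) (a₃ + w 2 * e₂) (a₂ + w 1 * e₁) (a₄ + w 3 * e₃) =
      sqRes a₁ a₃ a₂ a₄ + (sqMat e₀ e₁ e₂ e₃).mulVec w := by
  funext r
  fin_cases r <;> simp [sqRes, sqMat, Matrix.mulVec, dotProduct, Fin.sum_univ_four] <;> ring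

lemma qt_add (e : ZMod n) (x y : ℝ) : qt z e (x + y) = qt z e x + y * (z (e + 1) - z e) := by
  simp only [qt]; push_cast; ring

lemma sqAt_iff (t : ℝ) (x : Fin 4 → ℝ) : SqAt z t i k j l x ↔
    sqRes (shr t (qt z i (x 0))) (shr t (qt z k (x 2))) (shr t (qt z j (x 1))) (shr t (qt z l (x 3)))
      = 0 := by
  rw [sqRes_eq_zero, SqAt]

lemma sqAt_add (t : ℝ) (x w : Fin 4 → ℝ) : SqAt z t i k j l (x + w) ↔
    sqRes (shr t (qt z i (x 0))) (shr t (qt z k (x 2))) (shr t (qt z j (x 1))) (shr t (qt z l (x 3))) +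
      (sqMat (shr t (z (i + 1) - z i)) (shr t (z (j + 1) - z j)) (shr t (z (k + 1) - z k))
        (shr t (z (l + 1) - z l))).mulVec w = 0 := by
  rw [sqAt_iff, ← sqRes_add]
  simp only [Pi.add_apply, qt_add, shr_add, shr_smul]

end SquareSystem

namespace GenPoly

variable {n : ℕ} {z : ZMod n → ℂ} (H : GenPoly z)

include H

lemma det_ne {i k j l : ZMod n} {x : Fin 4 → ℝ} (hx : ∀ r, 0 < x r ∧ x r < 1)
    (hne : qt z i (x 0) ≠ qt z k (x 2)) (hs : SqAt z 0 i k j l x) :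
    (sqMat (shr 0 (z (i + 1) - z i)) (shr 0 (z (j + 1) - z j)) (shr 0 (z (k + 1) - z k))
        (shr 0 (z (l + 1) - z l))).det ≠ 0 := by
  intro hdet
  obtain ⟨w, hw0, hw⟩ := Matrix.exists_mulVec_eq_zero_iff.2 hdet
  have hsol : ∀ s : ℝ, SqAt z 0 i k j l (x + s • w) := by
    intro s
    rw [sqAt_add, Matrix.mulVec_smul, hw, smul_zero, add_zero]
    exact (sqAt_iff _ _ _ _ _ _ _).1 hs
  have hc : ∀ r, Continuous fun s : ℝ => (x + s • w) r := by
    intro r; simp only [Pi.add_apply, Pi.smul_apply, smul_eq_mul]; fun_prop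
  have hbox : ∀ᶠ s in 𝓝 (0 : ℝ), ∀ r, 0 < (x + s • w) r ∧ (x + s • w) r < 1 := by
    rw [eventually_all]
    intro r
    have h := hx r
    have h0 : Tendsto (fun s : ℝ => (x + s • w) r) (𝓝 0) (𝓝 (x r)) := by
      simpa using (hc r).tendsto 0
    exact (h0.eventually (lt_mem_nhds h.1)).and (h0.eventually (gt_mem_nhds h.2))
  have hq : ∀ (e : ZMod n) (r : Fin 4), Continuous fun s : ℝ => qt z e ((x + s • w) r) := by
    intro e r
    have := hc r
    unfold qt
    fun_prop
  have hnd : ∀ᶠ s in 𝓝 (0 : ℝ), qt z i ((x + s • w) 0) ≠ qt z k ((x + s • w) 2) := by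
    have := ((isClosed_eq (hq i 0) (hq k 2)).isOpen_compl).mem_nhds
      (show (0 : ℝ) ∈ {s : ℝ | qt z i ((x + s • w) 0) = qt z k ((x + s • w) 2)}ᶜ by simpa using hne)
    exact this
  obtain ⟨r, hr⟩ := Function.ne_iff.1 hw0
  have hinf : {s : ℝ | (∀ r, 0 < (x + s • w) r ∧ (x + s • w) r < 1) ∧
      qt z i ((x + s • w) 0) ≠ qt z k ((x + s • w) 2)}.Infinite :=
    infinite_of_mem_nhds (0 : ℝ) (hbox.and hnd)
  have hinj : ∀ (e : ZMod n), Function.Injective fun s : ℝ => qt z e ((x + s • w) r) := by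
    intro e s s' hss
    have := H.qt_inj hss
    simp only [Pi.add_apply, Pi.smul_apply, smul_eq_mul, add_right_inj] at this
    exact mul_right_cancel₀ hr this
  have hfin := fun (e : ZMod n) => hinf.image ((hinj e).injOn)
  fin_cases r
  · refine hfin i (H.fin.subset ?_)
    rintro _ ⟨s, ⟨h1, h2⟩, rfl⟩
    exact ⟨i, k, j, l, _, fun r => ⟨(h1 r).1.le, (h1 r).2.le⟩, h2, sqAt_zero.1 (hsol s), Or.inl rfl⟩
  · refine hfin j (H.fin.subset ?_)
    rintro _ ⟨s, ⟨h1, h2⟩, rfl⟩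
    exact ⟨i, k, j, l, _, fun r => ⟨(h1 r).1.le, (h1 r).2.le⟩, h2, sqAt_zero.1 (hsol s),
      Or.inr (Or.inl rfl)⟩
  · refine hfin k (H.fin.subset ?_)
    rintro _ ⟨s, ⟨h1, h2⟩, rfl⟩
    exact ⟨i, k, j, l, _, fun r => ⟨(h1 r).1.le, (h1 r).2.le⟩, h2, sqAt_zero.1 (hsol s),
      Or.inr (Or.inr (Or.inl rfl))⟩
  · refine hfin l (H.fin.subset ?_)
    rintro _ ⟨s, ⟨h1, h2⟩, rfl⟩
    exact ⟨i, k, j, l, _, fun r => ⟨(h1 r).1.le, (h1 r).2.le⟩, h2, sqAt_zero.1 (hsol s),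
      Or.inr (Or.inr (Or.inr rfl))⟩

/-- Squares persist under small deformations. -/
lemma eventually_openSq [NeZero n] : ∀ᶠ t in 𝓝 (0 : ℝ), ∀ i k j l,
    OpenSq z 0 i k j l → OpenSq z t i k j l := by
  simp only [eventually_all]
  rintro i k j l h
  obtain ⟨x, hx, hne, hs⟩ := h
  have hdet := H.det_ne hx hne hs
  obtain ⟨M, hM⟩ : ∃ M : ℝ → Matrix (Fin 4) (Fin 4) ℝ, M = fun t =>
    sqMat (shr t (z (i + 1) - z i)) (shr t (z (j + 1) - z j)) (shr t (z (k + 1) - z k))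
        (shr t (z (l + 1) - z l)) := ⟨_, rfl⟩
  obtain ⟨R, hR⟩ : ∃ R : ℝ → Fin 4 → ℝ, R = fun t => sqRes (shr t (qt z i (x 0)))
    (shr t (qt z k (x 2))) (shr t (qt z j (x 1))) (shr t (qt z l (x 3))) := ⟨_, rfl⟩
  have cM : Continuous M := by
    rw [hM]
    refine continuous_matrix fun a b => ?_
    fin_cases a <;> fin_cases b <;> simp [sqMat] <;> fun_prop
  have cR : Continuous R := by
    rw [hR]
    refine continuous_pi fun a => ?_
    fin_cases a <;> simp [sqRes] <;> fun_prop
  have hR0 : R 0 = 0 := by rw [hR]; exact (sqAt_iff _ _ _ _ _ _ _).1 hs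
  have hM0 : (M 0).det ≠ 0 := by rw [hM]; exact hdet
  obtain ⟨y, hy⟩ : ∃ y : ℝ → Fin 4 → ℝ, y = fun t =>
    (M t).det⁻¹ • ((M t).adjugate.mulVec (-R t)) := ⟨_, rfl⟩
  have cy : ContinuousAt y 0 := by
    rw [hy]
    refine ContinuousAt.smul (cM.matrix_det.continuousAt.inv₀ hM0) ?_
    exact (cM.matrix_adjugate.matrix_mulVec cR.neg).continuousAt
  have hy0 : y 0 = 0 := by rw [hy]; simp [hR0]
  have hsol : ∀ t, (M t).det ≠ 0 → SqAt z t i k j l (x + y t) := by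
    intro t ht
    rw [sqAt_add]
    have : (M t).mulVec (y t) = -R t := by
      rw [hy]
      simp only
      rw [Matrix.mulVec_smul, Matrix.mulVec_mulVec, Matrix.mul_adjugate, Matrix.smul_mulVec,
        Matrix.one_mulVec, smul_smul, inv_mul_cancel₀ ht, one_smul]
    rw [hM, hR] at this
    simp only at this
    rw [this, add_neg_cancel]
  have hxy : Tendsto (fun t => x + y t) (𝓝 0) (𝓝 x) := by
    have := (continuousAt_const (y := x)).add cy
    rw [ContinuousAt, Pi.add_apply, hy0, add_zero] at this
    exact this
  have hxr : ∀ r, Tendsto (fun t => (x + y t) r) (𝓝 0) (𝓝 (x r)) := fun r => tendsto_pi_nhds.1 hxy r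
  have hbox : ∀ᶠ t in 𝓝 (0 : ℝ), ∀ r, 0 < (x + y t) r ∧ (x + y t) r < 1 := by
    rw [eventually_all]
    intro r
    have h := hx r
    exact ((hxr r).eventually (lt_mem_nhds h.1)).and ((hxr r).eventually (gt_mem_nhds h.2))
  have hnd : ∀ᶠ t in 𝓝 (0 : ℝ), qt z i ((x + y t) 0) ≠ qt z k ((x + y t) 2) := by
    have hq : ∀ (e : ZMod n) (r : Fin 4), Tendsto (fun t => qt z e ((x + y t) r)) (𝓝 0)
        (𝓝 (qt z e (x r))) := by
      intro e r
      have : Continuous (qt z e) := by unfold qt; fun_prop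
      exact (this.tendsto _).comp (hxr r)
    exact (((hq i 0).sub (hq k 2)).eventually_ne (sub_ne_zero.2 hne)).mono fun t => sub_ne_zero.1
  filter_upwards [hbox, hnd, cM.matrix_det.continuousAt.eventually_ne hM0] with t h1 h2 h3
  exact ⟨x + y t, h1, h2, hsol t h3⟩

end GenPoly

lemma real_smul_eq {u v : ℂ} (h : crs u v ≠ 0) {a b : ℝ} (e : (a : ℂ) * u = b * v) :
    a = 0 ∧ b = 0 := by
  have h1 := congrArg re e
  have h2 := congrArg im e
  simp only [re_ofReal_mul, im_ofReal_mul] at h1 h2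
  constructor
  · have : a * crs u v = 0 := by simp only [crs]; linear_combination v.im * h1 - v.re * h2
    exact (mul_eq_zero.1 this).resolve_right h
  · have : b * crs u v = 0 := by simp only [crs]; linear_combination u.im * h1 - u.re * h2
    exact (mul_eq_zero.1 this).resolve_right h

lemma semi_square_unique {E₀ E₁ E₂ E₃ : ℂ} (h01 : dt E₀ E₁ ≠ 0) (h03 : dt E₀ E₃ ≠ 0)
    (h21 : dt E₂ E₁ ≠ 0) (h23 : dt E₂ E₃ ≠ 0) {y : Fin 4 → ℝ}
    (hy : y 2 * E₂ - y 0 * E₀ = I * (y 3 * E₃ - y 1 * E₁)) {r s : Fin 4} (hrs : r ≠ s)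
    (hr : y r = 0) (hs : y s = 0) (hcd : (r = 0 ∧ s = 2) ∨ (r = 2 ∧ s = 0) → crs E₁ E₃ ≠ 0)
    (hab : (r = 1 ∧ s = 3) ∨ (r = 3 ∧ s = 1) → crs E₀ E₂ ≠ 0) : ∀ q, y q = 0 := by
  have A : y 0 = 0 → y 2 = 0 → crs E₁ E₃ ≠ 0 → ∀ q, y q = 0 := by
    intro h0 h2 hc
    rw [h0, h2] at hy
    have : (y 1 : ℂ) * E₁ = y 3 * E₃ := by
      have := hy.symm
      simp at this
      linear_combination -this
    obtain ⟨h1, h3⟩ := real_smul_eq hc this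
    simp [Fin.forall_fin_succ, h0, h1, h2, h3]
  have B : y 1 = 0 → y 3 = 0 → crs E₀ E₂ ≠ 0 → ∀ q, y q = 0 := by
    intro h1 h3 hc
    rw [h1, h3] at hy
    have : (y 0 : ℂ) * E₀ = y 2 * E₂ := by
      simp at hy
      linear_combination -hy
    obtain ⟨h0, h2⟩ := real_smul_eq hc this
    simp [Fin.forall_fin_succ, h0, h1, h2, h3]
  have C : y 0 = 0 → y 1 = 0 → ∀ q, y q = 0 := by
    intro h0 h1
    rw [h0, h1] at hy
    obtain ⟨h2, h3⟩ := real_smul_eq (u := E₂) (v := I * E₃) (a := y 2) (b := y 3)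
      (by rwa [crs_I_mul]) (by simp at hy; linear_combination hy)
    simp [Fin.forall_fin_succ, h0, h1, h2, h3]
  have D : y 0 = 0 → y 3 = 0 → ∀ q, y q = 0 := by
    intro h0 h1
    rw [h0, h1] at hy
    obtain ⟨h2, h3⟩ := real_smul_eq (u := E₂) (v := I * E₁) (a := y 2) (b := -y 1)
      (by rwa [crs_I_mul]) (by push_cast; simp at hy; linear_combination hy)
    simp [Fin.forall_fin_succ, h0, h1, h2, neg_eq_zero.1 h3]
  have E : y 2 = 0 → y 1 = 0 → ∀ q, y q = 0 := by
    intro h0 h1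
    rw [h0, h1] at hy
    obtain ⟨h2, h3⟩ := real_smul_eq (u := E₀) (v := I * E₃) (a := -y 0) (b := y 3)
      (by rwa [crs_I_mul]) (by push_cast; simp at hy; linear_combination hy)
    simp [Fin.forall_fin_succ, h0, h1, neg_eq_zero.1 h2, h3]
  have F : y 2 = 0 → y 3 = 0 → ∀ q, y q = 0 := by
    intro h0 h1
    rw [h0, h1] at hy
    obtain ⟨h2, h3⟩ := real_smul_eq (u := E₀) (v := I * E₁) (a := -y 0) (b := -y 1)
      (by rwa [crs_I_mul]) (by push_cast; simp at hy; linear_combination -hy)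
    simp [Fin.forall_fin_succ, h0, h1, neg_eq_zero.1 h2, neg_eq_zero.1 h3]
  fin_cases r <;> fin_cases s <;> first
    | exact absurd rfl hrs
    | exact A hr hs (hcd (by decide))
    | exact A hs hr (hcd (by decide))
    | exact B hr hs (hab (by decide))
    | exact B hs hr (hab (by decide))
    | exact C hr hs
    | exact C hs hr
    | exact D hr hs
    | exact D hs hr
    | exact E hr hs
    | exact E hs hr
    | exact F hr hs
    | exact F hs hr

lemma finite_of_subsingleton {ι : Type*} [Finite ι] (P : ι → ℂ → Prop)
    (h : ∀ i a b, P i a → P i b → a = b) : {a | ∃ i, P i a}.Finite := by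
  have : {a | ∃ i, P i a} = ⋃ i, {a | P i a} := by ext; simp
  rw [this]
  exact Set.finite_iUnion fun i => Set.Subsingleton.finite fun a ha b hb => h i a b ha hb

/-- A vector along the bisector of an angle. -/
noncomputable def bis (f g : ℂ) : ℂ := ((|crs f g| - dt f g : ℝ) : ℂ) * f - normSq f * g

lemma bis_ne_zero {f g : ℂ} (h : crs f g ≠ 0) : bis f g ≠ 0 := by
  intro h0
  have hf : f ≠ 0 := by rintro rfl; simp [crs] at h
  have := real_smul_eq h (sub_eq_zero.1 h0)
  exact hf (normSq_eq_zero.1 this.2)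

lemma crs_mul (c f g : ℂ) : crs (c * f) (c * g) = normSq c * crs f g := by
  simp only [crs, normSq_apply, mul_re, mul_im]; ring

lemma dt_mul (c f g : ℂ) : dt (c * f) (c * g) = normSq c * dt f g := by
  simp only [dt, normSq_apply, mul_re, mul_im]; ring

lemma bis_mul (c f g : ℂ) : bis (c * f) (c * g) = normSq c * (c * bis f g) := by
  rw [bis, bis, crs_mul, dt_mul, normSq_mul, abs_mul, abs_of_nonneg (normSq_nonneg c)]
  push_cast; ring

section Tame

variable {n : ℕ}

/-- The deformation parameter `t` makes the polygon generic, up to rotation. -/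
structure TameAt (z : ZMod n → ℂ) (t : ℝ) : Prop where
  dist : ∀ a b c m, a ≠ b → (1 + t ^ 2) * crs (z m - z c) (z (m + 1) - z m) +
    dt (shr t (z a - z b)) (shr t (z (m + 1) - z m)) ≠ 0
  no_vertex : ∀ i k j l, ∀ x ∈ box, ∀ r, IsEnd (x r) →
    qt z i (x 0) ≠ qt z k (x 2) → ¬ SqAt z t i k j l x

/-- The rotation `c` puts the deformed polygon in general position with respect to horizontals. -/
structure GoodRot (z : ZMod n → ℂ) (t : ℝ) (c : ℂ) : Prop where
  ne : c ≠ 0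
  vertex : ∀ a b, a ≠ b → (c * (shr t (z a) - shr t (z b))).im ≠ 0
  two_vertices : ∀ i k j l, ∀ x ∈ box, qt z i (x 0) ≠ qt z k (x 2) →
    shr t (qt z k (x 2)) - shr t (qt z i (x 0)) =
      I * (shr t (qt z l (x 3)) - shr t (qt z j (x 1))) → ∀ r s, r ≠ s → IsEnd (x r) → IsEnd (x s) →
    (c * (shr t (qt z i (x 0)) + shr t (qt z k (x 2)) - shr t (qt z j (x 1)) -
      shr t (qt z l (x 3)))).im ≠ 0
  transverse : ∀ i k l, ∀ a b : ℝ, a * shr t (z (k + 1) - z k) - shr t (z (i + 1) - z i) =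
    I * (b * shr t (z (l + 1) - z l)) → (c * (shr t (z (i + 1) - z i) + a * shr t (z (k + 1) - z k) -
      b * shr t (z (l + 1) - z l))).im ≠ 0
  bis_fst : ∀ s, (c * bis (shr t (z (s + 1) - z s)) (-shr t (z s - z (s - 1)))).im ≠ 0
  bis_snd : ∀ s, (c * bis (-shr t (z s - z (s - 1))) (shr t (z (s + 1) - z s))).im ≠ 0

end Tame

namespace GenPoly

variable {n : ℕ} {z : ZMod n → ℂ} (H : GenPoly z)

include H

lemma vertex_ne {a b : ZMod n} (h : a ≠ b) : z a ≠ z b := by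
  intro h'
  rcases H.simple a b h 0 0 le_rfl zero_le_one le_rfl zero_le_one (by simpa [qt] using h') with
    ⟨-, h, -⟩ | ⟨-, -, h⟩ <;> norm_num at h

lemma eventually_tameAt [NeZero n] : ∀ᶠ t in 𝓝[≠] (0 : ℝ), TameAt z t := by
  have : ∀ᶠ t in 𝓝[≠] (0 : ℝ), ∀ a b c m, a ≠ b → (1 + t ^ 2) * crs (z m - z c) (z (m + 1) - z m) +
    dt (shr t (z a - z b)) (shr t (z (m + 1) - z m)) ≠ 0 := by
    simp only [eventually_all]
    intro a b c m hab
    exact eventually_shr_ne (sub_ne_zero.2 (H.vertex_ne hab)) (H.ed_ne m) _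
  filter_upwards [this, H.eventually_no_vertex] with t h1 h2 using ⟨h1, h2⟩

variable {t : ℝ} (T : TameAt z t)

include T

lemma dt_vertex_ne {a b : ZMod n} (h : a ≠ b) (m : ZMod n) :
    dt (shr t (z a) - shr t (z b)) (shr t (z (m + 1) - z m)) ≠ 0 := by
  have := T.dist a b m m h
  rw [sub_self] at this
  rw [← shr_sub]
  simpa [crs] using this

lemma dt_ed_ne (i j : ZMod n) : dt (shr t (z (i + 1) - z i)) (shr t (z (j + 1) - z j)) ≠ 0 := by
  have : Fact (1 < n) := ⟨by have := H.three; omega⟩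
  rw [shr_sub t (z (i + 1))]
  exact H.dt_vertex_ne T (by simp) j

lemma crs_ed_ne {i j : ZMod n} (h : i ≠ j) :
    crs (shr t (z (i + 1) - z i)) (shr t (z (j + 1) - z j)) ≠ 0 := by
  rw [crs_shr]
  exact mul_ne_zero (by positivity) (H.crs_ne i j h)

omit H T in
lemma qt_end (e : ZMod n) {x : ℝ} (h : IsEnd x) : ∃ a, qt z e x = z a := by
  rcases h with rfl | rfl
  · exact ⟨e, by simp [qt]⟩
  · exact ⟨e + 1, by simp [qt]⟩

omit H T in
lemma shr_qt (e : ZMod n) (x : ℝ) : shr t (qt z e x) = shr t (z e) + x * shr t (z (e + 1) - z e) := by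
  rw [qt, shr_add, shr_smul]

lemma two_vertices_unique {i k j l : ZMod n} {x x' : Fin 4 → ℝ}
    (hne : qt z i (x 0) ≠ qt z k (x 2))
    (e : shr t (qt z k (x 2)) - shr t (qt z i (x 0)) =
      I * (shr t (qt z l (x 3)) - shr t (qt z j (x 1))))
    (e' : shr t (qt z k (x' 2)) - shr t (qt z i (x' 0)) =
      I * (shr t (qt z l (x' 3)) - shr t (qt z j (x' 1)))) {r s : Fin 4} (hrs : r ≠ s)
    (hr : IsEnd (x r)) (hs : IsEnd (x s)) (hr' : x r = x' r) (hs' : x s = x' s) : x = x' := by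
  have hjl : IsEnd (x 0) → IsEnd (x 2) → j ≠ l := by
    rintro h0 h2 rfl
    obtain ⟨a, ha⟩ := qt_end (z := z) i h0
    obtain ⟨b, hb⟩ := qt_end (z := z) k h2
    rw [ha, hb] at hne e
    apply H.dt_vertex_ne T (a := b) (b := a) (fun h => hne (by rw [h])) j
    rw [e, shr_qt, shr_qt]
    simp only [dt, mul_re, mul_im, add_re, add_im, sub_re, sub_im, I_re, I_im, ofReal_re, ofReal_im]
    ring
  have hik : IsEnd (x 1) → IsEnd (x 3) → i ≠ k := by
    rintro h0 h2 rfl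
    obtain ⟨a, ha⟩ := qt_end (z := z) j h0
    obtain ⟨b, hb⟩ := qt_end (z := z) l h2
    rw [ha, hb] at e
    have hab : b ≠ a := by
      rintro rfl
      rw [sub_self, mul_zero, sub_eq_zero, shr_inj] at e
      exact hne e.symm
    apply H.dt_vertex_ne T hab i
    have e2 : shr t (z b) - shr t (z a) = -I * (shr t (qt z i (x 2)) - shr t (qt z i (x 0))) := by
      rw [e]; linear_combination (shr t (z b) - shr t (z a)) * I_mul_I
    rw [e2, shr_qt, shr_qt]
    simp only [dt, mul_re, mul_im, add_re, add_im, sub_re, sub_im, neg_re, neg_im, I_re, I_im,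
      ofReal_re, ofReal_im]
    ring
  have := semi_square_unique (y := x - x') (H.dt_ed_ne T i j) (H.dt_ed_ne T i l) (H.dt_ed_ne T k j)
    (H.dt_ed_ne T k l) (by
      simp only [shr_qt] at e e'
      simp only [Pi.sub_apply]; push_cast
      linear_combination e - e') hrs (sub_eq_zero.2 hr') (sub_eq_zero.2 hs')
    (by
      intro h
      apply H.crs_ed_ne T
      rcases h with ⟨rfl, rfl⟩ | ⟨rfl, rfl⟩
      · exact hjl hr hs
      · exact hjl hs hr)
    (by
      intro h
      apply H.crs_ed_ne T
      rcases h with ⟨rfl, rfl⟩ | ⟨rfl, rfl⟩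
      · exact hik hr hs
      · exact hik hs hr)
  funext q
  exact sub_eq_zero.1 (this q)

lemma transverse_ne {i k l : ZMod n} {a b : ℝ}
    (h : a * shr t (z (k + 1) - z k) - shr t (z (i + 1) - z i) = I * (b * shr t (z (l + 1) - z l))) :
    shr t (z (i + 1) - z i) + a * shr t (z (k + 1) - z k) - b * shr t (z (l + 1) - z l) ≠ 0 := by
  intro h0
  have h1 : ((a : ℝ) : ℂ) * shr t (z (k + 1) - z k) = ((1 : ℝ) : ℂ) * (I * shr t (z (i + 1) - z i)) := by
    push_cast
    linear_combination (1 + I) / 2 * h - I * (1 + I) / 2 * h0 +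
      (a * shr t (z (k + 1) - z k) + shr t (z (i + 1) - z i)) / 2 * I_mul_I
  have := real_smul_eq (by rw [crs_I_mul]; exact H.dt_ed_ne T k i) h1
  norm_num at this

lemma exists_goodRot [NeZero n] : ∃ c, GoodRot z t c := by
  obtain ⟨S₁, hS₁⟩ : ∃ S : Set ℂ, S = {w | ∃ p : ZMod n × ZMod n, w = shr t (z p.1) - shr t (z p.2)} :=
    ⟨_, rfl⟩
  obtain ⟨S₂, hS₂⟩ : ∃ S : Set ℂ, S = {w | ∃ p : (ZMod n × ZMod n × ZMod n × ZMod n) × (Fin 4 × Fin 4) ×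
      (Bool × Bool), p.2.1.1 ≠ p.2.1.2 ∧ ∃ x ∈ box, x p.2.1.1 = (if p.2.2.1 then 1 else 0) ∧
      x p.2.1.2 = (if p.2.2.2 then 1 else 0) ∧ qt z p.1.1 (x 0) ≠ qt z p.1.2.1 (x 2) ∧
      shr t (qt z p.1.2.1 (x 2)) - shr t (qt z p.1.1 (x 0)) =
        I * (shr t (qt z p.1.2.2.2 (x 3)) - shr t (qt z p.1.2.2.1 (x 1))) ∧
      w = shr t (qt z p.1.1 (x 0)) + shr t (qt z p.1.2.1 (x 2)) - shr t (qt z p.1.2.2.1 (x 1)) -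
        shr t (qt z p.1.2.2.2 (x 3))} := ⟨_, rfl⟩
  obtain ⟨S₃, hS₃⟩ : ∃ S : Set ℂ, S = {w | ∃ p : ZMod n × ZMod n × ZMod n, ∃ a b : ℝ,
      a * shr t (z (p.2.1 + 1) - z p.2.1) - shr t (z (p.1 + 1) - z p.1) =
        I * (b * shr t (z (p.2.2 + 1) - z p.2.2)) ∧
      w = shr t (z (p.1 + 1) - z p.1) + a * shr t (z (p.2.1 + 1) - z p.2.1) -
        b * shr t (z (p.2.2 + 1) - z p.2.2)} := ⟨_, rfl⟩
  obtain ⟨S₄, hS₄⟩ : ∃ S : Set ℂ, S = {w | ∃ s : ZMod n,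
      w = bis (shr t (z (s + 1) - z s)) (-shr t (z s - z (s - 1)))} := ⟨_, rfl⟩
  obtain ⟨S₅, hS₅⟩ : ∃ S : Set ℂ, S = {w | ∃ s : ZMod n,
      w = bis (-shr t (z s - z (s - 1))) (shr t (z (s + 1) - z s))} := ⟨_, rfl⟩
  have F₁ : S₁.Finite := by
    rw [hS₁]; exact finite_of_subsingleton _ fun _ a b ha hb => ha.trans hb.symm
  have F₂ : S₂.Finite := by
    rw [hS₂]
    refine finite_of_subsingleton _ ?_
    rintro ⟨⟨i, k, j, l⟩, ⟨r, s⟩, ⟨u, v⟩⟩ _ _ ⟨hrs, x, -, hr, hs, hne, e, rfl⟩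
      ⟨-, x', -, hr', hs', hne', e', rfl⟩
    rw [H.two_vertices_unique T hne e e' hrs (by rw [hr]; unfold IsEnd; cases u <;> simp)
      (by rw [hs]; unfold IsEnd; cases v <;> simp) (hr.trans hr'.symm) (hs.trans hs'.symm)]
  have F₃ : S₃.Finite := by
    rw [hS₃]
    refine finite_of_subsingleton _ ?_
    rintro ⟨i, k, l⟩ _ _ ⟨a, b, e, rfl⟩ ⟨a', b', e', rfl⟩
    have := real_smul_eq (u := shr t (z (k + 1) - z k)) (v := I * shr t (z (l + 1) - z l))
      (a := a - a') (b := b - b') (by rw [crs_I_mul]; exact H.dt_ed_ne T k l)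
      (by push_cast; simp only at e e'; linear_combination e - e')
    rw [sub_eq_zero.1 this.1, sub_eq_zero.1 this.2]
  have F₄ : S₄.Finite := by
    rw [hS₄]; exact finite_of_subsingleton _ fun _ a b ha hb => ha.trans hb.symm
  have F₅ : S₅.Finite := by
    rw [hS₅]; exact finite_of_subsingleton _ fun _ a b ha hb => ha.trans hb.symm
  have F := (F₁.union F₂).union (F₃.union (F₄.union F₅))
  have : Finite ↥((S₁ ∪ S₂) ∪ (S₃ ∪ (S₄ ∪ S₅))) := F
  obtain ⟨c, hc, h⟩ := exists_generic fun w : ↥((S₁ ∪ S₂) ∪ (S₃ ∪ (S₄ ∪ S₅))) => (w : ℂ)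
  have hw : ∀ w ∈ (S₁ ∪ S₂) ∪ (S₃ ∪ (S₄ ∪ S₅)), w ≠ 0 → (c * w).im ≠ 0 := fun w hw => h ⟨w, hw⟩
  have hF : Fact (1 < n) := ⟨by have := H.three; omega⟩
  have hcr : ∀ s, crs (shr t (z (s + 1) - z s)) (-shr t (z s - z (s - 1))) ≠ 0 := by
    intro s
    have := H.crs_ed_ne T (i := s) (j := s - 1) (by intro h; rw [eq_comm, sub_eq_self] at h; simp at h)
    rw [sub_add_cancel] at this
    simp only [crs, neg_re, neg_im] at this ⊢
    intro h
    exact this (by linarith)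
  refine ⟨c, hc, ?_, ?_, ?_, ?_, ?_⟩
  · intro a b hab
    refine hw _ (Or.inl (Or.inl ?_)) (sub_ne_zero.2 fun h => H.vertex_ne hab (shr_inj.1 h))
    rw [hS₁]; exact ⟨(a, b), rfl⟩
  · intro i k j l x hx hne e r s hrs hr hs
    refine hw _ (Or.inl (Or.inr ?_)) ?_
    · rw [hS₂]
      have : ∀ r, IsEnd (x r) → ∃ u : Bool, x r = if u then 1 else 0 := by
        intro r hr
        rcases hr with h | h
        · exact ⟨false, by simpa using h⟩
        · exact ⟨true, by simpa using h⟩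
      obtain ⟨u, hu⟩ := this r hr
      obtain ⟨v, hv⟩ := this s hs
      exact ⟨((i, k, j, l), (r, s), (u, v)), hrs, x, hx, hu, hv, hne, e, rfl⟩
    · intro h
      exact T.no_vertex i k j l x hx r hr hne ⟨e, by linear_combination h⟩
  · intro i k l a b e
    refine hw _ (Or.inr (Or.inl ?_)) (H.transverse_ne T e)
    rw [hS₃]; exact ⟨(i, k, l), a, b, e, rfl⟩
  · intro s
    refine hw _ (Or.inr (Or.inr (Or.inl ?_))) (bis_ne_zero (hcr s))
    rw [hS₄]; exact ⟨s, rfl⟩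
  · intro s
    refine hw _ (Or.inr (Or.inr (Or.inr ?_))) (bis_ne_zero ?_)
    · rw [hS₅]; exact ⟨s, rfl⟩
    · rw [crs_comm]; exact neg_ne_zero.2 (hcr s)

end GenPoly

section Shift

variable {n : ℕ}

/-- The rotated deformed polygon, with vertices numbered from `s`. -/
noncomputable def seqOf (z : ZMod n → ℂ) (t : ℝ) (c : ℂ) (s : ZMod n) (i : ℕ) : ℂ := c * shr t (z (i + s))

variable (z : ZMod n → ℂ) (t : ℝ) (c : ℂ) (s : ZMod n)

lemma ed_seqOf (i : ℕ) :
    ed (seqOf z t c s) i = c * shr t (z ((i + s) + 1) - z (i + s)) := by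
  rw [ed, seqOf, seqOf, shr_sub, mul_sub]
  congr 4
  push_cast; ring

lemma pt_seqOf (i : ℕ) (x : ℝ) : pt (seqOf z t c s) i x = c * shr t (qt z (i + s) x) := by
  rw [pt, ed_seqOf, qt, shr_add, shr_smul, seqOf]; ring

lemma natCast_add_inj {i j : ℕ} (hi : i < n) (hj : j < n) (h : (i : ZMod n) + s = j + s) : i = j := by
  have := (ZMod.natCast_eq_natCast_iff' i j n).1 (add_right_cancel h)
  rwa [Nat.mod_eq_of_lt hi, Nat.mod_eq_of_lt hj] at this

lemma natCast_succ_add_inj {i j : ℕ} (hi : i < n) (hj : j < n) (h : (j : ZMod n) + s = i + s + 1) :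
    j = i + 1 ∨ (j = 0 ∧ i + 1 = n) := by
  have h' : (j : ZMod n) = ((i + 1 : ℕ) : ZMod n) := by
    apply add_right_cancel (b := s); rw [h]; push_cast; ring
  have := (ZMod.natCast_eq_natCast_iff' _ _ n).1 h'
  rw [Nat.mod_eq_of_lt hj] at this
  rcases (Nat.succ_le_of_lt hi).lt_or_eq with h | h
  · left; rw [this]; exact Nat.mod_eq_of_lt h
  · right
    have h : i + 1 = n := h
    rw [h, Nat.mod_self] at this
    exact ⟨this, h⟩

variable {z t c}

lemma seqOf_sub_eq (hc : c ≠ 0) {i j k l : ℕ} {x y u w : ℝ} :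
    pt (seqOf z t c s) k y - pt (seqOf z t c s) i x =
      I * (pt (seqOf z t c s) l w - pt (seqOf z t c s) j u) ↔
    shr t (qt z (k + s) y) - shr t (qt z (i + s) x) =
      I * (shr t (qt z (l + s) w) - shr t (qt z (j + s) u)) := by
  simp only [pt_seqOf]
  rw [← mul_sub, ← mul_sub, mul_left_comm]
  exact mul_right_inj' hc

lemma seqOf_add_eq (hc : c ≠ 0) {i j k l : ℕ} {x y u w : ℝ} :
    pt (seqOf z t c s) i x + pt (seqOf z t c s) k y =
      pt (seqOf z t c s) j u + pt (seqOf z t c s) l w ↔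
    shr t (qt z (i + s) x) + shr t (qt z (k + s) y) =
      shr t (qt z (j + s) u) + shr t (qt z (l + s) w) := by
  simp only [pt_seqOf]
  rw [← mul_add, ← mul_add]
  exact mul_right_inj' hc

lemma seqOf_pt_inj (hc : c ≠ 0) {i j : ℕ} {x y : ℝ} :
    pt (seqOf z t c s) i x = pt (seqOf z t c s) j y ↔ qt z (i + s) x = qt z (j + s) y := by
  rw [pt_seqOf, pt_seqOf, mul_right_inj' hc, shr_inj]

end Shift

namespace GenPoly

variable {n : ℕ} {z : ZMod n → ℂ} (H : GenPoly z) {t : ℝ} (T : TameAt z t)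

include H T

lemma base_vertices {a j l m : ZMod n} {x : Fin 3 → ℝ}
    (e : shr t (qt z m (x 2)) - shr t (z a) = I * (shr t (qt z l (x 1)) - shr t (qt z j (x 0))))
    (hne : qt z j (x 0) ≠ qt z l (x 1)) : ∀ r s, IsEnd (x r) → IsEnd (x s) → r = s := by
  have A : IsEnd (x 0) → IsEnd (x 1) → False := by
    intro h0 h1
    obtain ⟨b, hb⟩ := qt_end (z := z) j h0
    obtain ⟨d, hd⟩ := qt_end (z := z) l h1
    rw [hb, hd] at e hne
    have hdb : d ≠ b := fun h => hne (by rw [h])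
    apply T.dist d b a m hdb
    rw [← crs_shr, shr_sub t (z m)]
    have : shr t (z m) - shr t (z a) = I * (shr t (z d - z b)) - x 2 * shr t (z (m + 1) - z m) := by
      rw [shr_qt] at e
      rw [shr_sub t (z d)]
      linear_combination e
    rw [this]
    simp [crs, dt]
    ring
  have B : IsEnd (x 2) → IsEnd (x 0) → False := by
    intro h0 h1
    obtain ⟨b, hb⟩ := qt_end (z := z) m h0
    obtain ⟨d, hd⟩ := qt_end (z := z) j h1
    rw [hb, hd] at e
    rw [hd] at hne
    have hab : a ≠ b := by
      rintro rfl
      rw [sub_self, eq_comm, mul_eq_zero, sub_eq_zero, shr_inj] at e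
      rcases e with e | e
      · exact I_ne_zero e
      · exact hne e.symm
    apply T.dist a b d l hab
    rw [← crs_shr, shr_sub t (z l)]
    have : shr t (z l) - shr t (z d) = I * (shr t (z a - z b)) - x 1 * shr t (z (l + 1) - z l) := by
      rw [shr_qt] at e
      rw [shr_sub t (z a)]
      linear_combination I * e + (shr t (z l) + x 1 * shr t (z (l + 1) - z l) - shr t (z d)) * I_mul_I
    rw [this]
    simp [crs, dt]
    ring
  have C : IsEnd (x 2) → IsEnd (x 1) → False := by
    intro h0 h1
    obtain ⟨b, hb⟩ := qt_end (z := z) m h0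
    obtain ⟨d, hd⟩ := qt_end (z := z) l h1
    rw [hb, hd] at e
    rw [hd] at hne
    have hab : b ≠ a := by
      rintro rfl
      rw [sub_self, eq_comm, mul_eq_zero, sub_eq_zero, shr_inj] at e
      rcases e with e | e
      · exact I_ne_zero e
      · exact hne e.symm
    apply T.dist b a d j hab
    rw [← crs_shr, shr_sub t (z j)]
    have : shr t (z j) - shr t (z d) = I * (shr t (z b - z a)) - x 0 * shr t (z (j + 1) - z j) := by
      rw [shr_qt] at e
      rw [shr_sub t (z b)]
      linear_combination -I * e - (shr t (z d) - shr t (z j) - x 0 * shr t (z (j + 1) - z j)) * I_mul_I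
    rw [this]
    simp [crs, dt]
    ring
  intro r s hr hs
  fin_cases r <;> fin_cases s <;> first
    | rfl
    | exact (A hr hs).elim
    | exact (A hs hr).elim
    | exact (B hr hs).elim
    | exact (B hs hr).elim
    | exact (C hr hs).elim
    | exact (C hs hr).elim

lemma exists_core [NeZero n] {c : ℂ} (G : GoodRot z t c) : ∃ s, Core (seqOf z t c s) n := by
  obtain ⟨s, hs⟩ := Finite.exists_min fun a : ZMod n => (c * shr t (z a)).im
  have hF : Fact (1 < n) := ⟨by have := H.three; omega⟩
  have hc := G.ne
  have hc2 : normSq c ≠ 0 := by rwa [Ne, normSq_eq_zero]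
  have hne : ∀ {i j : ℕ}, i < n → j < n → i ≠ j → (i : ZMod n) + s ≠ j + s :=
    fun hi hj h h' => h (natCast_add_inj s hi hj h')
  have him : ∀ a b : ZMod n, a ≠ b → (c * shr t (z a)).im ≠ (c * shr t (z b)).im := by
    intro a b hab h
    apply G.vertex a b hab
    rw [mul_sub, sub_im, h, sub_self]
  have hlast : -ed (seqOf z t c s) (n - 1) = c * -shr t (z s - z (s - 1)) := by
    have h1 : ((n - 1 : ℕ) : ZMod n) + s = s - 1 := by
      rw [Nat.cast_sub (by have := H.three; omega)]; simp; ring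
    rw [ed_seqOf, h1, sub_add_cancel]; ring
  have hfst : ed (seqOf z t c s) 0 = c * shr t (z (s + 1) - z s) := by
    rw [ed_seqOf]; simp
  have hbis : ∀ f g : ℂ, (c * bis f g).im ≠ 0 → (bis (c * f) (c * g)).im ≠ 0 := by
    intro f g h
    rw [bis_mul, im_ofReal_mul]
    exact mul_ne_zero hc2 h
  refine ⟨s, ⟨H.three, ?_, ?_, ?_, ?_, ?_, ?_, ?_, ?_, ?_, ?_, ?_, ?_⟩⟩
  · intro i; simp [seqOf]
  · intro i hi j hj hij
    rw [ed_seqOf, ed_seqOf, crs_mul]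
    exact mul_ne_zero hc2 (H.crs_ed_ne T (hne hi hj hij))
  · intro i hi j hj
    rw [ed_seqOf, ed_seqOf, dt_mul]
    exact mul_ne_zero hc2 (H.dt_ed_ne T _ _)
  · intro i j hij hj x y hx0 hx1 hy0 hy1 h
    rw [seqOf_pt_inj s hc] at h
    rcases H.simple _ _ (hne (hij.trans hj) hj hij.ne) x y hx0 hx1 hy0 hy1 h with ⟨h1, h2⟩ | ⟨h1, h2⟩
    · left
      rcases natCast_succ_add_inj s (hij.trans hj) hj h1 with h | h
      · exact ⟨h, h2⟩
      · omega
    · right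
      rcases natCast_succ_add_inj s hj (hij.trans hj) h1 with h | h
      · omega
      · exact ⟨h.1, h.2, h2⟩
  · intro a ha b hb hab
    exact him _ _ (hne ha hb hab)
  · intro a ha han
    refine lt_of_le_of_ne ?_ (him _ _ (hne (by omega) han ha.ne))
    have := hs (a + s)
    simpa [seqOf] using this
  · intro i _ k _ j _ l _ x hx hbox hne' r q hr hq
    by_contra hrq
    refine G.two_vertices _ _ _ _ x hbox (fun h => hne' ((seqOf_pt_inj s hc).2 h))
      ((seqOf_sub_eq s hc).1 hx.1) r q hrq hr hq ?_
    have := hx.2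
    simp only [pt_seqOf] at this
    rw [← this]
    congr 1; ring
  · intro i _ k _ j _ l _ x hx hbox hne' he r hr
    exact T.no_vertex _ _ _ _ x hbox r hr (fun h => hne' ((seqOf_pt_inj s hc).2 h))
      ⟨(seqOf_sub_eq s hc).1 hx.1, (seqOf_add_eq s hc).1 he⟩
  · intro i _ k _ j _ l _
    obtain ⟨a, b, e⟩ := exists_real_combination
      (u := shr t (z (k + s + 1) - z (k + s))) (v := I * shr t (z (l + s + 1) - z (l + s)))
      (by rw [crs_I_mul]; exact H.dt_ed_ne T _ _) (shr t (z (i + s + 1) - z (i + s)))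
    have e' : (a : ℂ) * shr t (z (k + s + 1) - z (k + s)) - shr t (z (i + s + 1) - z (i + s)) =
        I * ((-b : ℝ) * shr t (z (l + s + 1) - z (l + s))) := by
      push_cast; linear_combination -e
    refine ⟨![1, 0, a, -b], ?_, ?_⟩
    · simp only [ed_seqOf]
      simp
      simp at e'
      linear_combination c * e'
    · have := G.transverse _ _ _ a (-b) e'
      simp only [ed_seqOf]
      convert this using 2
      simp
      ring
  · intro j _ l _ m _ x _ e hne'
    have h0 : seqOf z t c s 0 = c * shr t (z s) := by simp [seqOf]
    refine H.base_vertices T (a := s) (j := j + s) (l := l + s) (m := m + s) ?_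
      (fun h => hne' ((seqOf_pt_inj s hc).2 h))
    rw [h0] at e
    simp only [pt_seqOf] at e
    apply mul_left_cancel₀ hc
    linear_combination e
  · have := hbis _ _ (G.bis_fst s)
    rw [hlast, hfst]
    exact this
  · have := hbis _ _ (G.bis_snd s)
    rw [bis, crs_comm, abs_neg, dt_comm, normSq_mul, normSq_neg, ← normSq_mul] at this
    rw [← hfst] at this
    have h2 : c * shr t (z s - z (s - 1)) = ed (seqOf z t c s) (n - 1) := by
      rw [← neg_inj, hlast]; ring
    rw [h2, ← hlast] at this
    exact this

/-- The parity of the number of squares of the deformed polygon, in terms of the original one. -/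
lemma exists_shift_sum [NeZero n] {c : ℂ} (G : GoodRot z t c) : ∃ s : ZMod n,
    pairSum n (fun i k => pairSum n fun j l => ind (CellSq (seqOf z t c s) i k j l)) = 1 := by
  obtain ⟨s, hs⟩ := H.exists_core T G
  exact ⟨s, hs.square_sum⟩

end GenPoly

lemma pairSum_eq_sum_prod {n : ℕ} {f : ℕ → ℕ → ZMod 2} (h : ∀ i k, k < i → f i k = 0) :
    pairSum n f = ∑ p ∈ Finset.range n ×ˢ Finset.range n, f p.1 p.2 := by
  rw [Finset.sum_product_right, pairSum]
  refine Finset.sum_congr rfl fun k hk => ?_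
  have hk : k < n := by simpa using hk
  refine Finset.sum_subset (fun i hi => ?_) fun i _ hi => ?_
  · simp at hi ⊢; omega
  · simp at hi; exact h i k (by omega)

lemma sum_ind_eq_card {α : Type*} (S : Finset α) (P : α → Prop) [DecidablePred P] :
    ∑ a ∈ S, ind (P a) = ((S.filter P).card : ZMod 2) := by
  rw [Finset.card_filter]
  push_cast
  refine Finset.sum_congr rfl fun a _ => ?_
  by_cases h : P a <;> simp [ind, h]

lemma SqRel.rotate {a₁ a₃ a₂ a₄ : ℂ} (h : SqRel a₁ a₃ a₂ a₄) : SqRel a₂ a₄ a₃ a₁ := by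
  refine ⟨?_, ?_⟩
  · linear_combination I * h.1 + (a₄ - a₂) * I_mul_I
  · rw [← h.2]; ring

lemma SqRel.ne_right {a₁ a₃ a₂ a₄ : ℂ} (h : SqRel a₁ a₃ a₂ a₄) (hne : a₁ ≠ a₃) : a₂ ≠ a₄ := by
  rintro rfl
  have := h.1
  rw [sub_self, mul_zero, sub_eq_zero] at this
  exact hne this.symm

/-- A square determines its vertices up to rotation. -/
lemma sqRel_rotations {a₁ a₃ a₂ a₄ b₁ b₃ b₂ b₄ : ℂ} (ha : SqRel a₁ a₃ a₂ a₄) (hne : a₁ ≠ a₃)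
    (hb : SqRel b₁ b₃ b₂ b₄) (hne' : b₁ ≠ b₃) (h₁ : b₁ ∈ ({a₁, a₂, a₃, a₄} : Set ℂ))
    (h₂ : b₂ ∈ ({a₁, a₂, a₃, a₄} : Set ℂ)) (h₃ : b₃ ∈ ({a₁, a₂, a₃, a₄} : Set ℂ))
    (h₄ : b₄ ∈ ({a₁, a₂, a₃, a₄} : Set ℂ)) :
    (b₁ = a₁ ∧ b₃ = a₃ ∧ b₂ = a₂ ∧ b₄ = a₄) ∨ (b₁ = a₂ ∧ b₃ = a₄ ∧ b₂ = a₃ ∧ b₄ = a₁) ∨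
    (b₁ = a₃ ∧ b₃ = a₁ ∧ b₂ = a₄ ∧ b₄ = a₂) ∨ (b₁ = a₄ ∧ b₃ = a₂ ∧ b₂ = a₁ ∧ b₄ = a₃) := by
  obtain ⟨m, hm⟩ : ∃ m : ℂ, m = (a₁ + a₃) / 2 := ⟨_, rfl⟩
  obtain ⟨ε, hε⟩ : ∃ ε : ℂ, ε = (a₄ - a₂) / 2 := ⟨_, rfl⟩
  obtain ⟨k1, k2⟩ := ha
  have e1 : a₁ = m + (-I) * ε := by rw [hm, hε]; linear_combination (-1 / 2 : ℂ) * k1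
  have e3 : a₃ = m + I * ε := by rw [hm, hε]; linear_combination (1 / 2 : ℂ) * k1
  have e2 : a₂ = m + (-1) * ε := by rw [hm, hε]; linear_combination (-1 / 2 : ℂ) * k2
  have e4 : a₄ = m + 1 * ε := by rw [hm, hε]; linear_combination (-1 / 2 : ℂ) * k2
  have hε0 : ε ≠ 0 := by
    rintro rfl
    exact hne (by rw [e1, e3]; simp)
  have key : ∀ b ∈ ({a₁, a₂, a₃, a₄} : Set ℂ), ∃ u ∈ ({-I, -1, I, 1} : Set ℂ), b = m + u * ε := by
    rintro b (rfl | rfl | rfl | rfl)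
    · exact ⟨_, by simp, e1⟩
    · exact ⟨_, by simp, e2⟩
    · exact ⟨_, by simp, e3⟩
    · exact ⟨_, by simp, e4⟩
  obtain ⟨u₁, v₁, rfl⟩ := key _ h₁
  obtain ⟨u₂, v₂, rfl⟩ := key _ h₂
  obtain ⟨u₃, v₃, rfl⟩ := key _ h₃
  obtain ⟨u₄, v₄, rfl⟩ := key _ h₄
  obtain ⟨r1, r2⟩ := hb
  have s1 : u₃ - u₁ = I * (u₄ - u₂) := mul_right_cancel₀ hε0 (by linear_combination r1)
  have s2 : u₁ + u₃ = u₂ + u₄ := mul_right_cancel₀ hε0 (by linear_combination r2)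
  have hu : u₁ ≠ u₃ := fun h => hne' (by rw [h])
  have s4 : u₄ = ((u₁ + u₃) - I * (u₃ - u₁)) / 2 := by
    linear_combination (-1 / 2 : ℂ) * s2 + I / 2 * s1 + (u₄ - u₂) / 2 * I_mul_I
  have s3 : u₂ = ((u₁ + u₃) + I * (u₃ - u₁)) / 2 := by
    linear_combination (-1 / 2 : ℂ) * s2 - I / 2 * s1 - (u₄ - u₂) / 2 * I_mul_I
  clear s1 s2 r1 r2 h₁ h₂ h₃ h₄ hne'
  have hN : u₃ = -u₁ := by
    have n1 : ∀ u ∈ ({-I, -1, I, 1} : Set ℂ), normSq u = 1 := by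
      rintro u (rfl | rfl | rfl | rfl) <;> simp
    have q2 := n1 _ v₂
    rw [s3] at q2
    have p2 : normSq (u₁ + u₃ + I * (u₃ - u₁)) = 4 := by
      rw [normSq_div] at q2
      have : normSq (2 : ℂ) = 4 := by simp [normSq_apply]; norm_num
      rw [this] at q2; linarith
    rcases v₁ with rfl | rfl | rfl | rfl <;> rcases v₃ with rfl | rfl | rfl | rfl <;>
      first
      | exact absurd rfl hu
      | (simp; done)
      | (exfalso; clear * - p2; norm_num [normSq_apply] at p2)
  subst hN
  have w2 : u₂ = -I * u₁ := by rw [s3]; ring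
  have w4 : u₄ = I * u₁ := by rw [s4]; ring
  subst w2 w4
  rw [e1, e2, e3, e4]
  rcases v₁ with rfl | rfl | rfl | rfl
  · left; simp
  · right; left; simp
  · right; right; left; simp
  · right; right; right; simp

namespace GenPoly

variable {n : ℕ} {z : ZMod n → ℂ} (H : GenPoly z)

include H

lemma cellSq_iff {t : ℝ} {c : ℂ} (hc : c ≠ 0) (s : ZMod n)
    (hO : ∀ i k j l, OpenSq z t i k j l ↔ OpenSq z 0 i k j l) {i k j l : ℕ}
    (hik : i ≤ k) (hk : k < n) (hjl : j ≤ l) :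
    CellSq (seqOf z t c s) i k j l ↔ i < k ∧ j < l ∧ OpenSq z 0 (i + s) (k + s) (j + s) (l + s) := by
  constructor
  · rintro ⟨x, y, u, w, h1, h2, h3⟩
    have hO0 : OpenSq z 0 (i + s) (k + s) (j + s) (l + s) := by
      rw [← hO]
      refine ⟨![x, u, y, w], ?_, ?_, (seqOf_sub_eq s hc).1 h3.1, (seqOf_add_eq s hc).1 h3.2⟩
      · simp [Fin.forall_fin_succ, h1.1, h1.2.1, h2.1, h2.2.1]
      · intro h
        simp at h
        rcases hik.eq_or_lt with rfl | hlt
        · exact (h1.2.2 rfl).ne (H.qt_inj h)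
        · rcases H.simple _ _ (fun h' => hlt.ne (natCast_add_inj s (hlt.trans hk) hk h')) x y h1.1.1.le
            h1.1.2.le h1.2.1.1.le h1.2.1.2.le h with ⟨-, h, -⟩ | ⟨-, h, -⟩
          · exact h1.1.2.ne h
          · exact h1.1.1.ne' h
    obtain ⟨x, hx, hne, hs⟩ := id hO0
    obtain ⟨-, g1, -, -, -, -, g2⟩ := H.gen _ _ _ _ x (fun r => ⟨(hx r).1.le, (hx r).2.le⟩) hne
      (sqAt_zero.1 hs)
    exact ⟨lt_of_le_of_ne hik fun h => g1 (by rw [h]), lt_of_le_of_ne hjl fun h => g2 (by rw [h]), hO0⟩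
  · rintro ⟨h1, h2, h3⟩
    rw [← hO] at h3
    obtain ⟨x, hx, hne, hs⟩ := h3
    exact ⟨x 0, x 2, x 1, x 3, ⟨hx 0, hx 2, fun h => absurd h h1.ne⟩,
      ⟨hx 1, hx 3, fun h => absurd h h2.ne⟩, (seqOf_sub_eq s hc).2 hs.1, (seqOf_add_eq s hc).2 hs.2⟩

/-- A point in the interior of an edge determines the edge. -/
lemma edge_unique {i j : ZMod n} {x y : ℝ} (hx : 0 < x ∧ x < 1) (hy : 0 ≤ y ∧ y ≤ 1)
    (h : qt z i x = qt z j y) : i = j := by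
  by_contra hij
  rcases H.simple i j hij x y hx.1.le hx.2.le hy.1 hy.2 h with ⟨-, h, -⟩ | ⟨-, h, -⟩
  · exact hx.2.ne h
  · exact hx.1.ne' h

lemma openSq_unique {i k j l : ZMod n} {x y : Fin 4 → ℝ} (hx : ∀ r, 0 < x r ∧ x r < 1)
    (hne : qt z i (x 0) ≠ qt z k (x 2)) (hs : SqAt z 0 i k j l x) (hy : SqAt z 0 i k j l y) : x = y := by
  have hd := H.det_ne hx hne hs
  rw [show y = x + (y - x) by abel, sqAt_add, (sqAt_iff _ _ _ _ _ _ _).1 hs, zero_add] at hy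
  have := Matrix.eq_zero_of_mulVec_eq_zero hd hy
  exact (sub_eq_zero.1 this).symm

end GenPoly

section SquareSets

variable {n : ℕ}

/-- The vertices of the square on the given edges. -/
def sqPts (z : ZMod n → ℂ) (i k j l : ZMod n) : Set ℂ :=
  {p | ∃ x : Fin 4 → ℝ, (∀ r, 0 < x r ∧ x r < 1) ∧ qt z i (x 0) ≠ qt z k (x 2) ∧
    SqAt z 0 i k j l x ∧ p ∈ ({qt z i (x 0), qt z j (x 1), qt z k (x 2), qt z l (x 3)} : Set ℂ)}

lemma openSq_rotate {z : ZMod n → ℂ} {i k j l : ZMod n} (h : OpenSq z 0 i k j l) :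
    OpenSq z 0 j l k i := by
  obtain ⟨x, hx, hne, hs⟩ := h
  rw [sqAt_zero] at hs
  refine ⟨![x 1, x 2, x 3, x 0], ?_, ?_, ?_⟩
  · simp [Fin.forall_fin_succ, hx]
  · simpa using hs.ne_right hne
  · rw [sqAt_zero]; simpa using hs.rotate

namespace GenPoly

variable {z : ZMod n → ℂ} (H : GenPoly z)

include H

lemma sqPts_eq {i k j l : ZMod n} {x : Fin 4 → ℝ} (hx : ∀ r, 0 < x r ∧ x r < 1)
    (hne : qt z i (x 0) ≠ qt z k (x 2)) (hs : SqAt z 0 i k j l x) :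
    sqPts z i k j l = {qt z i (x 0), qt z j (x 1), qt z k (x 2), qt z l (x 3)} := by
  ext p
  constructor
  · rintro ⟨y, -, -, hs', hp⟩
    rwa [H.openSq_unique hx hne hs hs']
  · exact fun hp => ⟨x, hx, hne, hs, hp⟩

lemma sqPts_rotate {i k j l : ZMod n} (h : OpenSq z 0 i k j l) :
    sqPts z j l k i = sqPts z i k j l := by
  obtain ⟨x, hx, hne, hs⟩ := h
  rw [H.sqPts_eq hx hne hs]
  rw [sqAt_zero] at hs
  rw [H.sqPts_eq (x := ![x 1, x 2, x 3, x 0])]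
  · ext p; simp; tauto
  · simp [Fin.forall_fin_succ, hx]
  · simpa using hs.ne_right hne
  · rw [sqAt_zero]; simpa using hs.rotate

lemma sqPts_inj {i k j l i' k' j' l' : ZMod n} (h : OpenSq z 0 i k j l)
    (h' : OpenSq z 0 i' k' j' l') (he : sqPts z i k j l = sqPts z i' k' j' l') :
    (i' = i ∧ k' = k ∧ j' = j ∧ l' = l) ∨ (i' = j ∧ k' = l ∧ j' = k ∧ l' = i) ∨
    (i' = k ∧ k' = i ∧ j' = l ∧ l' = j) ∨ (i' = l ∧ k' = j ∧ j' = i ∧ l' = k) := by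
  obtain ⟨x, hx, hne, hs⟩ := h
  obtain ⟨y, hy, hne', hs'⟩ := h'
  rw [H.sqPts_eq hx hne hs, H.sqPts_eq hy hne' hs'] at he
  rw [sqAt_zero] at hs hs'
  have hc : ∀ r, 0 ≤ x r ∧ x r ≤ 1 := fun r => ⟨(hx r).1.le, (hx r).2.le⟩
  have E : ∀ {a b : ZMod n} {r r' : Fin 4}, qt z a (y r) = qt z b (x r') → a = b :=
    fun h => H.edge_unique (hy _) (hc _) h
  rcases sqRel_rotations hs hne hs' hne' (by rw [he]; simp) (by rw [he]; simp) (by rw [he]; simp)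
    (by rw [he]; simp) with ⟨a, b, c, d⟩ | ⟨a, b, c, d⟩ | ⟨a, b, c, d⟩ | ⟨a, b, c, d⟩
  · exact Or.inl ⟨E a, E b, E c, E d⟩
  · exact Or.inr (Or.inl ⟨E a, E b, E c, E d⟩)
  · exact Or.inr (Or.inr (Or.inl ⟨E a, E b, E c, E d⟩))
  · exact Or.inr (Or.inr (Or.inr ⟨E a, E b, E c, E d⟩))

lemma openSq_ne {i k j l : ZMod n} (h : OpenSq z 0 i k j l) : i ≠ k ∧ j ≠ l := by
  obtain ⟨x, hx, hne, hs⟩ := h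
  obtain ⟨-, g1, -, -, -, -, g2⟩ := H.gen _ _ _ _ x (fun r => ⟨(hx r).1.le, (hx r).2.le⟩) hne
    (sqAt_zero.1 hs)
  exact ⟨g1, g2⟩

open Classical in
/-- A generic polygon carries an odd number of squares. -/
theorem odd_squares : Odd {A : Set ℂ | ∃ i k j l, OpenSq z 0 i k j l ∧ A = sqPts z i k j l}.ncard := by
  have : NeZero n := ⟨by have := H.three; omega⟩
  obtain ⟨t, ⟨hT, hO1⟩, hO2⟩ := ((H.eventually_tameAt.and H.eventually_openSq_imp).and
    (nhdsWithin_le_nhds H.eventually_openSq)).exists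
  have hO : ∀ i k j l, OpenSq z t i k j l ↔ OpenSq z 0 i k j l :=
    fun i k j l => ⟨hO1 i k j l, hO2 i k j l⟩
  obtain ⟨c, G⟩ := H.exists_goodRot hT
  obtain ⟨s, hs⟩ := H.exists_shift_sum hT G
  let Q : (ℕ × ℕ) × (ℕ × ℕ) → Prop := fun p => p.1.1 < p.1.2 ∧ p.2.1 < p.2.2 ∧
    OpenSq z 0 (p.1.1 + s) (p.1.2 + s) (p.2.1 + s) (p.2.2 + s)
  let R : Finset ((ℕ × ℕ) × (ℕ × ℕ)) :=
    (Finset.range n ×ˢ Finset.range n) ×ˢ (Finset.range n ×ˢ Finset.range n)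
  let Φ : (ℕ × ℕ) × (ℕ × ℕ) → Set ℂ := fun p =>
    sqPts z (p.1.1 + s) (p.1.2 + s) (p.2.1 + s) (p.2.2 + s)
  have hcard : ((R.filter Q).card : ZMod 2) = 1 := by
    rw [← sum_ind_eq_card, Finset.sum_product, ← hs]
    rw [pairSum_congr (g := fun i k => pairSum n fun j l => ind (Q ((i, k), (j, l))))]
    · rw [pairSum_eq_sum_prod]
      · refine Finset.sum_congr rfl fun p _ => ?_
        rw [pairSum_eq_sum_prod]
        intro j l hjl
        exact ind_false fun h => hjl.not_gt h.2.1
      · intro i k hik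
        refine Finset.sum_eq_zero fun l _ => Finset.sum_eq_zero fun j _ => ?_
        exact ind_false fun h => hik.not_gt h.1
    · intro i k hik hk
      refine pairSum_congr fun j l hjl _ => ind_congr ?_
      exact H.cellSq_iff G.ne s hO hik hk hjl
  have hinj : Set.InjOn Φ (R.filter Q : Set ((ℕ × ℕ) × (ℕ × ℕ))) := by
    rintro ⟨⟨i, k⟩, ⟨j, l⟩⟩ hp ⟨⟨i', k'⟩, ⟨j', l'⟩⟩ hp' he
    simp only [Finset.coe_filter, Set.mem_ofPred_eq, R, Q, Finset.mem_product, Finset.mem_range] at hp hp'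
    obtain ⟨⟨⟨hi, hk⟩, hj, hl⟩, hik, hjl, h⟩ := hp
    obtain ⟨⟨⟨hi', hk'⟩, hj', hl'⟩, hik', hjl', h'⟩ := hp'
    have N : ∀ {a b : ℕ}, a < n → b < n → (a : ZMod n) + s = b + s → a = b := natCast_add_inj s
    rcases H.sqPts_inj h h' he with ⟨a, b, c, d⟩ | ⟨a, b, c, d⟩ | ⟨a, b, c, d⟩ | ⟨a, b, c, d⟩
    · rw [N hi' hi a, N hk' hk b, N hj' hj c, N hl' hl d]
    · have := N hj' hk c; have := N hl' hi d; omega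
    · have := N hi' hk a; have := N hk' hi b; omega
    · have := N hi' hl a; have := N hk' hj b; omega
  have himg : {A : Set ℂ | ∃ i k j l, OpenSq z 0 i k j l ∧ A = sqPts z i k j l} =
      Φ '' (R.filter Q : Set ((ℕ × ℕ) × (ℕ × ℕ))) := by
    have V : ∀ e : ZMod n, (((e - s).val : ℕ) : ZMod n) + s = e := fun e => by simp
    have mk : ∀ i k j l : ZMod n, OpenSq z 0 i k j l → (i - s).val < (k - s).val →
        (j - s).val < (l - s).val →
        sqPts z i k j l ∈ Φ '' (R.filter Q : Set ((ℕ × ℕ) × (ℕ × ℕ))) := by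
      intro i k j l h h1 h2
      refine ⟨(((i - s).val, (k - s).val), ((j - s).val, (l - s).val)), ?_, ?_⟩
      · simp only [Finset.coe_filter, Set.mem_ofPred_eq, R, Q, Finset.mem_product, Finset.mem_range,
          V, h1, h2, h, ZMod.val_lt, and_self]
      · simp only [Φ, V]
    have W : ∀ {a b : ZMod n}, a ≠ b → (a - s).val ≠ (b - s).val := fun hab h =>
      hab (sub_left_injective (ZMod.val_injective n h))
    ext A
    constructor
    · rintro ⟨i, k, j, l, h, rfl⟩
      obtain ⟨hik, hjl⟩ := H.openSq_ne h
      have h₁ := openSq_rotate h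
      have h₂ := openSq_rotate h₁
      have h₃ := openSq_rotate h₂
      rcases (W hik).lt_or_gt with a | a <;> rcases (W hjl).lt_or_gt with b | b
      · exact mk _ _ _ _ h a b
      · rw [← H.sqPts_rotate h, ← H.sqPts_rotate h₁, ← H.sqPts_rotate h₂]
        exact mk _ _ _ _ h₃ b a
      · rw [← H.sqPts_rotate h]
        exact mk _ _ _ _ h₁ b a
      · rw [← H.sqPts_rotate h, ← H.sqPts_rotate h₁]
        exact mk _ _ _ _ h₂ a b
    · rintro ⟨⟨⟨i, k⟩, ⟨j, l⟩⟩, hp, rfl⟩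
      simp only [Finset.coe_filter, Set.mem_ofPred_eq, Q] at hp
      exact ⟨_, _, _, _, hp.2.2.2, rfl⟩
  rw [himg, Set.InjOn.ncard_image hinj, Set.ncard_coe_finset]
  exact ZMod.natCast_eq_one_iff_odd.1 hcard

end GenPoly

end SquareSets

/-- The identification of the Euclidean plane with the complex plane. -/
def toC : Pt ≃ₗ[ℝ] ℂ := Complex.orthonormalBasisOneI.repr.symm.toLinearEquiv

lemma toC_apply (p : Pt) : toC p = p 0 + p 1 * I :=
  Complex.orthonormalBasisOneI_repr_symm_apply p

lemma toC_re (p : Pt) : (toC p).re = p 0 := by simp [toC_apply]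

lemma toC_im (p : Pt) : (toC p).im = p 1 := by simp [toC_apply]

lemma toC_rotCCW (p : Pt) : toC (rotCCW p) = I * toC p := by
  apply Complex.ext <;> simp [toC_re, toC_im, rotCCW]

lemma inscribedSquare_iff {P : Set Pt} {a₁ a₂ a₃ a₄ : Pt} : InscribedSquare P a₁ a₂ a₃ a₄ ↔
    (a₁ ∈ P ∧ a₂ ∈ P ∧ a₃ ∈ P ∧ a₄ ∈ P) ∧ toC a₁ ≠ toC a₃ ∧
      SqRel (toC a₁) (toC a₃) (toC a₄) (toC a₂) := by
  have e₁ : a₂ - a₁ = a₃ - a₄ ↔ toC a₂ - toC a₁ = toC a₃ - toC a₄ := by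
    rw [← map_sub, ← map_sub, toC.injective.eq_iff]
  have e₂ : a₃ - a₂ = rotCCW (a₂ - a₁) ↔ toC a₃ - toC a₂ = I * (toC a₂ - toC a₁) := by
    rw [← map_sub, ← map_sub, ← toC_rotCCW, toC.injective.eq_iff]
  have N : ∀ {a b : Pt}, a ≠ b ↔ toC a ≠ toC b := toC.injective.ne_iff.symm
  rw [InscribedSquare, e₁, e₂, N, N, N, N, N, N]
  generalize toC a₁ = b₁
  generalize toC a₂ = b₂
  generalize toC a₃ = b₃
  generalize toC a₄ = b₄
  constructor
  · rintro ⟨p₁, p₂, p₃, p₄, h, h', -, h'', -⟩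
    refine ⟨⟨p₁, p₂, p₃, p₄⟩, h'', ?_, ?_⟩
    · linear_combination h' + I * h + I * h' + (b₂ - b₁) * I_mul_I
    · linear_combination -h
  · rintro ⟨⟨p₁, p₂, p₃, p₄⟩, h, k₁, k₂⟩
    have h₁ : b₂ - b₁ = b₃ - b₄ := by linear_combination -k₂
    have h₂ : b₃ - b₂ = I * (b₂ - b₁) := by
      linear_combination (1 - I) / 2 * (k₁ + I * k₂) - (2 * b₂ - b₁ - b₃) / 2 * I_mul_I
    have hd : b₂ - b₁ ≠ 0 := fun h0 => h (by rw [h0] at h₂; linear_combination -h₂ - h0)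
    have u : (1 : ℂ) + I ≠ 0 := fun h0 => by simpa using congrArg im h0
    have w : (1 : ℂ) - I ≠ 0 := fun h0 => by simpa using congrArg im h0
    refine ⟨p₁, p₂, p₃, p₄, h₁, h₂, ?_, h, ?_, ?_, ?_, ?_⟩
    · rintro rfl; exact hd (sub_self _)
    · rintro rfl
      exact mul_ne_zero I_ne_zero hd (by linear_combination -h₂ - h₁)
    · rintro rfl
      exact mul_ne_zero I_ne_zero hd (by linear_combination -h₂)
    · rintro rfl
      exact mul_ne_zero w hd (by linear_combination h₁ + h₂)
    · rintro rfl
      exact hd (by linear_combination h₁)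

lemma exists_real_smul_of_crs_eq_zero {a b : ℂ} (hb : b ≠ 0) (h : crs a b = 0) :
    ∃ c : ℝ, a = c * b := by
  have hN := (normSq_pos.2 hb).ne'
  rw [normSq_apply] at hN
  refine ⟨dt a b / (b.re * b.re + b.im * b.im), ?_⟩
  simp only [crs] at h
  apply Complex.ext
  · rw [re_ofReal_mul, dt, div_mul_eq_mul_div, eq_div_iff hN]
    linear_combination b.im * h
  · rw [im_ofReal_mul, dt, div_mul_eq_mul_div, eq_div_iff hN]
    linear_combination -b.re * h

section Transfer

variable {n : ℕ} {v : ZMod n → Pt}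

lemma qt_eq_lineMap (i : ZMod n) (x : ℝ) :
    qt (toC ∘ v) i x = toC (v i + x • (v (i + 1) - v i)) := by
  simp [qt]

lemma mem_edge_iff {i : ZMod n} {a : Pt} : a ∈ segment ℝ (v i) (v (i + 1)) ↔
    ∃ x : ℝ, (0 ≤ x ∧ x ≤ 1) ∧ toC a = qt (toC ∘ v) i x := by
  simp only [segment_eq_image', Set.mem_image, Set.mem_Icc, qt_eq_lineMap, toC.injective.eq_iff]
  exact ⟨fun ⟨x, hx, h⟩ => ⟨x, hx, h.symm⟩, fun ⟨x, hx, h⟩ => ⟨x, hx, h.symm⟩⟩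

lemma mem_openEdge_iff {i : ZMod n} {a : Pt} : a ∈ openSegment ℝ (v i) (v (i + 1)) ↔
    ∃ x : ℝ, (0 < x ∧ x < 1) ∧ toC a = qt (toC ∘ v) i x := by
  simp only [openSegment_eq_image', Set.mem_image, Set.mem_Ioo, qt_eq_lineMap, toC.injective.eq_iff]
  exact ⟨fun ⟨x, hx, h⟩ => ⟨x, hx, h.symm⟩, fun ⟨x, hx, h⟩ => ⟨x, hx, h.symm⟩⟩

lemma mem_polygonSet_iff {a : Pt} : a ∈ polygonSet v ↔
    ∃ i, ∃ x : ℝ, (0 ≤ x ∧ x ≤ 1) ∧ toC a = qt (toC ∘ v) i x := by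
  simp only [polygonSet, Set.mem_iUnion, mem_edge_iff]

lemma IsSimplePolygon.simple (hP : IsSimplePolygon v) (i j : ZMod n) (hij : i ≠ j) (x y : ℝ)
    (hx0 : 0 ≤ x) (hx1 : x ≤ 1) (hy0 : 0 ≤ y) (hy1 : y ≤ 1)
    (h : qt (toC ∘ v) i x = qt (toC ∘ v) j y) :
    (j = i + 1 ∧ x = 1 ∧ y = 0) ∨ (i = j + 1 ∧ x = 0 ∧ y = 1) := by
  obtain ⟨-, hne, hadj, hdisj⟩ := hP
  have adj : ∀ (i : ZMod n) (x y : ℝ), 0 ≤ x → x ≤ 1 → 0 ≤ y → y ≤ 1 →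
      qt (toC ∘ v) i x = qt (toC ∘ v) (i + 1) y → x = 1 ∧ y = 0 := by
    intro i x y hx0 hx1 hy0 hy1 h
    have m : toC.symm (qt (toC ∘ v) i x) ∈
        segment ℝ (v i) (v (i + 1)) ∩ segment ℝ (v (i + 1)) (v (i + 2)) := by
      refine ⟨mem_edge_iff.2 ⟨x, ⟨hx0, hx1⟩, by simp⟩, ?_⟩
      rw [show i + 2 = i + 1 + 1 by ring]
      exact mem_edge_iff.2 ⟨y, ⟨hy0, hy1⟩, by simpa using h⟩
    rw [hadj i, Set.mem_singleton_iff, LinearEquiv.symm_apply_eq] at m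
    have m' := h.symm.trans m
    rw [qt_eq_lineMap, toC.injective.eq_iff] at m m'
    constructor
    · have : (x - 1) • (v (i + 1) - v i) = 0 := by
        rw [sub_smul, one_smul, sub_eq_zero]; exact eq_sub_of_add_eq' m
      have := (smul_eq_zero.1 this).resolve_right (sub_ne_zero.2 (hne i).symm)
      linarith
    · have : y • (v (i + 1 + 1) - v (i + 1)) = 0 := by simpa using m'
      exact (smul_eq_zero.1 this).resolve_right (sub_ne_zero.2 (hne _).symm)
  by_cases h1 : j = i + 1
  · subst h1
    exact Or.inl ⟨rfl, adj i x y hx0 hx1 hy0 hy1 h⟩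
  by_cases h2 : i = j + 1
  · subst h2
    exact Or.inr ⟨rfl, (adj j y x hy0 hy1 hx0 hx1 h.symm).symm⟩
  have : toC.symm (qt (toC ∘ v) i x) ∈
      segment ℝ (v i) (v (i + 1)) ∩ segment ℝ (v j) (v (j + 1)) :=
    ⟨mem_edge_iff.2 ⟨x, ⟨hx0, hx1⟩, by simp⟩, mem_edge_iff.2 ⟨y, ⟨hy0, hy1⟩, by simpa using h⟩⟩
  rw [hdisj i j hij h2 h1] at this
  exact this.elim

/-- Points of the complex polygon come from points of the polygon. -/
lemma exists_mem_polygonSet {i : ZMod n} {x : ℝ} (hx : 0 ≤ x ∧ x ≤ 1) :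
    ∃ a ∈ polygonSet v, toC a = qt (toC ∘ v) i x :=
  ⟨toC.symm (qt (toC ∘ v) i x), mem_polygonSet_iff.2 ⟨i, x, hx, by simp⟩, by simp⟩

/-- A square on the complex polygon comes from an inscribed square. -/
lemma exists_inscribedSquare {i k j l : ZMod n} {x : Fin 4 → ℝ} (hx : ∀ r, 0 ≤ x r ∧ x r ≤ 1)
    (hne : qt (toC ∘ v) i (x 0) ≠ qt (toC ∘ v) k (x 2))
    (hs : SqRel (qt (toC ∘ v) i (x 0)) (qt (toC ∘ v) k (x 2)) (qt (toC ∘ v) j (x 1))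
      (qt (toC ∘ v) l (x 3))) :
    ∃ a₁ a₂ a₃ a₄, InscribedSquare (polygonSet v) a₁ a₂ a₃ a₄ ∧ toC a₁ = qt (toC ∘ v) i (x 0) ∧
      toC a₂ = qt (toC ∘ v) l (x 3) ∧ toC a₃ = qt (toC ∘ v) k (x 2) ∧
      toC a₄ = qt (toC ∘ v) j (x 1) := by
  obtain ⟨a₁, m₁, e₁⟩ := exists_mem_polygonSet (v := v) (i := i) (hx 0)
  obtain ⟨a₂, m₂, e₂⟩ := exists_mem_polygonSet (v := v) (i := l) (hx 3)
  obtain ⟨a₃, m₃, e₃⟩ := exists_mem_polygonSet (v := v) (i := k) (hx 2)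
  obtain ⟨a₄, m₄, e₄⟩ := exists_mem_polygonSet (v := v) (i := j) (hx 1)
  refine ⟨a₁, a₂, a₃, a₄, inscribedSquare_iff.2 ⟨⟨m₁, m₂, m₃, m₄⟩, ?_, ?_⟩, e₁, e₂, e₃, e₄⟩
  · rwa [e₁, e₃]
  · rwa [e₁, e₂, e₃, e₄]

/-- The hypotheses on a polygon carry over to the complex plane. -/
lemma genPoly_of_generic (hP : IsSimplePolygon v)
    (hpar : ∀ i j : ZMod n, i ≠ j →
      ¬ ∃ c : ℝ, v (i + 1) - v i = c • (v (j + 1) - v j))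
    (hgen : ∀ a₁ a₂ a₃ a₄ : Pt, InscribedSquare (polygonSet v) a₁ a₂ a₃ a₄ →
      ∃ i₁ i₂ i₃ i₄ : ZMod n,
        i₁ ≠ i₂ ∧ i₁ ≠ i₃ ∧ i₁ ≠ i₄ ∧ i₂ ≠ i₃ ∧ i₂ ≠ i₄ ∧ i₃ ≠ i₄ ∧
        a₁ ∈ openSegment ℝ (v i₁) (v (i₁ + 1)) ∧
        a₂ ∈ openSegment ℝ (v i₂) (v (i₂ + 1)) ∧
        a₃ ∈ openSegment ℝ (v i₃) (v (i₃ + 1)) ∧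
        a₄ ∈ openSegment ℝ (v i₄) (v (i₄ + 1)))
    (hfin : {s : Set Pt | ∃ a₁ a₂ a₃ a₄ : Pt,
      InscribedSquare (polygonSet v) a₁ a₂ a₃ a₄ ∧ s = {a₁, a₂, a₃, a₄}}.Finite) :
    GenPoly (toC ∘ v) where
  three := hP.1
  simple := hP.simple
  crs_ne i j hij h := by
    have hj : toC (v (j + 1)) - toC (v j) ≠ 0 :=
      sub_ne_zero.2 (toC.injective.ne (hP.2.1 j).symm)
    obtain ⟨c, hc⟩ := exists_real_smul_of_crs_eq_zero hj h
    exact hpar i j hij ⟨c, toC.injective (by simpa using hc)⟩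
  gen i k j l x hx hne hs := by
    obtain ⟨a₁, a₂, a₃, a₄, hA, e₁, e₂, e₃, e₄⟩ := exists_inscribedSquare hx hne hs
    obtain ⟨i₁, i₂, i₃, i₄, n12, n13, n14, n23, n24, n34, o₁, o₂, o₃, o₄⟩ := hgen _ _ _ _ hA
    have key : ∀ {a : Pt} {p q : ZMod n} {x : ℝ}, (0 ≤ x ∧ x ≤ 1) → toC a = qt (toC ∘ v) p x →
        a ∈ openSegment ℝ (v q) (v (q + 1)) → p = q ∧ 0 < x ∧ x < 1 := by
      intro a p q x hx h ho
      obtain ⟨y, hy, h'⟩ := mem_openEdge_iff.1 ho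
      have hpq : p = q := by
        by_contra hpq
        rcases hP.simple p q hpq x y hx.1 hx.2 hy.1.le hy.2.le (h.symm.trans h') with
          ⟨-, -, h⟩ | ⟨-, -, h⟩
        · exact hy.1.ne' h
        · exact hy.2.ne h
      subst hpq
      have : x = y := by
        rw [h, qt_eq_lineMap, qt_eq_lineMap, toC.injective.eq_iff, add_right_inj] at h'
        exact smul_left_injective ℝ (sub_ne_zero.2 (hP.2.1 p).symm) h'
      exact ⟨rfl, this ▸ hy⟩
    obtain ⟨rfl, x0⟩ := key (hx 0) e₁ o₁
    obtain ⟨rfl, x3⟩ := key (hx 3) e₂ o₂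
    obtain ⟨rfl, x2⟩ := key (hx 2) e₃ o₃
    obtain ⟨rfl, x1⟩ := key (hx 1) e₄ o₄
    refine ⟨?_, n13, n14, n12, n34, n23.symm, n24.symm⟩
    simp [Fin.forall_fin_succ, x0, x1, x2, x3]
  fin := by
    refine Set.Finite.subset ((Set.Finite.sUnion hfin ?_).image toC) ?_
    · rintro s ⟨a₁, a₂, a₃, a₄, -, rfl⟩
      exact Set.toFinite _
    · rintro p ⟨i, k, j, l, x, hx, hne, hs, hp⟩
      obtain ⟨a₁, a₂, a₃, a₄, hA, e₁, e₂, e₃, e₄⟩ := exists_inscribedSquare hx hne hs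
      rw [← e₁, ← e₂, ← e₃, ← e₄] at hp
      have M : ∀ a ∈ ({a₁, a₂, a₃, a₄} : Set Pt), toC a ∈ toC '' ⋃₀ {s : Set Pt | ∃ a₁ a₂ a₃ a₄ : Pt,
          InscribedSquare (polygonSet v) a₁ a₂ a₃ a₄ ∧ s = {a₁, a₂, a₃, a₄}} := fun a ha =>
        ⟨a, Set.mem_sUnion.2 ⟨_, ⟨a₁, a₂, a₃, a₄, hA, rfl⟩, ha⟩, rfl⟩
      rcases hp with rfl | rfl | rfl | rfl <;> exact M _ (by simp)

lemma image_squares (H : GenPoly (toC ∘ v)) :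
    (fun s : Set Pt => toC '' s) '' {s : Set Pt | ∃ a₁ a₂ a₃ a₄ : Pt,
      InscribedSquare (polygonSet v) a₁ a₂ a₃ a₄ ∧ s = {a₁, a₂, a₃, a₄}} =
    {A : Set ℂ | ∃ i k j l, OpenSq (toC ∘ v) 0 i k j l ∧ A = sqPts (toC ∘ v) i k j l} := by
  ext A
  constructor
  · rintro ⟨_, ⟨a₁, a₂, a₃, a₄, hA, rfl⟩, rfl⟩
    obtain ⟨⟨m₁, m₂, m₃, m₄⟩, hne, hs⟩ := inscribedSquare_iff.1 hA
    obtain ⟨i, x0, b0, e₁⟩ := mem_polygonSet_iff.1 m₁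
    obtain ⟨l, x3, b3, e₂⟩ := mem_polygonSet_iff.1 m₂
    obtain ⟨k, x2, b2, e₃⟩ := mem_polygonSet_iff.1 m₃
    obtain ⟨j, x1, b1, e₄⟩ := mem_polygonSet_iff.1 m₄
    rw [e₁, e₃] at hne
    rw [e₁, e₂, e₃, e₄] at hs
    obtain ⟨hx, -⟩ := H.gen i k j l ![x0, x1, x2, x3]
      (by simp [Fin.forall_fin_succ, b0, b1, b2, b3]) (by simpa using hne) (by simpa using hs)
    refine ⟨i, k, j, l, ⟨_, hx, by simpa using hne, sqAt_zero.2 (by simpa using hs)⟩, ?_⟩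
    rw [H.sqPts_eq hx (by simpa using hne) (sqAt_zero.2 (by simpa using hs))]
    simp only [Set.image_insert_eq, Set.image_singleton, e₁, e₂, e₃, e₄]
    ext p
    simp
    tauto
  · rintro ⟨i, k, j, l, ⟨x, hx, hne, hs⟩, rfl⟩
    rw [H.sqPts_eq hx hne hs]
    rw [sqAt_zero] at hs
    obtain ⟨a₁, a₂, a₃, a₄, hA, e₁, e₂, e₃, e₄⟩ :=
      exists_inscribedSquare (fun r => ⟨(hx r).1.le, (hx r).2.le⟩) hne hs
    refine ⟨_, ⟨a₁, a₂, a₃, a₄, hA, rfl⟩, ?_⟩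
    simp only [Set.image_insert_eq, Set.image_singleton, e₁, e₂, e₃, e₄]
    ext p
    simp
    tauto

end Transfer

end Deformation

/-- A generic simple polygon (no two distinct edges on parallel or perpendicular
lines, every inscribed square has its vertices in the relative interiors of four
pairwise distinct edges, finitely many inscribed squares) has an odd number of
inscribed squares (counted as four-element vertex sets). -/
theorem odd_number_of_inscribed_squares {n : ℕ} (v : ZMod n → Pt)
    (hP : IsSimplePolygon v)
    (hpar : ∀ i j : ZMod n, i ≠ j →
      ¬ ∃ c : ℝ, v (i + 1) - v i = c • (v (j + 1) - v j))
    (hperp : ∀ i j : ZMod n, i ≠ j → ⟪v (i + 1) - v i, v (j + 1) - v j⟫ ≠ 0)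
    (hgen : ∀ a₁ a₂ a₃ a₄ : Pt, InscribedSquare (polygonSet v) a₁ a₂ a₃ a₄ →
      ∃ i₁ i₂ i₃ i₄ : ZMod n,
        i₁ ≠ i₂ ∧ i₁ ≠ i₃ ∧ i₁ ≠ i₄ ∧ i₂ ≠ i₃ ∧ i₂ ≠ i₄ ∧ i₃ ≠ i₄ ∧
        a₁ ∈ openSegment ℝ (v i₁) (v (i₁ + 1)) ∧
        a₂ ∈ openSegment ℝ (v i₂) (v (i₂ + 1)) ∧
        a₃ ∈ openSegment ℝ (v i₃) (v (i₃ + 1)) ∧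
        a₄ ∈ openSegment ℝ (v i₄) (v (i₄ + 1)))
    (hfin : {s : Set Pt | ∃ a₁ a₂ a₃ a₄ : Pt,
      InscribedSquare (polygonSet v) a₁ a₂ a₃ a₄ ∧ s = {a₁, a₂, a₃, a₄}}.Finite) :
    Odd {s : Set Pt | ∃ a₁ a₂ a₃ a₄ : Pt,
      InscribedSquare (polygonSet v) a₁ a₂ a₃ a₄ ∧ s = {a₁, a₂, a₃, a₄}}.ncard := by
  have H := genPoly_of_generic hP hpar hgen hfin
  have h := H.odd_squares
  rwa [← image_squares H, Set.ncard_image_of_injective _ toC.injective.image_injective] at h
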